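/- Let (u,m) be the classical solution of the MFG system. Then there exists a constant C>0, depending only on the coefficients of the problem (and not on a, b, v, ρ), such that for every a ∈ C⁰(Q), every vector field b ∈ C⁰(Q;ℝ^d), and every classical solution (v,ρ) of the perturbed linearized system (i) -∂_t v - Δv + H_p(x,m,Du)·Dv + H_m(x,m,Du)ρ = f'(m)ρ + a(x,t) in Q, (ii) ∂_t ρ - Δρ - div(ρ·H_p(x,m,Du)) - div(m·ρ·H_{pm}(x,m,Du)) = div(m·H_{pp}(x,m,Du)Dv) + div(b(x,t)) in Q, with ρ(x,0)=0 and v(x,T)=0, one has ‖v‖_{C^{1,0}(Q)} + ‖ρ‖_{C⁰(Q)} ≤ C(‖a‖_{C⁰(Q)} + ‖b‖_{C⁰(Q)}). -/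

import Mathlib

open Set MeasureTheory
open scoped RealInnerProductSpace

noncomputable section

/-- Euclidean space ℝ^d, used as the universal cover of the flat torus 𝕋^d. -/
abbrev Ed (d : ℕ) : Type := EuclideanSpace ℝ (Fin d)

variable {d : ℕ}

/-- The `i`-th unit coordinate vector of ℝ^d. -/
def ebasis (d : ℕ) (i : Fin d) : Ed d := EuclideanSpace.single i 1

/-- Second spatial partial derivative `∂²f/∂xᵢ∂xⱼ`. -/
def partial2 (f : Ed d → ℝ) (i j : Fin d) (x : Ed d) : ℝ :=
  fderiv ℝ (fun y => fderiv ℝ f y (ebasis d j)) x (ebasis d i)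

/-- Laplacian in the space variable. -/
def lap (f : Ed d → ℝ) (x : Ed d) : ℝ := ∑ i, partial2 f i i x

/-- Divergence of a vector field in the space variable. -/
def diverg (F : Ed d → Ed d) (x : Ed d) : ℝ :=
  ∑ i, ⟪fderiv ℝ F x (ebasis d i), ebasis d i⟫

/-- Spatial gradient. -/
def sgrad (f : Ed d → ℝ) (x : Ed d) : Ed d := gradient f x

/-- ℤ^d-periodicity: a function on ℝ^d descending to the flat torus 𝕋^d. -/
def ZPeriodic (f : Ed d → ℝ) : Prop :=
  ∀ (x : Ed d) (i : Fin d), f (x + ebasis d i) = f x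

/-- Time derivative within the time interval `[0,T]`. -/
def tderiv (T : ℝ) (w : ℝ → Ed d → ℝ) (t : ℝ) (x : Ed d) : ℝ :=
  derivWithin (fun s => w s x) (Icc 0 T) t

/-- `w` is bounded and parabolically `a`-Hölder on `Q = 𝕋^d × [0,T]`. -/
def HolderBddQ (T a : ℝ) (w : ℝ → Ed d → ℝ) : Prop :=
  ∃ C : ℝ, (∀ t ∈ Icc (0:ℝ) T, ∀ x : Ed d, |w t x| ≤ C) ∧
    ∀ t ∈ Icc (0:ℝ) T, ∀ s ∈ Icc (0:ℝ) T, ∀ x y : Ed d,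
      |w t x - w s y| ≤ C * (‖x - y‖ ^ 2 + |t - s|) ^ (a / 2)

/-- Membership in the parabolic Hölder space `C^{2+a,1+a/2}(Q)` (including
ℤ^d-periodicity in the space variable): `w` is C² in space, differentiable in
time, and `w`, `Dw`, `D²w`, `∂ₜw` are bounded and parabolically Hölder. -/
def InC2alpha (T a : ℝ) (w : ℝ → Ed d → ℝ) : Prop :=
  (∀ t ∈ Icc (0:ℝ) T, ZPeriodic (w t)) ∧
  (∀ t ∈ Icc (0:ℝ) T, ContDiff ℝ 2 (w t)) ∧
  (∀ x : Ed d, DifferentiableOn ℝ (fun s => w s x) (Icc 0 T)) ∧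
  HolderBddQ T a w ∧
  (∀ i : Fin d, HolderBddQ T a fun t x => ⟪sgrad (w t) x, ebasis d i⟫) ∧
  (∀ i j : Fin d, HolderBddQ T a fun t x => partial2 (w t) i j x) ∧
  HolderBddQ T a fun t x => tderiv T w t x

/-- Membership in `C^{2+a}(𝕋^d)` for time-independent functions. -/
def InC2alphaSpace (a : ℝ) (g : Ed d → ℝ) : Prop :=
  ZPeriodic g ∧ ContDiff ℝ 2 g ∧
  ∃ C : ℝ, ∀ (i j : Fin d) (x y : Ed d),
    |partial2 g i j x - partial2 g i j y| ≤ C * ‖x - y‖ ^ a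

/-- The fundamental domain `[0,1)^d` of the torus, used for integration. -/
def cube (d : ℕ) : Set (Ed d) := {x : Ed d | ∀ i, x i ∈ Ico (0:ℝ) 1}

/-- `H_p`: gradient of `H = H(x,m,p)` in `p`. -/
def HamP (H : Ed d → ℝ → Ed d → ℝ) (x : Ed d) (m : ℝ) (p : Ed d) : Ed d :=
  gradient (H x m) p

/-- `H_m`: derivative of `H = H(x,m,p)` in `m`. -/
def HamM (H : Ed d → ℝ → Ed d → ℝ) (x : Ed d) (m : ℝ) (p : Ed d) : ℝ :=
  deriv (fun s => H x s p) m

/-- `H_pm`: gradient in `p` of `H_m`. -/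
def HamPM (H : Ed d → ℝ → Ed d → ℝ) (x : Ed d) (m : ℝ) (p : Ed d) : Ed d :=
  gradient (fun q => HamM H x m q) p

/-- `H_pp`: Hessian of `H` in `p`, as a continuous linear map. -/
def HamPP (H : Ed d → ℝ → Ed d → ℝ) (x : Ed d) (m : ℝ) (p : Ed d) :
    Ed d →L[ℝ] Ed d :=
  fderiv ℝ (fun q => HamP H x m q) p

/-- `H_mm`: second derivative of `H` in `m`. -/
def HamMM (H : Ed d → ℝ → Ed d → ℝ) (x : Ed d) (m : ℝ) (p : Ed d) : ℝ :=
  deriv (fun s => HamM H x s p) m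

/-- Assumption (A1): `m₀ ∈ C^{2+a}(𝕋^d)` is a probability density with
`m₀ ≥ ϑ > 0`, and `u_T ∈ C^{2+a}(𝕋^d)`. -/
def A1 (a ϑ : ℝ) (m0 uT : Ed d → ℝ) : Prop :=
  InC2alphaSpace a m0 ∧ InC2alphaSpace a uT ∧ (∀ x, ϑ ≤ m0 x) ∧
  (∫ x in cube d, m0 x) = 1

/-- Assumption (A2): `H ∈ C⁴(𝕋^d × (0,∞) × ℝ^d)`, the growth bounds
`|H_px| ≤ C̄(|p|+1)`, `|H_xx| + |H_xxm| ≤ C̄(|p|²+1)`, `|H_mp| ≤ C̄|p|`,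
`|H_mm| ≤ C̄|p|²`, `|H_pp| + |H_ppm| ≤ C̄`, `|H_ppp| + |H_pppm| ≤ C̄`, and the
Hessian-type monotonicity condition: for every `m > 0` the block matrix
`[[-H_m, (m/2)H_pmᵀ],[(m/2)H_pm, m·H_pp]]` is positive definite, expressed via
its quadratic form on `(r,q) ∈ ℝ × ℝ^d`. -/
def A2 (H : Ed d → ℝ → Ed d → ℝ) : Prop :=
  ContDiffOn ℝ 4 (fun q : Ed d × ℝ × Ed d => H q.1 q.2.1 q.2.2)
    {q : Ed d × ℝ × Ed d | 0 < q.2.1} ∧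
  (∃ Cb : ℝ, 0 < Cb ∧ ∀ (x : Ed d) (m : ℝ), 0 < m → ∀ p : Ed d,
    ‖fderiv ℝ (fun y => HamP H y m p) x‖ ≤ Cb * (‖p‖ + 1) ∧
    ‖iteratedFDeriv ℝ 2 (fun y => H y m p) x‖ +
        ‖iteratedFDeriv ℝ 2 (fun y => HamM H y m p) x‖ ≤ Cb * (‖p‖ ^ 2 + 1) ∧
    ‖HamPM H x m p‖ ≤ Cb * ‖p‖ ∧
    |HamMM H x m p| ≤ Cb * ‖p‖ ^ 2 ∧
    ‖HamPP H x m p‖ + ‖fderiv ℝ (fun q => HamPM H x m q) p‖ ≤ Cb ∧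
    ‖iteratedFDeriv ℝ 3 (fun q => H x m q) p‖ +
        ‖iteratedFDeriv ℝ 3 (fun q => HamM H x m q) p‖ ≤ Cb) ∧
  (∀ (x : Ed d) (m : ℝ), 0 < m → ∀ p : Ed d, ∀ (r : ℝ) (q : Ed d),
    ¬(r = 0 ∧ q = 0) →
    0 < -HamM H x m p * r ^ 2 + m * ⟪HamPM H x m p, q⟫ * r +
        m * ⟪HamPP H x m p q, q⟫)

/-- Assumption (A3): `f ∈ C²((0,∞))` with `f, f', f''` uniformly bounded and
`f' ≥ 0`. -/
def A3 (f : ℝ → ℝ) : Prop :=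
  ContDiffOn ℝ 2 f (Ioi 0) ∧
  (∃ C : ℝ, ∀ m : ℝ, 0 < m →
    |f m| ≤ C ∧ |deriv f m| ≤ C ∧ |deriv (deriv f) m| ≤ C) ∧
  (∀ m : ℝ, 0 < m → 0 ≤ deriv f m)

/-- The MFG system with non-separable Hamiltonian and local coupling,
satisfied pointwise on `Q = 𝕋^d × [0,T]`:
(i)  `-∂ₜu - Δu + H(x,m,Du) = f(m)`;
(ii) `∂ₜm - Δm - div(m·H_p(x,m,Du)) = 0`;
with `m(·,0) = m₀` and `u(·,T) = u_T`. -/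
def SolvesMFG (T : ℝ) (H : Ed d → ℝ → Ed d → ℝ) (f : ℝ → ℝ)
    (m0 uT : Ed d → ℝ) (u m : ℝ → Ed d → ℝ) : Prop :=
  (∀ t ∈ Icc (0:ℝ) T, ∀ x : Ed d,
    -tderiv T u t x - lap (u t) x + H x (m t x) (sgrad (u t) x) = f (m t x)) ∧
  (∀ t ∈ Icc (0:ℝ) T, ∀ x : Ed d,
    tderiv T m t x - lap (m t) x -
      diverg (fun y => m t y • HamP H y (m t y) (sgrad (u t) y)) x = 0) ∧
  (∀ x : Ed d, m 0 x = m0 x) ∧ (∀ x : Ed d, u T x = uT x)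

lemma ebasis_norm (i : Fin d) : ‖ebasis d i‖ = 1 := by simp [ebasis]

lemma inner_ebasis (x : Ed d) (i : Fin d) : ⟪x, ebasis d i⟫ = x i := by
  simp [ebasis, EuclideanSpace.inner_single_right]

lemma diverg_eq (F : Ed d → Ed d) (x : Ed d) :
    diverg F x = ∑ i, (fderiv ℝ F x (ebasis d i)) i := by
  simp only [diverg, inner_ebasis]

lemma diverg_zero_of_far (F : Ed d → Ed d) (R : ℝ) (hR : ∀ x, R < ‖x‖ → F x = 0) (x : Ed d)
    (hx : R < ‖x‖) : diverg F x = 0 := by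
  have h : F =ᶠ[nhds x] fun _ => 0 := by
    filter_upwards [(isOpen_lt continuous_const continuous_norm).mem_nhds hx] with y hy
    exact hR y hy
  simp [diverg, h.fderiv_eq]

lemma integral_diverg_zero (hd : 1 ≤ d) (F : Ed d → Ed d) (hF : Differentiable ℝ F)
    (hdiv : Continuous (diverg F)) (R : ℝ) (hR : ∀ x, R < ‖x‖ → F x = 0) :
    ∫ x, diverg F x = 0 := by
  obtain ⟨n, rfl⟩ : ∃ n, d = n + 1 := ⟨d - 1, by omega⟩
  set eL : Ed (n+1) ≃L[ℝ] (Fin (n+1) → ℝ) := PiLp.continuousLinearEquiv 2 ℝ (fun _ : Fin (n+1) => ℝ)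
    with heL
  set c : ℝ := |R| + 1 with hc
  have hc0 : 0 < c := by positivity
  have hcR : R < c := by have := le_abs_self R; linarith
  have hcoord : ∀ (y : Fin (n+1) → ℝ) (i), |y i| ≤ ‖eL.symm y‖ := fun y i => by
    have := PiLp.norm_apply_le (eL.symm y) i
    simpa [heL] using this
  have hfar : ∀ (y : Fin (n+1) → ℝ) (i), c ≤ |y i| → F (eL.symm y) = 0 := fun y i h =>
    hR _ (by linarith [hcoord y i])
  have key := integral_divergence_of_hasFDerivAt_off_countable' (E := ℝ) (n := n)
    (fun _ => -c) (fun _ => c) (fun _ => by linarith)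
    (fun i y => F (eL.symm y) i)
    (fun i y => ((EuclideanSpace.proj i : Ed (n+1) →L[ℝ] ℝ).comp
      (fderiv ℝ F (eL.symm y))).comp (eL.symm : (Fin (n+1) → ℝ) →L[ℝ] Ed (n+1)))
    ∅ Set.countable_empty ?_ ?_ ?_
  · have hsum : ∀ y : Fin (n+1) → ℝ, (∑ i, (((EuclideanSpace.proj i : Ed (n+1) →L[ℝ] ℝ).comp
      (fderiv ℝ F (eL.symm y))).comp (eL.symm : (Fin (n+1) → ℝ) →L[ℝ] Ed (n+1)))
        (Pi.single i 1)) = diverg F (eL.symm y) := fun y => by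
      rw [diverg_eq]; rfl
    simp only [hsum] at key
    have hz : ∀ (i : Fin (n+1)) (x : Fin n → ℝ) (z : ℝ), |z| = c →
        F (eL.symm (i.insertNth z x)) i = 0 := fun i x z h => by
      rw [hfar _ i (by simp [h])]; rfl
    have h1 : ∀ (i : Fin (n+1)) (x : Fin n → ℝ), F (eL.symm (i.insertNth c x)) i = 0 :=
      fun i x => hz i x c (abs_of_pos hc0)
    have h2 : ∀ (i : Fin (n+1)) (x : Fin n → ℝ), F (eL.symm (i.insertNth (-c) x)) i = 0 :=
      fun i x => hz i x (-c) (by rw [abs_neg, abs_of_pos hc0])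
    simp only [h1, h2, integral_zero, sub_self, Finset.sum_const_zero] at key
    rw [setIntegral_eq_integral_of_forall_compl_eq_zero] at key
    · rw [← key]
      have := (EuclideanSpace.volume_preserving_symm_measurableEquiv_toLp (Fin (n+1))).symm
      have h3 := this.integral_comp' (g := diverg F)
      rw [← h3]; rfl
    · intro y hy
      apply diverg_zero_of_far F R hR
      have : ∃ i, c < |y i| := by
        by_contra hcon
        push Not at hcon
        exact hy ⟨fun i => (abs_le.1 (hcon i)).1, fun i => (abs_le.1 (hcon i)).2⟩
      obtain ⟨i, hi⟩ := this
      linarith [hcoord y i]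
  · intro i
    apply Continuous.continuousOn
    have := hF.continuous
    fun_prop
  · intro y _ i
    have h1 := (hF (eL.symm y)).hasFDerivAt
    have h2 : HasFDerivAt (fun y => F (eL.symm y)) ((fderiv ℝ F (eL.symm y)).comp
      (eL.symm : (Fin (n+1) → ℝ) →L[ℝ] Ed (n+1))) y := h1.comp y eL.symm.hasFDerivAt
    exact ((EuclideanSpace.proj i : Ed (n+1) →L[ℝ] ℝ).hasFDerivAt.comp y h2)
  · apply ContinuousOn.integrableOn_Icc
    apply Continuous.continuousOn
    have : (fun y : Fin (n+1) → ℝ => ∑ i, (((EuclideanSpace.proj i : Ed (n+1) →L[ℝ] ℝ).comp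
      (fderiv ℝ F (eL.symm y))).comp (eL.symm : (Fin (n+1) → ℝ) →L[ℝ] Ed (n+1)))
        (Pi.single i 1)) = fun y => diverg F (eL.symm y) := by
      funext y; rw [diverg_eq]; rfl
    rw [this]
    exact hdiv.comp eL.symm.continuous

lemma fderiv_eq_inner_sgrad (f : Ed d → ℝ) (x e : Ed d) (_hf : DifferentiableAt ℝ f x) :
    fderiv ℝ f x e = ⟪sgrad f x, e⟫ := by
  simp [sgrad, gradient, InnerProductSpace.toDual_symm_apply]

lemma diverg_smul (ψ : Ed d → ℝ) (F : Ed d → Ed d) (x : Ed d) (hψ : DifferentiableAt ℝ ψ x)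
    (hF : DifferentiableAt ℝ F x) :
    diverg (fun y => ψ y • F y) x = ψ x * diverg F x + ⟪sgrad ψ x, F x⟫ := by
  have h := (hψ.hasFDerivAt.smul hF.hasFDerivAt).fderiv
  have h' : fderiv ℝ (fun y => ψ y • F y) x = ψ x • fderiv ℝ F x +
    (fderiv ℝ ψ x).smulRight (F x) := h
  rw [diverg_eq, diverg_eq, h']
  rw [PiLp.inner_apply]
  rw [Finset.mul_sum, ← Finset.sum_add_distrib]
  refine Finset.sum_congr rfl fun i _ => ?_
  have : sgrad ψ x i = fderiv ℝ ψ x (ebasis d i) := by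
    rw [fderiv_eq_inner_sgrad _ _ _ hψ, inner_ebasis]
  simp [this, mul_comm]

lemma diverg_add (F G : Ed d → Ed d) (x : Ed d)
    (hF : DifferentiableAt ℝ F x) (hG : DifferentiableAt ℝ G x) :
    diverg (fun y => F y + G y) x = diverg F x + diverg G x := by
  have : fderiv ℝ (fun y => F y + G y) x = fderiv ℝ F x + fderiv ℝ G x := fderiv_add hF hG
  simp [diverg, this, inner_add_left, Finset.sum_add_distrib]

/-- Functions that are continuous and vanish far away. -/
def CS (f : Ed d → ℝ) : Prop := Continuous f ∧ ∃ R : ℝ, ∀ x, R < ‖x‖ → f x = 0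

lemma CS.integrable {f : Ed d → ℝ} (h : CS f) : Integrable f := by
  obtain ⟨hc, R, hR⟩ := h
  apply hc.integrable_of_hasCompactSupport
  apply HasCompactSupport.intro (isCompact_closedBall (0 : Ed d) R)
  intro x hx
  apply hR
  simpa using hx

lemma CS.mul_left {f g : Ed d → ℝ} (h : CS f) (hg : Continuous g) : CS (fun x => g x * f x) :=
  ⟨hg.mul h.1, h.2.imp fun R hR x hx => by simp [hR x hx]⟩

lemma CS.mul_right {f g : Ed d → ℝ} (h : CS f) (hg : Continuous g) : CS (fun x => f x * g x) :=
  ⟨h.1.mul hg, h.2.imp fun R hR x hx => by simp [hR x hx]⟩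

lemma CS.add {f g : Ed d → ℝ} (h : CS f) (hg : CS g) : CS (fun x => f x + g x) := by
  obtain ⟨hc, R, hR⟩ := h
  obtain ⟨hc', R', hR'⟩ := hg
  refine ⟨hc.add hc', max R R', fun x hx => ?_⟩
  rw [max_lt_iff] at hx
  simp [hR x hx.1, hR' x hx.2]

lemma CS.neg {f : Ed d → ℝ} (h : CS f) : CS (fun x => - f x) :=
  ⟨h.1.neg, h.2.imp fun R hR x hx => by simp [hR x hx]⟩

lemma CS.sub {f g : Ed d → ℝ} (h : CS f) (hg : CS g) : CS (fun x => f x - g x) := by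
  simpa [sub_eq_add_neg] using h.add hg.neg

/-- null divergence lemma -/
lemma null_div (hd : 1 ≤ d) (ψ : Ed d → ℝ) (F : Ed d → Ed d) (hψ : ContDiff ℝ 1 ψ)
    (hF : Differentiable ℝ F) (hdiv : Continuous (diverg F))
    (hR : ∃ R : ℝ, ∀ x, R < ‖x‖ → ψ x • F x = 0) :
    CS (fun x => ψ x * diverg F x + ⟪sgrad ψ x, F x⟫) ∧
    ∫ x, (ψ x * diverg F x + ⟪sgrad ψ x, F x⟫) = 0 := by
  have hψd : Differentiable ℝ ψ := hψ.differentiable one_ne_zero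
  have heq : diverg (fun y => ψ y • F y) = fun x => ψ x * diverg F x + ⟪sgrad ψ x, F x⟫ :=
    funext fun x => diverg_smul ψ F x (hψd x) (hF x)
  have hgc : Continuous (sgrad ψ) := by
    have h1 : Continuous (fderiv ℝ ψ) := hψ.continuous_fderiv one_ne_zero
    exact (InnerProductSpace.toDual ℝ (Ed d)).symm.continuous.comp h1
  have hcont : Continuous (fun x => ψ x * diverg F x + ⟪sgrad ψ x, F x⟫) :=
    (hψ.continuous.mul hdiv).add (hgc.inner hF.continuous)
  obtain ⟨R, hR⟩ := hR
  refine ⟨⟨hcont, R, fun x hx => ?_⟩, ?_⟩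
  · have := diverg_zero_of_far _ R hR x hx
    rwa [heq] at this
  · have := integral_diverg_zero hd (fun y => ψ y • F y) (hψd.smul hF)
      (by rw [heq]; exact hcont) R hR
    rwa [heq] at this

lemma sgrad_contDiff {f : Ed d → ℝ} (hf : ContDiff ℝ 2 f) : ContDiff ℝ 1 (sgrad f) := by
  have h1 : ContDiff ℝ 1 (fderiv ℝ f) := hf.fderiv_right (by norm_num)
  exact (InnerProductSpace.toDual ℝ (Ed d)).symm.contDiff.comp h1

lemma sgrad_continuous {f : Ed d → ℝ} (hf : ContDiff ℝ 1 f) : Continuous (sgrad f) := by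
  have h1 : Continuous (fderiv ℝ f) := hf.continuous_fderiv one_ne_zero
  exact (InnerProductSpace.toDual ℝ (Ed d)).symm.continuous.comp h1

lemma partial2_eq {f : Ed d → ℝ} (hf : ContDiff ℝ 2 f) (i j : Fin d) (x : Ed d) :
    partial2 f i j x = (fderiv ℝ (sgrad f) x (ebasis d i)) j := by
  have hd : Differentiable ℝ f := hf.differentiable two_ne_zero
  have : (fun y => fderiv ℝ f y (ebasis d j)) = fun y => (sgrad f y) j := by
    funext y; rw [fderiv_eq_inner_sgrad _ _ _ (hd y), inner_ebasis]
  unfold partial2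
  rw [this]
  have h2 : HasFDerivAt (fun y => (sgrad f y) j) ((EuclideanSpace.proj j : Ed d →L[ℝ] ℝ).comp
      (fderiv ℝ (sgrad f) x)) x :=
    (EuclideanSpace.proj j : Ed d →L[ℝ] ℝ).hasFDerivAt.comp x
      ((sgrad_contDiff hf).differentiable one_ne_zero x).hasFDerivAt
  rw [h2.fderiv]; rfl

lemma diverg_sgrad {f : Ed d → ℝ} (hf : ContDiff ℝ 2 f) (x : Ed d) :
    diverg (sgrad f) x = lap f x := by
  rw [diverg_eq, lap]
  exact Finset.sum_congr rfl fun i _ => (partial2_eq hf i i x).symm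

lemma diverg_continuous {F : Ed d → Ed d} (hF : ContDiff ℝ 1 F) : Continuous (diverg F) := by
  have h1 : Continuous (fderiv ℝ F) := hF.continuous_fderiv one_ne_zero
  unfold diverg
  fun_prop

lemma lap_continuous {f : Ed d → ℝ} (hf : ContDiff ℝ 2 f) : Continuous (lap f) := by
  have := diverg_continuous (sgrad_contDiff hf)
  rwa [show diverg (sgrad f) = lap f from funext (diverg_sgrad hf)] at this

lemma null_lap (hd : 1 ≤ d) (ψ g : Ed d → ℝ) (hψ : ContDiff ℝ 1 ψ)
    (hg : ContDiff ℝ 2 g) (hR : ∃ R : ℝ, ∀ x, R < ‖x‖ → ψ x • sgrad g x = 0) :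
    CS (fun x => ψ x * lap g x + ⟪sgrad ψ x, sgrad g x⟫) ∧
    ∫ x, (ψ x * lap g x + ⟪sgrad ψ x, sgrad g x⟫) = 0 := by
  have := null_div hd ψ (sgrad g) hψ ((sgrad_contDiff hg).differentiable one_ne_zero)
    (diverg_continuous (sgrad_contDiff hg)) hR
  simpa only [diverg_sgrad hg] using this

lemma sgrad_mul {f g : Ed d → ℝ} {x : Ed d} (hf : DifferentiableAt ℝ f x)
    (hg : DifferentiableAt ℝ g x) :
    sgrad (fun y => f y * g y) x = f x • sgrad g x + g x • sgrad f x := by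
  have : fderiv ℝ (fun y => f y * g y) x = f x • fderiv ℝ g x + g x • fderiv ℝ f x :=
    fderiv_mul hf hg
  simp [sgrad, gradient, this]

lemma sgrad_zero_of_far (f : Ed d → ℝ) (R : ℝ) (hR : ∀ x, R < ‖x‖ → f x = 0) (x : Ed d)
    (hx : R < ‖x‖) : sgrad f x = 0 := by
  have h : f =ᶠ[nhds x] fun _ => 0 := by
    filter_upwards [(isOpen_lt continuous_const continuous_norm).mem_nhds hx] with y hy
    exact hR y hy
  simp [sgrad, gradient, h.fderiv_eq]

lemma time_ftc (t0 t1 : ℝ) (h : t0 ≤ t1) (G G' : ℝ → Ed d → ℝ) (R : ℝ)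
    (hc : ContinuousOn (fun q : ℝ × Ed d => G q.1 q.2) (Icc t0 t1 ×ˢ univ))
    (hc' : ContinuousOn (fun q : ℝ × Ed d => G' q.1 q.2) (Icc t0 t1 ×ˢ univ))
    (hder : ∀ t ∈ Ioo t0 t1, ∀ x, HasDerivAt (fun s => G s x) (G' t x) t)
    (hR : ∀ t ∈ Icc t0 t1, ∀ x, R < ‖x‖ → G t x = 0)
    (hR' : ∀ t ∈ Icc t0 t1, ∀ x, R < ‖x‖ → G' t x = 0) :
    IntervalIntegrable (fun t => ∫ x, G' t x) volume t0 t1 ∧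
    ∫ t in t0..t1, ∫ x, G' t x = (∫ x, G t1 x) - ∫ x, G t0 x := by
  set K := Metric.closedBall (0 : Ed d) R with hK
  have hKc : IsCompact K := isCompact_closedBall _ _
  set c : ℝ → ℝ := fun t => (projIcc t0 t1 h t : ℝ) with hcdef
  have hcc : Continuous c := continuous_subtype_val.comp continuous_projIcc
  have hcm : ∀ t, c t ∈ Icc t0 t1 := fun t => (projIcc t0 t1 h t).2
  have hce : ∀ t ∈ Icc t0 t1, c t = t := fun t ht => by
    simp only [hcdef]; rw [projIcc_of_mem h ht]
  set G2 : ℝ → Ed d → ℝ := fun t x => G' (c t) x with hG2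
  have hG2c : Continuous (fun q : ℝ × Ed d => G2 q.1 q.2) := by
    have := hc'.comp_continuous (f := fun q : ℝ × Ed d => (c q.1, q.2)) (by fun_prop)
      (fun q => ⟨hcm _, mem_univ _⟩)
    exact this
  have hxK : ∀ x, x ∉ K → R < ‖x‖ := fun x hx => by simpa [hK] using hx
  have hitg : ∀ t ∈ Icc t0 t1, ∫ x, G' t x = ∫ x in K, G2 t x := fun t ht => by
    rw [← setIntegral_eq_integral_of_forall_compl_eq_zero (s := K)
      (fun x hx => hR' t ht x (hxK x hx))]
    simp only [hG2, hce t ht]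
  have hcont : Continuous (fun t => ∫ x in K, G2 t x) :=
    continuous_parametric_integral_of_continuous (f := G2) hG2c hKc
  have hu : uIcc t0 t1 = Icc t0 t1 := uIcc_of_le h
  refine ⟨?_, ?_⟩
  · refine (hcont.intervalIntegrable t0 t1).congr ?_
    intro t ht
    rw [uIoc_of_le h] at ht
    exact (hitg t ⟨ht.1.le, ht.2⟩).symm
  · have e1 : ∫ t in t0..t1, ∫ x, G' t x = ∫ t in t0..t1, ∫ x in K, G2 t x := by
      apply intervalIntegral.integral_congr
      intro t ht
      rw [hu] at ht
      exact hitg t ht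
    have e2 : ∫ t in t0..t1, ∫ x in K, G2 t x = ∫ x in K, ∫ t in t0..t1, G2 t x := by
      rw [intervalIntegral.integral_of_le h, integral_integral_swap]
      · refine integral_congr_ae (Filter.Eventually.of_forall fun x => ?_)
        simp only
        rw [intervalIntegral.integral_of_le h]
      · rw [Measure.prod_restrict]
        have : IntegrableOn (fun q : ℝ × Ed d => G2 q.1 q.2) (Icc t0 t1 ×ˢ K)
            (volume.prod volume) :=
          hG2c.continuousOn.integrableOn_compact (isCompact_Icc.prod hKc)
        exact this.mono_set (prod_mono Ioc_subset_Icc_self subset_rfl)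
    have e3 : ∀ x, ∫ t in t0..t1, G2 t x = G t1 x - G t0 x := fun x => by
      apply intervalIntegral.integral_eq_sub_of_hasDeriv_right_of_le h
      · exact hc.comp (f := fun t : ℝ => (t, x)) (by fun_prop) (fun t ht => ⟨ht, mem_univ _⟩)
      · intro t ht
        have := hder t ht x
        simp only [hG2, hce t ⟨ht.1.le, ht.2.le⟩]
        exact this.hasDerivWithinAt
      · apply Continuous.intervalIntegrable
        exact hG2c.comp (f := fun t : ℝ => (t, x)) (by fun_prop)
    have hGi : ∀ t ∈ Icc t0 t1, CS (G t) := fun t ht => by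
      refine ⟨?_, R, hR t ht⟩
      exact hc.comp_continuous (f := fun x : Ed d => (t, x)) (by fun_prop)
        (fun q => ⟨ht, mem_univ _⟩)
    have m0 : t0 ∈ Icc t0 t1 := left_mem_Icc.2 h
    have m1 : t1 ∈ Icc t0 t1 := right_mem_Icc.2 h
    rw [e1, e2]
    simp only [e3]
    rw [integral_sub (hGi t1 m1).integrable.integrableOn (hGi t0 m0).integrable.integrableOn]
    rw [setIntegral_eq_integral_of_forall_compl_eq_zero (fun x hx => hR t1 m1 x (hxK x hx)),
      setIntegral_eq_integral_of_forall_compl_eq_zero (fun x hx => hR t0 m0 x (hxK x hx))]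

/-- The regularity actually used. -/
structure Nice (T : ℝ) (w : ℝ → Ed d → ℝ) : Prop where
  per : ∀ t ∈ Icc (0:ℝ) T, ZPeriodic (w t)
  c2 : ∀ t ∈ Icc (0:ℝ) T, ContDiff ℝ 2 (w t)
  td : ∀ t ∈ Ioo (0:ℝ) T, ∀ x, HasDerivAt (fun s => w s x) (tderiv T w t x) t
  cont : ContinuousOn (fun q : ℝ × Ed d => w q.1 q.2) (Icc 0 T ×ˢ univ)
  contt : ContinuousOn (fun q : ℝ × Ed d => tderiv T w q.1 q.2) (Icc 0 T ×ˢ univ)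
  contg : ContinuousOn (fun q : ℝ × Ed d => sgrad (w q.1) q.2) (Icc 0 T ×ˢ univ)
  bdd : ∃ B : ℝ, 0 ≤ B ∧ ∀ t ∈ Icc (0:ℝ) T, ∀ x, |w t x| ≤ B ∧ ‖sgrad (w t) x‖ ≤ B ∧
    ‖fderiv ℝ (sgrad (w t)) x‖ ≤ B

lemma HolderBddQ.continuousOn {T a : ℝ} (ha : 0 < a) {w : ℝ → Ed d → ℝ} (h : HolderBddQ T a w) :
    ContinuousOn (fun q : ℝ × Ed d => w q.1 q.2) (Icc 0 T ×ˢ univ) := by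
  obtain ⟨C, _, h⟩ := h
  intro q hq
  rw [ContinuousWithinAt, tendsto_iff_dist_tendsto_zero]
  have hlim : Filter.Tendsto (fun p : ℝ × Ed d => C * (‖p.2 - q.2‖ ^ 2 + |p.1 - q.1|) ^ (a / 2))
      (nhdsWithin q (Icc 0 T ×ˢ univ)) (nhds 0) := by
    have hc : Continuous (fun p : ℝ × Ed d => C * (‖p.2 - q.2‖ ^ 2 + |p.1 - q.1|) ^ (a / 2)) := by
      refine continuous_const.mul (Continuous.rpow_const (by fun_prop) fun _ => Or.inr (by positivity))
    have := hc.tendsto q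
    simp only [sub_self, norm_zero, abs_zero] at this
    rw [show ((0:ℝ) ^ 2 + 0) = 0 by norm_num, Real.zero_rpow (by positivity), mul_zero] at this
    exact this.mono_left nhdsWithin_le_nhds
  refine squeeze_zero' (Filter.Eventually.of_forall fun p => dist_nonneg) ?_ hlim
  filter_upwards [self_mem_nhdsWithin] with p hp
  rw [Real.dist_eq]
  exact h p.1 hp.1 q.1 hq.1 p.2 q.2

lemma norm_le_sum_abs (x : Ed d) : ‖x‖ ≤ ∑ i, |x i| := by
  have h : x = ∑ i, x i • ebasis d i := by
    ext j
    simp [ebasis, Finset.sum_apply, Pi.single_apply]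
  conv_lhs => rw [h]
  refine (norm_sum_le _ _).trans (Finset.sum_le_sum fun i _ => ?_)
  rw [norm_smul, ebasis_norm, mul_one, Real.norm_eq_abs]

lemma opNorm_le_sum (A : Ed d →L[ℝ] Ed d) (B : ℝ) (hB : 0 ≤ B)
    (h : ∀ i j, |A (ebasis d i) j| ≤ B) : ‖A‖ ≤ d * d * B := by
  refine A.opNorm_le_bound (by positivity) fun x => ?_
  have hx : x = ∑ i, x i • ebasis d i := by
    ext j
    simp [ebasis, Finset.sum_apply, Pi.single_apply]
  have h1 : ∀ i, ‖A (ebasis d i)‖ ≤ d * B := fun i => by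
    refine (norm_le_sum_abs _).trans ((Finset.sum_le_sum fun j _ => h i j).trans ?_)
    simp
  conv_lhs => rw [hx]
  rw [map_sum]
  refine (norm_sum_le _ _).trans ?_
  have h2 : ∀ i ∈ Finset.univ, ‖A (x i • ebasis d i)‖ ≤ ‖x‖ * (d * B) := fun i _ => by
    rw [map_smul, norm_smul]
    exact mul_le_mul (PiLp.norm_apply_le x i) (h1 i) (norm_nonneg _) (norm_nonneg _)
  refine (Finset.sum_le_sum h2).trans (le_of_eq ?_)
  simp; ring

lemma InC2alpha.nice {T a : ℝ} (hT : 0 < T) (ha : 0 < a) {w : ℝ → Ed d → ℝ} (h : InC2alpha T a w) :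
    Nice T w := by
  obtain ⟨h1, h2, h3, h4, h5, h6, h7⟩ := h
  refine ⟨h1, h2, ?_, h4.continuousOn ha, h7.continuousOn ha, ?_, ?_⟩
  · intro t ht x
    have h := (h3 x t ⟨ht.1.le, ht.2.le⟩).hasDerivWithinAt
    exact h.hasDerivAt (Icc_mem_nhds ht.1 ht.2)
  · have := fun i => (h5 i).continuousOn ha
    simp only [inner_ebasis] at this
    have h8 : ContinuousOn (fun q : ℝ × Ed d => (fun i => sgrad (w q.1) q.2 i : Fin d → ℝ))
      (Icc 0 T ×ˢ univ) := continuousOn_pi.2 this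
    have h9 := (PiLp.continuous_toLp 2 (fun _ : Fin d => ℝ)).comp_continuousOn h8
    exact h9
  · obtain ⟨C1, hC1, _⟩ := h4
    choose C2 hC2 _ using h5
    choose C3 hC3 _ using h6
    have m0 : (0:ℝ) ∈ Icc 0 T := ⟨le_rfl, hT.le⟩
    have p1 : 0 ≤ C1 := (abs_nonneg _).trans (hC1 0 m0 0)
    have p2 : ∀ i, 0 ≤ C2 i := fun i => (abs_nonneg _).trans (hC2 i 0 m0 0)
    have p3 : ∀ i j, 0 ≤ C3 i j := fun i j => (abs_nonneg _).trans (hC3 i j 0 m0 0)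
    have s3 : 0 ≤ ∑ i, ∑ j, C3 i j := Finset.sum_nonneg fun i _ => Finset.sum_nonneg fun j _ => p3 i j
    have s2 : 0 ≤ ∑ i, C2 i := Finset.sum_nonneg fun i _ => p2 i
    refine ⟨C1 + ∑ i, C2 i + d * d * ∑ i, ∑ j, C3 i j, by positivity, fun t ht x => ⟨?_, ?_, ?_⟩⟩
    · have := hC1 t ht x
      have : 0 ≤ d * d * ∑ i, ∑ j, C3 i j := by positivity
      linarith
    · have : ‖sgrad (w t) x‖ ≤ ∑ i, C2 i := (norm_le_sum_abs _).trans
        (Finset.sum_le_sum fun i _ => by simpa [inner_ebasis] using hC2 i t ht x)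
      have : 0 ≤ d * d * ∑ i, ∑ j, C3 i j := by positivity
      linarith
    · have : ‖fderiv ℝ (sgrad (w t)) x‖ ≤ d * d * ∑ i, ∑ j, C3 i j := by
        apply opNorm_le_sum _ _ s3
        intro i j
        rw [← partial2_eq (h2 t ht)]
        refine (hC3 i j t ht x).trans ?_
        refine le_trans ?_ (Finset.single_le_sum (f := fun i => ∑ j, C3 i j)
          (fun i _ => Finset.sum_nonneg fun j _ => p3 i j) (Finset.mem_univ i))
        exact Finset.single_le_sum (f := fun j => C3 i j) (fun j _ => p3 i j) (Finset.mem_univ j)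
      linarith

/-- the standard basis -/
def sb (d : ℕ) : Module.Basis (Fin d) ℝ (Ed d) := (EuclideanSpace.basisFun (Fin d) ℝ).toBasis

lemma sb_apply (i : Fin d) : sb d i = ebasis d i := by simp [sb, ebasis]

lemma sb_repr (x : Ed d) (i : Fin d) : (sb d).repr x i = x i := by simp [sb]

lemma cube_eq : cube d = ZSpan.fundamentalDomain (sb d) := by
  ext x
  simp [cube, ZSpan.mem_fundamentalDomain, sb_repr]

lemma cube_measurable : MeasurableSet (cube d) := by
  rw [cube_eq]; exact ZSpan.fundamentalDomain_measurableSet _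

lemma cube_isAdd : IsAddFundamentalDomain (Submodule.span ℤ (range (sb d))).toAddSubgroup (cube d)
    (volume : Measure (Ed d)) := by
  rw [cube_eq]; exact ZSpan.isAddFundamentalDomain' _ _

lemma ZPeriodic.span {f : Ed d → ℝ} (hf : ZPeriodic f) (g : Ed d)
    (hg : g ∈ Submodule.span ℤ (range (sb d))) : ∀ x, f (g + x) = f x := by
  induction hg using Submodule.span_induction with
  | mem y hy =>
    obtain ⟨i, rfl⟩ := hy
    intro x
    rw [sb_apply, add_comm, hf]
  | zero => intro x; rw [zero_add]
  | add a b _ _ ha hb => intro x; rw [add_assoc, ha, hb]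
  | smul n a _ ha =>
    intro x
    induction n using Int.induction_on generalizing x with
    | zero => simp
    | succ k ih => rw [add_smul, one_smul, add_assoc, ih, ha]
    | pred k ih =>
      rw [← ha ((-(k:ℤ) - 1) • a + x)]
      rw [show a + ((-(k:ℤ) - 1) • a + x) = (-(k:ℤ)) • a + x by rw [sub_smul, one_smul]; abel]
      exact ih x

open scoped Pointwise in
lemma ZPeriodic.cube_shift {f : Ed d → ℝ} (hf : ZPeriodic f) (x : Ed d) :
    ∫ y in cube d, f (x + y) = ∫ y in cube d, f y := by
  have h2 : IsAddFundamentalDomain (Submodule.span ℤ (range (sb d))).toAddSubgroup (x +ᵥ cube d)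
    (volume : Measure (Ed d)) := cube_isAdd.vadd_of_comm x
  have : Countable (Submodule.span ℤ (range (sb d))).toAddSubgroup :=
    inferInstanceAs (Countable (Submodule.span ℤ (range (sb d))))
  have h3 := h2.setIntegral_eq cube_isAdd (f := f) (fun g x => hf.span _ g.2 x)
  rw [← h3]
  have h4 := (measurePreserving_add_left (volume : Measure (Ed d)) x).setIntegral_preimage_emb
    (measurableEmbedding_addLeft x) f (x +ᵥ cube d)
  rw [← h4]
  congr 2
  ext y
  simp [mem_vadd_set_iff_neg_vadd_mem]

/-- every point can be translated into the cube -/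
lemma exists_cube (x : Ed d) : ∃ g ∈ Submodule.span ℤ (range (sb d)), g + x ∈ cube d := by
  obtain ⟨g, hg, _⟩ := ZSpan.exist_unique_vadd_mem_fundamentalDomain (sb d) x
  refine ⟨g, g.2, ?_⟩
  rw [cube_eq]; exact hg

lemma cube_norm (x : Ed d) (hx : x ∈ cube d) : ‖x‖ ≤ d := by
  refine (norm_le_sum_abs x).trans ?_
  have : ∀ i ∈ Finset.univ, |x i| ≤ 1 := fun i _ => by
    rw [abs_of_nonneg (hx i).1]; exact (hx i).2.le
  refine (Finset.sum_le_sum this).trans ?_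
  simp

lemma cube_volume : volume (cube d) = 1 := by
  have h : volume ((WithLp.toLp 2 : (Fin d → ℝ) → Ed d) ⁻¹' cube d) = volume (cube d) :=
    (EuclideanSpace.volume_preserving_symm_measurableEquiv_toLp (Fin d)).symm.measure_preimage_equiv
    (cube d)
  rw [← h]
  have : ((WithLp.toLp 2 : (Fin d → ℝ) → Ed d) ⁻¹' cube d) = Set.pi univ (fun _ => Ico (0:ℝ) 1) := by
    ext x; simp [cube]
  rw [this, Real.volume_pi_Ico]
  simp

instance : IsFiniteMeasure ((volume : Measure (Ed d)).restrict (cube d)) :=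
  ⟨by rw [Measure.restrict_apply_univ, cube_volume]; exact ENNReal.one_lt_top⟩


lemma ZPeriodic.bound_of_cube {f : Ed d → ℝ} (hf : ZPeriodic f) (B : ℝ)
    (h : ∀ x ∈ cube d, |f x| ≤ B) (x : Ed d) : |f x| ≤ B := by
  obtain ⟨g, hg, hx⟩ := exists_cube x
  rw [← hf.span g hg x]
  exact h _ hx

lemma bdd_integrable_cube {f : Ed d → ℝ} (hf : Continuous f) (B : ℝ) (h : ∀ x, |f x| ≤ B) :
    IntegrableOn f (cube d) :=
  Integrable.of_bound hf.aestronglyMeasurable B (Filter.Eventually.of_forall h)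

lemma avg_aux (w lam : Ed d → ℝ) (hw : CS w) (hl : Continuous lam) (hp : ZPeriodic lam)
    (B eps : ℝ) (hB : ∀ x, |lam x| ≤ B)
    (heps : ∀ y ∈ cube d, ∫ x, |w x - w (x - y)| ≤ eps) :
    |(∫ x, lam x * w x) - (∫ x in cube d, lam x) * ∫ x, w x| ≤ B * eps := by
  have hB0 : 0 ≤ B := (abs_nonneg _).trans (hB 0)
  have hwi := hw.integrable
  have hws : ∀ y, Integrable (fun x => w (x - y)) := fun y => hwi.comp_sub_right y
  have hlb : ∀ (g : Ed d → ℝ), Integrable g → Integrable (fun x => lam x * g x) := fun g hg =>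
    hg.bdd_mul (c := B) hl.aestronglyMeasurable (Filter.Eventually.of_forall hB)
  -- swap
  have hitg : Integrable (Function.uncurry fun y x => lam (x + y) * w x)
      (((volume : Measure (Ed d)).restrict (cube d)).prod volume) := by
    have h1 : Integrable (fun z : Ed d × Ed d => (1:ℝ) * w z.2)
      (((volume : Measure (Ed d)).restrict (cube d)).prod volume) :=
      Integrable.mul_prod (f := fun _ : Ed d => (1:ℝ)) (g := w) (integrable_const 1) hwi
    have h2 := h1.bdd_mul (c := B) (f := fun z : Ed d × Ed d => lam (z.2 + z.1))
      (hl.comp (by fun_prop)).aestronglyMeasurable (Filter.Eventually.of_forall fun z => hB _)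
    refine h2.congr (Filter.Eventually.of_forall fun z => ?_)
    simp [Function.uncurry]
  have e1 : ∫ y in cube d, ∫ x, lam x * w (x - y) = (∫ x in cube d, lam x) * ∫ x, w x := by
    have : ∀ y, ∫ x, lam x * w (x - y) = ∫ x, lam (x + y) * w x := fun y => by
      rw [← integral_add_right_eq_self (fun x => lam x * w (x - y)) y]
      simp
    simp only [this]
    rw [integral_integral_swap hitg, ← integral_const_mul]
    congr 1
    ext x
    rw [integral_mul_const, hp.cube_shift]
  have e0 : ∫ _ in cube d, ∫ x, lam x * w x = ∫ x, lam x * w x := by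
    simp [Measure.real, cube_volume]
  rw [← e1]
  nth_rewrite 1 [← e0]
  have hint2 : Integrable (fun y => ∫ x, lam x * w (x - y)) (volume.restrict (cube d)) := by
    have : ∀ y, ∫ x, lam x * w (x - y) = ∫ x, lam (x + y) * w x := fun y => by
      rw [← integral_add_right_eq_self (fun x => lam x * w (x - y)) y]
      simp
    simp only [this]
    exact hitg.integral_prod_left
  rw [← integral_sub (integrable_const _) hint2]
  have key : ∀ y ∈ cube d, ‖(∫ x, lam x * w x) - ∫ x, lam x * w (x - y)‖ ≤ B * eps := fun y hy => by
    rw [← integral_sub (hlb _ hwi) (hlb _ (hws y))]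
    refine (norm_integral_le_integral_norm _).trans ?_
    refine le_trans ?_ (mul_le_mul_of_nonneg_left (heps y hy) hB0)
    rw [← integral_const_mul]
    refine integral_mono ((hlb _ hwi).sub (hlb _ (hws y))).norm
      ((hwi.sub (hws y)).norm.const_mul B) fun x => ?_
    simp only
    rw [← mul_sub, norm_mul]
    exact mul_le_mul_of_nonneg_right (hB x) (abs_nonneg _)
  have := norm_setIntegral_le_of_norm_le_const (μ := volume) (s := cube d)
    (by rw [cube_volume]; exact ENNReal.one_lt_top) key
  simpa [Measure.real, cube_volume] using this

/-- averaging lemma at scale `N` -/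
lemma avg_lemma (hd : 1 ≤ d) : ∃ C : ℝ, 0 ≤ C ∧ ∀ (g lam : Ed d → ℝ) (K B N : ℝ), 1 ≤ N →
    (∀ z z', |g z - g z'| ≤ K * ‖z - z'‖) → (∀ z, 1 < ‖z‖ → g z = 0) →
    Continuous lam → ZPeriodic lam → (∀ x, |lam x| ≤ B) →
    CS (fun x => (N ^ d)⁻¹ * g (N⁻¹ • x)) ∧
    |(∫ x, lam x * ((N ^ d)⁻¹ * g (N⁻¹ • x))) - (∫ x in cube d, lam x) * ∫ z, g z| ≤
      C * (K * B) / N := by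
  set V : ℝ := volume.real (Metric.closedBall (0 : Ed d) (1 + d)) with hV
  refine ⟨d * V, by positivity, ?_⟩
  intro g lam K B N hN hg hgs hl hp hB
  have hN0 : 0 < N := by linarith
  have hK : 0 ≤ K := by
    have h := (abs_nonneg _).trans (hg 0 (ebasis d ⟨0, hd⟩))
    rw [zero_sub, norm_neg, ebasis_norm, mul_one] at h
    exact h
  have hgc : Continuous g := by
    have : LipschitzWith ⟨K, hK⟩ g := LipschitzWith.of_dist_le_mul fun z z' => by
      rw [dist_eq_norm, dist_eq_norm]; exact hg z z'
    exact this.continuous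
  have hgcs : CS g := ⟨hgc, 1, hgs⟩
  have hcs : CS (fun x => (N ^ d)⁻¹ * g (N⁻¹ • x)) := by
    refine ⟨by fun_prop, N, fun x hx => ?_⟩
    simp only
    rw [hgs, mul_zero]
    rw [norm_smul, norm_inv, Real.norm_of_nonneg hN0.le, inv_mul_eq_div, one_lt_div hN0]
    exact hx
  refine ⟨hcs, ?_⟩
  have hsc : ∀ G : Ed d → ℝ, ∫ x, (N ^ d)⁻¹ * G (N⁻¹ • x) = ∫ z, G z := fun G => by
    rw [integral_const_mul, Measure.integral_comp_inv_smul, finrank_euclideanSpace_fin,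
      abs_of_pos (by positivity), smul_eq_mul, ← mul_assoc, inv_mul_cancel₀ (by positivity), one_mul]
  have h := avg_aux (fun x => (N ^ d)⁻¹ * g (N⁻¹ • x)) lam hcs hl hp B (d * V * K / N) hB ?_
  · rw [hsc] at h
    refine h.trans (le_of_eq ?_)
    ring
  intro y hy
  have e : ∀ x, |(N ^ d)⁻¹ * g (N⁻¹ • x) - (N ^ d)⁻¹ * g (N⁻¹ • (x - y))| =
      (N ^ d)⁻¹ * (fun z => |g z - g (z - N⁻¹ • y)|) (N⁻¹ • x) := fun x => by
    simp only
    rw [← mul_sub, abs_mul, abs_of_pos (by positivity), smul_sub]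
  rw [integral_congr_ae (Filter.Eventually.of_forall e), hsc (fun z => |g z - g (z - N⁻¹ • y)|)]
  have hny : ‖N⁻¹ • y‖ ≤ d / N := by
    rw [norm_smul, norm_inv, Real.norm_of_nonneg hN0.le, inv_mul_eq_div]
    exact div_le_div_of_nonneg_right (cube_norm y hy) hN0.le
  have hny2 : ‖N⁻¹ • y‖ ≤ d := hny.trans (div_le_self (by positivity) hN)
  have hz : ∀ z, z ∉ Metric.closedBall (0 : Ed d) (1 + d) → |g z - g (z - N⁻¹ • y)| = 0 := by
    intro z hz
    have hz1 : 1 + (d:ℝ) < ‖z‖ := by simpa using hz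
    have hd0 : (0:ℝ) ≤ d := by positivity
    rw [hgs z (by linarith), hgs, sub_zero, abs_zero]
    have := norm_sub_norm_le z (N⁻¹ • y)
    linarith
  rw [← setIntegral_eq_integral_of_forall_compl_eq_zero hz]
  have := norm_setIntegral_le_of_norm_le_const (μ := volume)
    (s := Metric.closedBall (0 : Ed d) (1 + d)) (f := fun z => |g z - g (z - N⁻¹ • y)|)
    (C := K * (d / N)) measure_closedBall_lt_top (fun z _ => by
      rw [Real.norm_eq_abs, abs_abs]
      refine (hg _ _).trans ?_
      rw [sub_sub_cancel]
      exact mul_le_mul_of_nonneg_left hny hK)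
  refine (le_abs_self _).trans (this.trans (le_of_eq ?_))
  ring

/-- a normalized smooth bump supported in the unit ball -/
lemma exists_bump : ∃ φ : Ed d → ℝ, ContDiff ℝ 3 φ ∧ (∀ z, 0 ≤ φ z) ∧ (∀ z, 1 < ‖z‖ → φ z = 0) ∧
    ∫ z, φ z = 1 := by
  let f : ContDiffBump (0 : Ed d) := ⟨1/4, 1/2, by norm_num, by norm_num⟩
  refine ⟨f.normed volume, f.contDiff_normed, fun z => f.nonneg_normed z, fun z hz => ?_, f.integral_normed⟩
  have h := f.support_normed_eq (μ := volume)
  by_contra hne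
  have : z ∈ Function.support (f.normed volume) := hne
  rw [h] at this
  have h2 : ‖z‖ < 1/2 := by simpa [f] using this
  linarith

lemma lip_of_cs {E : Type*} [NormedAddCommGroup E] [NormedSpace ℝ E] (G : Ed d → E) (h : ContDiff ℝ 1 G)
    (hs : ∀ z, 1 < ‖z‖ → G z = 0) : ∃ K : ℝ, 0 ≤ K ∧ (∀ z z', ‖G z - G z'‖ ≤ K * ‖z - z'‖) ∧
      ∀ z, ‖G z‖ ≤ K := by
  have hc : HasCompactSupport G := HasCompactSupport.of_support_subset_isCompact
    (isCompact_closedBall (0 : Ed d) 1) (fun z hz => by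
      by_contra hn
      exact hz (hs z (by simpa using hn)))
  obtain ⟨K, hK⟩ := ContDiff.lipschitzWith_of_hasCompactSupport hc h one_ne_zero
  obtain ⟨B, hB⟩ := h.continuous.bounded_above_of_compact_support hc
  have hB0 : 0 ≤ B := (norm_nonneg _).trans (hB 0)
  refine ⟨K + B, by positivity, fun z z' => ?_, fun z => (hB z).trans (by simp)⟩
  have := hK.dist_le_mul z z'
  rw [dist_eq_norm, dist_eq_norm] at this
  refine this.trans (mul_le_mul_of_nonneg_right (by linarith) (norm_nonneg _))

/-- scaled function -/
def scl (N : ℝ) (φ : Ed d → ℝ) (x : Ed d) : ℝ := (N ^ d)⁻¹ * φ (N⁻¹ • x)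

lemma integral_scl {N : ℝ} (hN : 0 < N) (G : Ed d → ℝ) :
    ∫ x, (N ^ d)⁻¹ * G (N⁻¹ • x) = ∫ z, G z := by
  rw [integral_const_mul, Measure.integral_comp_inv_smul, finrank_euclideanSpace_fin,
      abs_of_pos (by positivity), smul_eq_mul, ← mul_assoc, inv_mul_cancel₀ (by positivity), one_mul]

lemma sgrad_comp_smul (r : ℝ) {φ : Ed d → ℝ} (hφ : Differentiable ℝ φ) (x : Ed d) :
    sgrad (fun y => φ (r • y)) x = r • sgrad φ (r • x) := by
  unfold sgrad
  have h1 := (hφ (r • x)).hasGradientAt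
  rw [hasGradientAt_iff_hasFDerivAt] at h1
  have h2 : HasFDerivAt (fun y : Ed d => r • y) (r • ContinuousLinearMap.id ℝ (Ed d)) x :=
    (hasFDerivAt_id x).const_smul r
  have h3 : HasFDerivAt (fun y => φ (r • y)) _ x := h1.comp x h2
  apply HasGradientAt.gradient
  rw [hasGradientAt_iff_hasFDerivAt]
  refine h3.congr_fderiv ?_
  ext e
  simp

lemma sgrad_const_mul (c : ℝ) {φ : Ed d → ℝ} (x : Ed d) (hφ : DifferentiableAt ℝ φ x) :
    sgrad (fun y => c * φ y) x = c • sgrad φ x := by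
  have := sgrad_mul (f := fun _ => c) (g := φ) (x := x) (by fun_prop) hφ
  rw [this]
  simp [sgrad]

lemma sgrad_scl (N : ℝ) {φ : Ed d → ℝ} (hφ : Differentiable ℝ φ) (x : Ed d) :
    sgrad (scl N φ) x = ((N ^ d)⁻¹ * N⁻¹) • sgrad φ (N⁻¹ • x) := by
  unfold scl
  rw [sgrad_const_mul _ _ (by fun_prop), sgrad_comp_smul _ hφ, smul_smul]

lemma lap_scl (N : ℝ) {φ : Ed d → ℝ} (hφ : ContDiff ℝ 2 φ) (x : Ed d) :
    lap (scl N φ) x = ((N ^ d)⁻¹ * N⁻¹ * N⁻¹) * lap φ (N⁻¹ • x) := by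
  have hs : ContDiff ℝ 2 (scl N φ) := by unfold scl; fun_prop
  rw [← diverg_sgrad hs, ← diverg_sgrad hφ]
  have e : sgrad (scl N φ) = fun x => ((N ^ d)⁻¹ * N⁻¹) • sgrad φ (N⁻¹ • x) := by
    ext1 x; exact sgrad_scl N (hφ.differentiable (by norm_num)) x
  rw [e]
  unfold diverg
  rw [Finset.mul_sum]
  refine Finset.sum_congr rfl fun i _ => ?_
  have h1 := ((sgrad_contDiff hφ).differentiable one_ne_zero (N⁻¹ • x)).hasFDerivAt
  have h2 : HasFDerivAt (fun y : Ed d => N⁻¹ • y) (N⁻¹ • ContinuousLinearMap.id ℝ (Ed d)) x :=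
    (hasFDerivAt_id x).const_smul N⁻¹
  have h3 := (h1.comp x h2).const_smul ((N ^ d)⁻¹ * N⁻¹)
  have h4 : HasFDerivAt (fun x => ((N ^ d)⁻¹ * N⁻¹) • sgrad φ (N⁻¹ • x)) _ x := h3
  rw [h4.fderiv]
  simp [inner_smul_left]
  ring

/-- weight package -/
structure Wt (P0 : Ed d → Ed d) (C N : ℝ) (ω : Ed d → ℝ) (c : ℝ) : Prop where
  smooth : ContDiff ℝ 2 ω
  nonneg : ∀ x, 0 ≤ ω x
  cs : ∃ R, ∀ x, R < ‖x‖ → ω x = 0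
  one : ∫ x, ω x = 1
  grad : ∫ x, ‖sgrad ω x‖ ≤ C / N
  lapl : ∫ x, |lap ω x| ≤ C / N
  avg : ∀ (lam : Ed d → ℝ) (B : ℝ), Continuous lam → ZPeriodic lam → (∀ x, |lam x| ≤ B) →
    |(∫ x, lam x * ω x) - ∫ x in cube d, lam x| ≤ C * B / N
  avg2 : ∀ (lam : Ed d → ℝ) (B : ℝ), Continuous lam → ZPeriodic lam → (∀ x, |lam x| ≤ B) →
    |∫ x, lam x * (⟪P0 x, sgrad ω x⟫ - c * ω x)| ≤ C * B / N
  cbd : |c| ≤ C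

lemma exists_weights (hd : 1 ≤ d) (P0 : Ed d → Ed d) (L : ℝ) (hL : 0 ≤ L)
    (hP : ∀ x y, ‖P0 x - P0 y‖ ≤ L * ‖x - y‖) :
    ∃ C : ℝ, 0 ≤ C ∧ ∀ N : ℝ, 1 ≤ N → ∃ (ω : Ed d → ℝ) (c : ℝ), Wt P0 C N ω c := by
  obtain ⟨φ, hφ3, hφ0, hφs, hφ1⟩ := exists_bump (d := d)
  have hφ : ContDiff ℝ 2 φ := hφ3.of_le (by norm_num)
  have hφd : Differentiable ℝ φ := hφ.differentiable (by norm_num)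
  have hgs : ∀ z, 1 < ‖z‖ → sgrad φ z = 0 := fun z hz => sgrad_zero_of_far φ 1 hφs z hz
  obtain ⟨K1, hK1, hl1, hb1⟩ := lip_of_cs φ (hφ.of_le (by norm_num)) hφs
  obtain ⟨K2, hK2, hl2, hb2⟩ := lip_of_cs (sgrad φ) (sgrad_contDiff hφ) hgs
  obtain ⟨CA, hCA, havg⟩ := avg_lemma hd
  set V : ℝ := volume.real (Metric.closedBall (0 : Ed d) 1) with hV
  set A : ℝ := ‖P0 0‖ + L with hA
  have hA0 : 0 ≤ A := by positivity
  set I1 := ∫ z, ‖sgrad φ z‖ with hI1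
  set I2 := ∫ z, |lap φ z| with hI2
  have hI1' : 0 ≤ I1 := integral_nonneg fun _ => norm_nonneg _
  have hI2' : 0 ≤ I2 := integral_nonneg fun _ => abs_nonneg _
  set C0 := A * K2 * V with hC0
  have hC00 : 0 ≤ C0 := by positivity
  set Kg := L * K2 + A * K2 + C0 * K1 with hKg
  have hKg0 : 0 ≤ Kg := by positivity
  refine ⟨I1 + I2 + CA * K1 + CA * Kg + C0, by positivity, fun N hN => ?_⟩
  have hN0 : 0 < N := by linarith
  set p : Ed d → Ed d := fun z => N⁻¹ • P0 (N • z) with hp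
  have hpl : ∀ z z', ‖p z - p z'‖ ≤ L * ‖z - z'‖ := fun z z' => by
    simp only [hp]
    rw [← smul_sub, norm_smul, norm_inv, Real.norm_of_nonneg hN0.le]
    have := hP (N • z) (N • z')
    rw [← smul_sub, norm_smul, Real.norm_of_nonneg hN0.le] at this
    rw [inv_mul_le_iff₀ hN0]
    linarith
  have hpb : ∀ z, ‖z‖ ≤ 1 → ‖p z‖ ≤ A := fun z hz => by
    have h1 := hpl z 0
    have h2 : ‖p 0‖ ≤ ‖P0 0‖ := by
      simp only [hp, smul_zero]
      rw [norm_smul, norm_inv, Real.norm_of_nonneg hN0.le]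
      exact mul_le_of_le_one_left (norm_nonneg _) (inv_le_one_of_one_le₀ hN)
    have h3 : ‖p z‖ ≤ ‖p z - p 0‖ + ‖p 0‖ := by
      have := norm_add_le (p z - p 0) (p 0); simpa using this
    rw [sub_zero] at h1
    have : L * ‖z‖ ≤ L := mul_le_of_le_one_right hL hz
    rw [hA]; linarith
  set g0 : Ed d → ℝ := fun z => ⟪p z, sgrad φ z⟫ with hg0
  have hg0l1 : ∀ z z', ‖z‖ ≤ 1 → |g0 z - g0 z'| ≤ (L * K2 + A * K2) * ‖z - z'‖ := fun z z' hz => by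
    have e : g0 z - g0 z' = ⟪p z, sgrad φ z - sgrad φ z'⟫ + ⟪p z - p z', sgrad φ z'⟫ := by
      simp only [hg0, inner_sub_left, inner_sub_right]; ring
    rw [e]
    refine (abs_add_le _ _).trans ?_
    have h1 := abs_real_inner_le_norm (p z) (sgrad φ z - sgrad φ z')
    have h2 := abs_real_inner_le_norm (p z - p z') (sgrad φ z')
    have h3 : ‖p z‖ * ‖sgrad φ z - sgrad φ z'‖ ≤ A * (K2 * ‖z - z'‖) :=
      mul_le_mul (hpb z hz) (hl2 z z') (norm_nonneg _) hA0
    have h4 : ‖p z - p z'‖ * ‖sgrad φ z'‖ ≤ (L * ‖z - z'‖) * K2 :=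
      mul_le_mul (hpl z z') (hb2 z') (norm_nonneg _) (by positivity)
    nlinarith
  have hg0s : ∀ z, 1 < ‖z‖ → g0 z = 0 := fun z hz => by simp [hg0, hgs z hz]
  have hg0l : ∀ z z', |g0 z - g0 z'| ≤ (L * K2 + A * K2) * ‖z - z'‖ := fun z z' => by
    rcases le_or_gt ‖z‖ 1 with h | h
    · exact hg0l1 z z' h
    · rcases le_or_gt ‖z'‖ 1 with h' | h'
      · rw [abs_sub_comm, norm_sub_rev]; exact hg0l1 z' z h'
      · rw [hg0s z h, hg0s z' h', sub_zero, abs_zero]; positivity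
  set c := ∫ z, g0 z with hc
  have hcb : |c| ≤ C0 := by
    rw [hc, ← setIntegral_eq_integral_of_forall_compl_eq_zero
      (s := Metric.closedBall (0 : Ed d) 1) (fun z hz => hg0s z (by simpa using hz))]
    refine norm_setIntegral_le_of_norm_le_const (f := g0) (C := A * K2) (μ := (volume : Measure (Ed d)))
      (measure_closedBall_lt_top (x := (0 : Ed d))) (fun z hz => ?_)
    refine (abs_real_inner_le_norm _ _).trans ?_
    exact mul_le_mul (hpb z (by simpa using hz)) (hb2 z) (norm_nonneg _) hA0
  set g : Ed d → ℝ := fun z => g0 z - c * φ z with hg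
  have hgl : ∀ z z', |g z - g z'| ≤ Kg * ‖z - z'‖ := fun z z' => by
    have e : g z - g z' = (g0 z - g0 z') - c * (φ z - φ z') := by simp only [hg]; ring
    rw [e]
    refine (abs_sub _ _).trans ?_
    rw [abs_mul]
    have := mul_le_mul hcb (hl1 z z') (norm_nonneg _) hC00
    rw [Real.norm_eq_abs] at this
    have := hg0l z z'
    rw [hKg]; nlinarith
  have hgs' : ∀ z, 1 < ‖z‖ → g z = 0 := fun z hz => by simp only [hg]; rw [hg0s z hz, hφs z hz]; simp
  have hφcs : CS φ := ⟨hφ.continuous, 1, hφs⟩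
  have hpc : Continuous p := by
    have : LipschitzWith ⟨L, hL⟩ p := LipschitzWith.of_dist_le_mul fun z z' => by
      rw [dist_eq_norm, dist_eq_norm]; exact hpl z z'
    exact this.continuous
  have hg0cs : CS g0 := ⟨hpc.inner (sgrad_continuous (hφ.of_le (by norm_num))), 1, hg0s⟩
  have hgint : ∫ z, g z = 0 := by
    simp only [hg]
    rw [integral_sub hg0cs.integrable (hφcs.integrable.const_mul c), integral_const_mul, hφ1, mul_one,
      sub_self]
  have hφl : ∀ z z', |φ z - φ z'| ≤ K1 * ‖z - z'‖ := fun z z' => hl1 z z'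
  have hsm : ContDiff ℝ 2 (scl N φ) := by unfold scl; fun_prop
  have hbig : ∀ q x B : ℝ, 0 ≤ B → q * B ≤ x * B → q * B / N ≤ x * B / N := fun q x B _ h =>
    div_le_div_of_nonneg_right h hN0.le
  have hNN : N⁻¹ ≤ 1 := inv_le_one_of_one_le₀ hN
  refine ⟨scl N φ, c, hsm, fun x => mul_nonneg (by positivity) (hφ0 _), ⟨N, fun x hx => ?_⟩, ?_, ?_, ?_,
    ?_, ?_, ?_⟩
  · unfold scl
    rw [hφs, mul_zero]
    rw [norm_smul, norm_inv, Real.norm_of_nonneg hN0.le, inv_mul_eq_div, one_lt_div hN0]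
    exact hx
  · unfold scl; rw [integral_scl hN0, hφ1]
  · have e : ∀ x, ‖sgrad (scl N φ) x‖ = N⁻¹ * ((N ^ d)⁻¹ * (fun z => ‖sgrad φ z‖) (N⁻¹ • x)) := fun x => by
      rw [sgrad_scl N hφd, norm_smul, Real.norm_of_nonneg (by positivity)]; ring
    rw [integral_congr_ae (Filter.Eventually.of_forall e), integral_const_mul,
      integral_scl hN0 (fun z => ‖sgrad φ z‖), inv_mul_eq_div]
    refine div_le_div_of_nonneg_right ?_ hN0.le
    have : 0 ≤ I2 + CA * K1 + CA * Kg + C0 := by positivity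
    linarith
  · have e : ∀ x, |lap (scl N φ) x| = N⁻¹ * N⁻¹ * ((N ^ d)⁻¹ * (fun z => |lap φ z|) (N⁻¹ • x)) := fun x => by
      rw [lap_scl N hφ, abs_mul, abs_of_nonneg (by positivity)]; ring
    rw [integral_congr_ae (Filter.Eventually.of_forall e), integral_const_mul,
      integral_scl hN0 (fun z => |lap φ z|)]
    have h1 : N⁻¹ * N⁻¹ * I2 ≤ N⁻¹ * I2 := by
      refine mul_le_mul_of_nonneg_right ?_ hI2'
      exact mul_le_of_le_one_left (by positivity) hNN
    refine h1.trans ?_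
    rw [inv_mul_eq_div]
    refine div_le_div_of_nonneg_right ?_ hN0.le
    have : 0 ≤ I1 + CA * K1 + CA * Kg + C0 := by positivity
    linarith
  · intro lam B hl hlp hB
    have hB0 : 0 ≤ B := (abs_nonneg _).trans (hB 0)
    have := (havg φ lam K1 B N hN hφl hφs hl hlp hB).2
    rw [hφ1, mul_one] at this
    refine this.trans ?_
    refine div_le_div_of_nonneg_right ?_ hN0.le
    rw [← mul_assoc]
    refine mul_le_mul_of_nonneg_right ?_ hB0
    have : 0 ≤ I1 + I2 + CA * Kg + C0 := by positivity
    linarith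
  · intro lam B hl hlp hB
    have hB0 : 0 ≤ B := (abs_nonneg _).trans (hB 0)
    have := (havg g lam Kg B N hN hgl hgs' hl hlp hB).2
    rw [hgint, mul_zero, sub_zero] at this
    have e : ∀ x, lam x * (⟪P0 x, sgrad (scl N φ) x⟫ - c * scl N φ x) =
        lam x * ((N ^ d)⁻¹ * g (N⁻¹ • x)) := fun x => by
      rw [sgrad_scl N hφd]
      simp only [hg, hg0, hp, scl]
      rw [smul_smul, mul_inv_cancel₀ hN0.ne', one_smul, inner_smul_left, inner_smul_right]
      simp
      left
      ring
    rw [integral_congr_ae (Filter.Eventually.of_forall e)]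
    refine this.trans ?_
    refine div_le_div_of_nonneg_right ?_ hN0.le
    rw [← mul_assoc]
    refine mul_le_mul_of_nonneg_right ?_ hB0
    have : 0 ≤ I1 + I2 + CA * K1 + C0 := by positivity
    linarith
  · have : 0 ≤ I1 + I2 + CA * K1 + CA * Kg := by positivity
    linarith

/-- the flux -/
def flux (P Q : Ed d → Ed d) (B : Ed d → Ed d →L[ℝ] Ed d) (b : Ed d → Ed d) (v ρ : Ed d → ℝ)
    (x : Ed d) : Ed d := ρ x • P x + ρ x • Q x + B x (sgrad v x) + b x

/-- the linearized system at a fixed time -/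
structure Slice (L : ℝ) (P0 P Q : Ed d → Ed d) (B : Ed d → Ed d →L[ℝ] Ed d) (h : Ed d → ℝ)
    (a : Ed d → ℝ) (b : Ed d → Ed d) (v ρ vt rt : Ed d → ℝ) (Ca Cb M : ℝ) : Prop where
  L1 : 1 ≤ L
  v2 : ContDiff ℝ 2 v
  r2 : ContDiff ℝ 2 ρ
  vp : ZPeriodic v
  rp : ZPeriodic ρ
  pp0 : ∀ x, ‖P x - P0 x‖ ≤ L
  p1 : ContDiff ℝ 1 P
  dp : ∀ x, |diverg P x| ≤ L
  qc : Continuous Q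
  qb : ∀ x, ‖Q x‖ ≤ L
  bs : ∀ x y z, ⟪B x y, z⟫ = ⟪y, B x z⟫
  bb : ∀ x, ‖B x‖ ≤ L
  bc : Continuous B
  form : ∀ x r ξ, 0 ≤ h x * r ^ 2 + ⟪Q x, ξ⟫ * r + ⟪B x ξ, ξ⟫
  vtc : Continuous vt
  rtc : Continuous rt
  fd : Differentiable ℝ (flux P Q B b v ρ)
  eq1 : ∀ x, vt x = - lap v x + ⟪P x, sgrad v x⟫ - h x * ρ x - a x
  eq2 : ∀ x, rt x = lap ρ x + diverg (flux P Q B b v ρ) x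
  ha : ∀ x, |a x| ≤ Ca
  hb : ∀ x, ‖b x‖ ≤ Cb
  mv : ∀ x, |v x| ≤ M
  mg : ∀ x, ‖sgrad v x‖ ≤ M
  mr : ∀ x, |ρ x| ≤ M

lemma CS.integral_add {f g : Ed d → ℝ} (hf : CS f) (hg : CS g) :
    ∫ x, (f x + g x) = (∫ x, f x) + ∫ x, g x := MeasureTheory.integral_add hf.integrable hg.integrable

lemma CS.integral_sub {f g : Ed d → ℝ} (hf : CS f) (hg : CS g) :
    ∫ x, (f x - g x) = (∫ x, f x) - ∫ x, g x := MeasureTheory.integral_sub hf.integrable hg.integrable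

lemma CS.const_mul {f : Ed d → ℝ} (hf : CS f) (k : ℝ) : CS (fun x => k * f x) :=
  hf.mul_left continuous_const

lemma CS.integral_mono {f g : Ed d → ℝ} (hf : CS f) (hg : CS g) (h : ∀ x, f x ≤ g x) :
    ∫ x, f x ≤ ∫ x, g x := MeasureTheory.integral_mono hf.integrable hg.integrable h

lemma int_bound {P0 : Ed d → Ed d} {C N : ℝ} {ω : Ed d → ℝ} {c : ℝ} (hW : Wt P0 C N ω c)
    (hP0 : Continuous P0)
    (A n lam : Ed d → ℝ) (hA : CS A) (hn : CS n) (hn0 : ∫ x, n x = 0) (B k1 k2 k3 : ℝ)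
    (hl : Continuous lam) (hp : ZPeriodic lam) (hB : ∀ x, |lam x| ≤ B) (hk1 : 0 ≤ k1) (hk2 : 0 ≤ k2)
    (hle : ∀ x, A x ≤ n x + lam x * (⟪P0 x, sgrad ω x⟫ - c * ω x) + k1 * ‖sgrad ω x‖ +
      k2 * |lap ω x| + k3 * ω x) :
    ∫ x, A x ≤ C * B / N + k1 * (C / N) + k2 * (C / N) + k3 := by
  obtain ⟨R, hR⟩ := hW.cs
  have hgr := sgrad_zero_of_far ω R hR
  have hgc := sgrad_continuous (hW.smooth.of_le (by norm_num))
  have hlc := lap_continuous hW.smooth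
  have hwc := hW.smooth.continuous
  have hω : CS ω := ⟨hW.smooth.continuous, R, hR⟩
  have hlapr : ∀ x, R < ‖x‖ → lap ω x = 0 := fun x hx => by
    rw [← diverg_sgrad hW.smooth]; exact diverg_zero_of_far _ R hgr x hx
  have c1 : CS (fun x => lam x * (⟪P0 x, sgrad ω x⟫ - c * ω x)) :=
    ⟨by fun_prop, R, fun x hx => by simp [hgr x hx, hR x hx]⟩
  have c2 : CS (fun x => ‖sgrad ω x‖) := ⟨by fun_prop, R, fun x hx => by simp [hgr x hx]⟩
  have c3 : CS (fun x => |lap ω x|) := ⟨by fun_prop, R, fun x hx => by simp [hlapr x hx]⟩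
  have s1 := hn.add c1
  have s2 := s1.add (c2.const_mul k1)
  have s3 := s2.add (c3.const_mul k2)
  have s4 := s3.add (hω.const_mul k3)
  have e := hA.integral_mono s4 hle
  rw [s3.integral_add (hω.const_mul k3), s2.integral_add (c3.const_mul k2),
    s1.integral_add (c2.const_mul k1), hn.integral_add c1, hn0, integral_const_mul, integral_const_mul,
    integral_const_mul, hW.one, mul_one] at e
  refine e.trans ?_
  have h1 := (le_abs_self _).trans (hW.avg2 lam B hl hp hB)
  have h2 := mul_le_mul_of_nonneg_left hW.grad hk1
  have h3 := mul_le_mul_of_nonneg_left hW.lapl hk2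
  linarith

lemma psd_bound {L h r : ℝ} (hL : 0 < L) (Q ξ : Ed d) (B : Ed d →L[ℝ] Ed d)
    (hs : ∀ y z, ⟪B y, z⟫ = ⟪y, B z⟫) (hB : ‖B‖ ≤ L)
    (hf : ∀ r ξ, 0 ≤ h * r ^ 2 + ⟪Q, ξ⟫ * r + ⟪B ξ, ξ⟫) :
    ‖B ξ + (r / 2) • Q‖ ^ 2 / L ≤ h * r ^ 2 + ⟪Q, ξ⟫ * r + ⟪B ξ, ξ⟫ := by
  set R := B ξ + (r / 2) • Q with hR
  have h1 := hf r (ξ - L⁻¹ • R)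
  have h2 : ⟪B R, R⟫ ≤ L * ‖R‖ ^ 2 := by
    refine (real_inner_le_norm _ _).trans ?_
    have := B.le_opNorm R
    have : ‖B R‖ ≤ L * ‖R‖ := this.trans (mul_le_mul_of_nonneg_right hB (norm_nonneg _))
    nlinarith [norm_nonneg R]
  have h3 : ‖R‖ ^ 2 = ⟪B ξ, R⟫ + r / 2 * ⟪Q, R⟫ := by
    rw [← real_inner_self_eq_norm_sq]
    nth_rewrite 1 [hR]
    rw [inner_add_left, inner_smul_left]; simp
  rw [map_sub, map_smul] at h1
  simp only [inner_sub_left, inner_sub_right, inner_smul_left, inner_smul_right] at h1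
  have h4 : ⟪B R, ξ⟫ = ⟪B ξ, R⟫ := by rw [hs, real_inner_comm]
  rw [h4] at h1
  simp only [RCLike.conj_to_real] at h1
  have h5 : L⁻¹ * (L⁻¹ * ⟪B R, R⟫) ≤ L⁻¹ * ‖R‖ ^ 2 := by
    refine mul_le_mul_of_nonneg_left ?_ (by positivity)
    rw [inv_mul_le_iff₀ hL]; exact h2
  have h6 : ‖R‖ ^ 2 / L = L⁻¹ * ‖R‖ ^ 2 := by rw [div_eq_inv_mul]
  rw [h6]
  rw [h3] at h5 ⊢
  nlinarith

section
variable {L : ℝ} {P0 P Q : Ed d → Ed d} {B : Ed d → Ed d →L[ℝ] Ed d} {h : Ed d → ℝ}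
    {a : Ed d → ℝ} {b : Ed d → Ed d} {v ρ vt rt : Ed d → ℝ} {Ca Cb M : ℝ}

/-- the good quantity -/
def goodR (Q : Ed d → Ed d) (B : Ed d → Ed d →L[ℝ] Ed d) (v ρ : Ed d → ℝ) (x : Ed d) : Ed d :=
  B x (sgrad v x) + (ρ x / 2) • Q x

lemma Slice.goodR_cont (S : Slice L P0 P Q B h a b v ρ vt rt Ca Cb M) :
    Continuous (goodR Q B v ρ) := by
  have h1 := sgrad_continuous (S.v2.of_le (by norm_num))
  have h2 := S.r2.continuous
  have h3 := S.qc
  have h4 := S.bc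
  unfold goodR
  fun_prop

lemma Slice.div_cont (S : Slice L P0 P Q B h a b v ρ vt rt Ca Cb M) :
    Continuous (diverg (flux P Q B b v ρ)) := by
  have : diverg (flux P Q B b v ρ) = fun x => rt x - lap ρ x := by
    ext1 x; rw [S.eq2]; ring
  rw [this]
  exact S.rtc.sub (lap_continuous S.r2)

lemma Slice.est1 (hd : 1 ≤ d) (S : Slice L P0 P Q B h a b v ρ vt rt Ca Cb M)
    {C N : ℝ} {ω : Ed d → ℝ} {c : ℝ} (hW : Wt P0 C N ω c) (hP0 : Continuous P0) :
    ∫ x, (ω x * (‖goodR Q B v ρ x‖ ^ 2 / L) + ω x * (vt x * ρ x + v x * rt x + c * (v x * ρ x))) ≤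
     C * (M * M) / N + ((2 + 3 * L) * (M * M) + M * Cb) * (C / N) + M * M * (C / N) +
      (M * Ca + M * Cb) := by
  obtain ⟨R, hR⟩ := hW.cs
  have hL0 : 0 < L := by linarith [S.L1]
  have hM : 0 ≤ M := (abs_nonneg _).trans (S.mv 0)
  have hCa : 0 ≤ Ca := (abs_nonneg _).trans (S.ha 0)
  have hCb : 0 ≤ Cb := (norm_nonneg _).trans (S.hb 0)
  have v1 : ContDiff ℝ 1 v := S.v2.of_le (by norm_num)
  have r1 : ContDiff ℝ 1 ρ := S.r2.of_le (by norm_num)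
  have w1 : ContDiff ℝ 1 ω := hW.smooth.of_le (by norm_num)
  have vd : Differentiable ℝ v := v1.differentiable one_ne_zero
  have rd : Differentiable ℝ ρ := r1.differentiable one_ne_zero
  have wd : Differentiable ℝ ω := w1.differentiable one_ne_zero
  have hgr := sgrad_zero_of_far ω R hR
  obtain ⟨n1c, n1⟩ := null_div hd (fun x => ω x * v x) (flux P Q B b v ρ) (w1.mul v1) S.fd S.div_cont
    ⟨R, fun x hx => by simp [hR x hx]⟩
  obtain ⟨n2c, n2⟩ := null_lap hd (fun x => ω x * v x) ρ (w1.mul v1) S.r2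
    ⟨R, fun x hx => by simp [hR x hx]⟩
  obtain ⟨n3c, n3⟩ := null_lap hd (fun x => ω x * ρ x) v (w1.mul r1) S.v2
    ⟨R, fun x hx => by simp [hR x hx]⟩
  obtain ⟨n4c, n4⟩ := null_lap hd (fun x => v x * ρ x) ω (v1.mul r1) hW.smooth
    ⟨R, fun x hx => by simp [hgr x hx]⟩
  have hRc := S.goodR_cont
  have hvtc := S.vtc
  have hrtc := S.rtc
  have hvc := v1.continuous
  have hrc := r1.continuous
  have hwc := w1.continuous
  refine int_bound hW hP0 _ _ (fun x => - (v x * ρ x)) ?_ ((n1c.add n2c).sub (n3c.add n4c)) ?_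
    (M * M) _ _ _ (by fun_prop) ?_ ?_ (by positivity) (by positivity) ?_
  · exact ⟨by fun_prop, R, fun x hx => by simp [hR x hx]⟩
  · rw [(n1c.add n2c).integral_sub (n3c.add n4c), n1c.integral_add n2c, n3c.integral_add n4c,
      n1, n2, n3, n4]; simp
  · intro x i; simp only; rw [S.vp, S.rp]
  · intro x
    rw [abs_neg, abs_mul]
    exact mul_le_mul (S.mv x) (S.mr x) (abs_nonneg _) hM
  · intro x
    have hF := psd_bound (r := ρ x) hL0 (Q x) (sgrad v x) (B x) (S.bs x) (S.bb x) (S.form x)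
    have hω := hW.nonneg x
    have hF2 := mul_le_mul_of_nonneg_left hF hω
    simp only [goodR]
    rw [S.eq1 x, S.eq2 x, sgrad_mul (wd x) (vd x), sgrad_mul (wd x) (rd x), sgrad_mul (vd x) (rd x)]
    have eF : ∀ y, ⟪y, flux P Q B b v ρ x⟫ = ρ x * ⟪P0 x, y⟫ + ρ x * ⟪P x - P0 x, y⟫ +
        ρ x * ⟪Q x, y⟫ + ⟪B x (sgrad v x), y⟫ + ⟪b x, y⟫ := fun y => by
      rw [← real_inner_comm]
      simp only [flux, inner_add_left, inner_smul_left, inner_sub_left, RCLike.conj_to_real]; ring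
    have eP : ⟪P x, sgrad v x⟫ = ⟪P0 x, sgrad v x⟫ + ⟪P x - P0 x, sgrad v x⟫ := by
      rw [inner_sub_left]; ring
    simp only [inner_add_left, inner_smul_left, RCLike.conj_to_real, eF, eP, inner_add_right,
      inner_smul_right]
    rw [real_inner_comm (sgrad v x) (sgrad ρ x), real_inner_comm (sgrad v x) (sgrad ω x),
      real_inner_comm (sgrad ρ x) (sgrad ω x)]
    set G := ‖sgrad ω x‖ with hG
    have hG0 : 0 ≤ G := norm_nonneg _
    have av := S.mv x
    have ar := S.mr x
    have b1 : |v x * ρ x * ⟪P x - P0 x, sgrad ω x⟫| ≤ M * M * (L * G) := by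
      rw [abs_mul, abs_mul]
      refine mul_le_mul (mul_le_mul av ar (abs_nonneg _) hM) ?_ (abs_nonneg _) (by positivity)
      exact (abs_real_inner_le_norm _ _).trans (mul_le_mul_of_nonneg_right (S.pp0 x) hG0)
    have b2 : |v x * ρ x * ⟪Q x, sgrad ω x⟫| ≤ M * M * (L * G) := by
      rw [abs_mul, abs_mul]
      refine mul_le_mul (mul_le_mul av ar (abs_nonneg _) hM) ?_ (abs_nonneg _) (by positivity)
      exact (abs_real_inner_le_norm _ _).trans (mul_le_mul_of_nonneg_right (S.qb x) hG0)
    have hBv : ‖B x (sgrad v x)‖ ≤ L * M := ((B x).le_opNorm _).trans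
      (mul_le_mul (S.bb x) (S.mg x) (norm_nonneg _) hL0.le)
    have b3 : |v x * ⟪B x (sgrad v x), sgrad ω x⟫| ≤ M * (L * M * G) := by
      rw [abs_mul]
      refine mul_le_mul av ?_ (abs_nonneg _) hM
      exact (abs_real_inner_le_norm _ _).trans (mul_le_mul_of_nonneg_right hBv hG0)
    have b4 : |v x * ⟪b x, sgrad ω x⟫| ≤ M * (Cb * G) := by
      rw [abs_mul]
      refine mul_le_mul av ?_ (abs_nonneg _) hM
      exact (abs_real_inner_le_norm _ _).trans (mul_le_mul_of_nonneg_right (S.hb x) hG0)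
    have b5 : |ρ x * ⟪sgrad v x, sgrad ω x⟫| ≤ M * (M * G) := by
      rw [abs_mul]
      refine mul_le_mul ar ?_ (abs_nonneg _) hM
      exact (abs_real_inner_le_norm _ _).trans (mul_le_mul_of_nonneg_right (S.mg x) hG0)
    have b6 : |v x * ρ x * lap ω x| ≤ M * M * |lap ω x| := by
      rw [abs_mul, abs_mul]
      exact mul_le_mul_of_nonneg_right (mul_le_mul av ar (abs_nonneg _) hM) (abs_nonneg _)
    have b7 : |ω x * (a x * ρ x)| ≤ ω x * (Ca * M) := by
      rw [abs_mul, abs_mul, abs_of_nonneg hω]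
      exact mul_le_mul_of_nonneg_left (mul_le_mul (S.ha x) ar (abs_nonneg _) hCa) hω
    have b8 : |ω x * ⟪b x, sgrad v x⟫| ≤ ω x * (Cb * M) := by
      rw [abs_mul, abs_of_nonneg hω]
      refine mul_le_mul_of_nonneg_left ?_ hω
      exact (abs_real_inner_le_norm _ _).trans (mul_le_mul (S.hb x) (S.mg x) (norm_nonneg _) hCb)
    replace b1 := abs_le.1 b1
    replace b2 := abs_le.1 b2
    replace b3 := abs_le.1 b3
    replace b4 := abs_le.1 b4
    replace b5 := abs_le.1 b5
    replace b6 := abs_le.1 b6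
    replace b7 := abs_le.1 b7
    replace b8 := abs_le.1 b8
    obtain ⟨b1, b1'⟩ := b1
    obtain ⟨b2, b2'⟩ := b2
    obtain ⟨b3, b3'⟩ := b3
    obtain ⟨b4, b4'⟩ := b4
    obtain ⟨b5, b5'⟩ := b5
    obtain ⟨b6, b6'⟩ := b6
    obtain ⟨b7, b7'⟩ := b7
    obtain ⟨b8, b8'⟩ := b8
    linarith

end

section
variable {L : ℝ} {P0 P Q : Ed d → Ed d} {B : Ed d → Ed d →L[ℝ] Ed d} {h : Ed d → ℝ}
    {a : Ed d → ℝ} {b : Ed d → Ed d} {v ρ vt rt : Ed d → ℝ} {Ca Cb M : ℝ}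

lemma Slice.est2 (hd : 1 ≤ d) (S : Slice L P0 P Q B h a b v ρ vt rt Ca Cb M)
    {C N : ℝ} {ω : Ed d → ℝ} {c K : ℝ} (hW : Wt P0 C N ω c) (hP0 : Continuous P0)
    (hK : L + L ^ 2 + C + 1 ≤ K) :
    ∫ x, (ω x * (2 * (ρ x * rt x) - K * (ρ x * ρ x)) - 3 / 2 * (ω x * ‖goodR Q B v ρ x‖ ^ 2) +
        ω x * (ρ x * ρ x)) ≤
     C * (M * M) / N + (5 * L * (M * M) + 2 * (M * Cb)) * (C / N) + M * M * (C / N) +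
      3 / 2 * (Cb * Cb) := by
  obtain ⟨R, hR⟩ := hW.cs
  have hL0 : 0 < L := by linarith [S.L1]
  have hM : 0 ≤ M := (abs_nonneg _).trans (S.mv 0)
  have hCb : 0 ≤ Cb := (norm_nonneg _).trans (S.hb 0)
  have r1 : ContDiff ℝ 1 ρ := S.r2.of_le (by norm_num)
  have w1 : ContDiff ℝ 1 ω := hW.smooth.of_le (by norm_num)
  have rd : Differentiable ℝ ρ := r1.differentiable one_ne_zero
  have wd : Differentiable ℝ ω := w1.differentiable one_ne_zero
  have hgr := sgrad_zero_of_far ω R hR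
  obtain ⟨n1c, n1⟩ := null_div hd (fun x => ω x * ρ x) (flux P Q B b v ρ) (w1.mul r1) S.fd S.div_cont
    ⟨R, fun x hx => by simp [hR x hx]⟩
  obtain ⟨n2c, n2⟩ := null_lap hd (fun x => ω x * ρ x) ρ (w1.mul r1) S.r2
    ⟨R, fun x hx => by simp [hR x hx]⟩
  obtain ⟨n3c, n3⟩ := null_lap hd (fun x => ρ x * ρ x) ω (r1.mul r1) hW.smooth
    ⟨R, fun x hx => by simp [hgr x hx]⟩
  obtain ⟨n4c, n4⟩ := null_div hd (fun x => ω x * (ρ x * ρ x)) P (w1.mul (r1.mul r1))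
    (S.p1.differentiable one_ne_zero) (diverg_continuous S.p1) ⟨R, fun x hx => by simp [hR x hx]⟩
  have hRc := S.goodR_cont
  have hrtc := S.rtc
  have hrc := r1.continuous
  have hwc := w1.continuous
  refine int_bound hW hP0 _ _ (fun x => - (ρ x * ρ x)) ?_
    (((n1c.add n2c).const_mul 2).sub (n3c.add n4c)) ?_
    (M * M) _ _ _ (by fun_prop) ?_ ?_ (by positivity) (by positivity) ?_
  · exact ⟨by fun_prop, R, fun x hx => by simp [hR x hx]⟩
  · rw [((n1c.add n2c).const_mul 2).integral_sub (n3c.add n4c), integral_const_mul,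
      n1c.integral_add n2c, n3c.integral_add n4c, n1, n2, n3, n4]; simp
  · intro x i; simp only; rw [S.rp]
  · intro x
    rw [abs_neg, abs_mul]
    exact mul_le_mul (S.mr x) (S.mr x) (abs_nonneg _) hM
  · intro x
    have hω := hW.nonneg x
    rw [S.eq2 x, sgrad_mul (g := fun y => ρ y * ρ y) (wd x) ((rd x).mul (rd x)), sgrad_mul (wd x) (rd x), sgrad_mul (rd x) (rd x)]
    set RR := goodR Q B v ρ x with hRR
    set Gv : Ed d := (ρ x / 2) • Q x + RR + b x with hGv
    have eG : Gv = ρ x • Q x + B x (sgrad v x) + b x := by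
      rw [hGv, hRR]; simp only [goodR]
      have : ρ x • Q x = (ρ x / 2) • Q x + (ρ x / 2) • Q x := by rw [← add_smul]; ring_nf
      rw [this]; abel
    have eF : ∀ y, ⟪y, flux P Q B b v ρ x⟫ = ρ x * ⟪P0 x, y⟫ + ρ x * ⟪P x - P0 x, y⟫ + ⟪Gv, y⟫ :=
      fun y => by
      rw [← real_inner_comm, eG]
      simp only [flux, inner_add_left, inner_smul_left, inner_sub_left, RCLike.conj_to_real]; ring
    have eP : ∀ y, ⟪y, P x⟫ = ⟪P0 x, y⟫ + ⟪P x - P0 x, y⟫ := fun y => by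
      rw [inner_sub_left, real_inner_comm]; ring
    simp only [inner_add_left, inner_smul_left, RCLike.conj_to_real, eF, eP, inner_add_right,
      inner_smul_right]
    rw [real_inner_comm (sgrad ρ x) (sgrad ω x), real_inner_self_eq_norm_sq]
    set G := ‖sgrad ω x‖ with hG
    have hG0 : 0 ≤ G := norm_nonneg _
    have ar := S.mr x
    have arr : |ρ x * ρ x| ≤ M * M := by
      rw [abs_mul]; exact mul_le_mul ar ar (abs_nonneg _) hM
    have b1 : |ρ x * ρ x * ⟪P x - P0 x, sgrad ω x⟫| ≤ M * M * (L * G) := by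
      rw [abs_mul]
      refine mul_le_mul arr ?_ (abs_nonneg _) (by positivity)
      exact (abs_real_inner_le_norm _ _).trans (mul_le_mul_of_nonneg_right (S.pp0 x) hG0)
    have hBv : ‖B x (sgrad v x)‖ ≤ L * M := ((B x).le_opNorm _).trans
      (mul_le_mul (S.bb x) (S.mg x) (norm_nonneg _) hL0.le)
    have hGn : ‖Gv‖ ≤ 2 * L * M + Cb := by
      rw [eG]
      refine (norm_add_le _ _).trans (add_le_add ((norm_add_le _ _).trans ?_) (S.hb x))
      have : ‖ρ x • Q x‖ ≤ M * L := by
        rw [norm_smul]; exact mul_le_mul ar (S.qb x) (norm_nonneg _) hM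
      linarith
    have b2 : |ρ x * ⟪Gv, sgrad ω x⟫| ≤ M * ((2 * L * M + Cb) * G) := by
      rw [abs_mul]
      refine mul_le_mul ar ?_ (abs_nonneg _) hM
      exact (abs_real_inner_le_norm _ _).trans (mul_le_mul_of_nonneg_right hGn hG0)
    have b3 : |ρ x * ρ x * lap ω x| ≤ M * M * |lap ω x| := by
      rw [abs_mul]
      exact mul_le_mul_of_nonneg_right arr (abs_nonneg _)
    have b4 : - ⟪Gv, sgrad ρ x⟫ ≤ ‖sgrad ρ x‖ ^ 2 + ‖Gv‖ ^ 2 / 4 := by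
      have := abs_real_inner_le_norm Gv (sgrad ρ x)
      have := (abs_le.1 this).1
      nlinarith [sq_nonneg (‖sgrad ρ x‖ - ‖Gv‖ / 2)]
    have hq : ‖(ρ x / 2) • Q x‖ ≤ |ρ x| * L / 2 := by
      rw [norm_smul, Real.norm_eq_abs, abs_div, abs_two]
      have := mul_le_mul_of_nonneg_left (S.qb x) (abs_nonneg (ρ x))
      linarith
    have b5 : ‖Gv‖ ^ 2 ≤ 3 * (ρ x * ρ x * L ^ 2 / 4 + ‖RR‖ ^ 2 + Cb * Cb) := by
      have h1 : ‖Gv‖ ≤ |ρ x| * L / 2 + ‖RR‖ + Cb :=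
        (norm_add_le _ _).trans (add_le_add ((norm_add_le _ _).trans (add_le_add hq le_rfl)) (S.hb x))
      have h2 : ‖Gv‖ ^ 2 ≤ (|ρ x| * L / 2 + ‖RR‖ + Cb) ^ 2 := pow_le_pow_left₀ (norm_nonneg _) h1 2
      have h3 : |ρ x| * |ρ x| = ρ x * ρ x := abs_mul_abs_self _
      nlinarith [sq_nonneg (|ρ x| * L / 2 - ‖RR‖), sq_nonneg (|ρ x| * L / 2 - Cb), sq_nonneg (‖RR‖ - Cb)]
    have b6 : 2 * ω x * (- ⟪Gv, sgrad ρ x⟫) ≤ 2 * ω x * (‖sgrad ρ x‖ ^ 2 +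
      3 * (ρ x * ρ x * L ^ 2 / 4 + ‖RR‖ ^ 2 + Cb * Cb) / 4) :=
      mul_le_mul_of_nonneg_left (by linarith) (by positivity)
    have hrr : 0 ≤ ρ x * ρ x := mul_self_nonneg _
    have b7 : ω x * (ρ x * ρ x) * (diverg P x - c + 3 / 8 * L ^ 2 + 1 - K) ≤ 0 := by
      refine mul_nonpos_of_nonneg_of_nonpos (by positivity) ?_
      have := (abs_le.1 (S.dp x)).2
      have := (abs_le.1 hW.cbd).1
      nlinarith [sq_nonneg L]
    have b1' := (abs_le.1 b1).1
    have b2' := (abs_le.1 b2).1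
    have b3' := (abs_le.1 b3).2
    linarith
end

/-- the linearized system -/
structure Sys (T L : ℝ) (P0 : Ed d → Ed d) (P Q : ℝ → Ed d → Ed d) (B : ℝ → Ed d → Ed d →L[ℝ] Ed d)
    (h : ℝ → Ed d → ℝ) (a : ℝ → Ed d → ℝ) (b : ℝ → Ed d → Ed d) (v ρ : ℝ → Ed d → ℝ)
    (Ca Cb : ℝ) : Prop where
  hT : 0 < T
  vN : Nice T v
  rN : Nice T ρ
  slice : ∀ t ∈ Icc (0:ℝ) T, ∀ M, (∀ x, |v t x| ≤ M) → (∀ x, ‖sgrad (v t) x‖ ≤ M) →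
    (∀ x, |ρ t x| ≤ M) → Slice L P0 (P t) (Q t) (B t) (h t) (a t) (b t) (v t) (ρ t)
      (tderiv T v t) (tderiv T ρ t) Ca Cb M
  hloc : ∀ t ∈ Icc (0:ℝ) T, ∀ x, ‖x‖ ≤ d + 1 → |h t x| ≤ L ∧ ‖P t x‖ ≤ L
  ini : ∀ x, ρ 0 x = 0
  fin : ∀ x, v T x = 0

lemma cube_int_cont {T B : ℝ} {w : ℝ → Ed d → ℝ}
    (hc : ContinuousOn (fun q : ℝ × Ed d => w q.1 q.2) (Icc 0 T ×ˢ univ))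
    (hb : ∀ t ∈ Icc (0:ℝ) T, ∀ x, |w t x| ≤ B) :
    ContinuousOn (fun t => ∫ x in cube d, w t x) (Icc 0 T) := by
  refine continuousOn_of_dominated (bound := fun _ => B) ?_ ?_ ?_ ?_
  · intro t ht
    have : Continuous (w t) := hc.comp_continuous (f := fun x : Ed d => (t, x)) (by fun_prop)
        (fun q => ⟨ht, mem_univ _⟩)
    exact this.aestronglyMeasurable
  · exact fun t ht => Filter.Eventually.of_forall fun x => hb t ht x
  · exact integrable_const _
  · exact Filter.Eventually.of_forall fun x =>
      hc.comp (f := fun t : ℝ => (t, x)) (by fun_prop) (fun t ht => ⟨ht, mem_univ _⟩)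

lemma le_of_forall_inv {y A D : ℝ} (h : ∀ N : ℝ, 1 ≤ N → y ≤ A + D / N) : y ≤ A := by
  have h1 : Filter.Tendsto (fun N : ℝ => A + D / N) Filter.atTop (nhds (A + 0)) :=
    tendsto_const_nhds.add (tendsto_const_nhds.div_atTop Filter.tendsto_id)
  rw [add_zero] at h1
  exact ge_of_tendsto h1 ((Filter.eventually_ge_atTop 1).mono h)

lemma Nice.slice_cont {T : ℝ} {w : ℝ → Ed d → ℝ} (hc : ContinuousOn (fun q : ℝ × Ed d => w q.1 q.2) (Icc 0 T ×ˢ univ))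
    {t : ℝ} (ht : t ∈ Icc 0 T) : Continuous (w t) :=
  hc.comp_continuous (f := fun x : Ed d => (t, x)) (by fun_prop) (fun q => ⟨ht, mem_univ _⟩)

set_option maxHeartbeats 2000000 in
lemma Sys.energy (hd : 1 ≤ d) (T L : ℝ) (P0 : Ed d → Ed d) (hL : 0 ≤ L)
    (hP : ∀ x y, ‖P0 x - P0 y‖ ≤ L * ‖x - y‖) :
    ∃ C : ℝ, 0 ≤ C ∧ ∀ {P Q : ℝ → Ed d → Ed d} {B : ℝ → Ed d → Ed d →L[ℝ] Ed d}
    {h : ℝ → Ed d → ℝ} {a : ℝ → Ed d → ℝ} {b : ℝ → Ed d → Ed d} {v ρ : ℝ → Ed d → ℝ}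
    {Ca Cb M : ℝ}, Sys T L P0 P Q B h a b v ρ Ca Cb → (∀ t ∈ Icc (0:ℝ) T, ∀ x, |v t x| ≤ M) →
      (∀ t ∈ Icc (0:ℝ) T, ∀ x, ‖sgrad (v t) x‖ ≤ M) → (∀ t ∈ Icc (0:ℝ) T, ∀ x, |ρ t x| ≤ M) →
      ∫ t in (0:ℝ)..T, ∫ x in cube d, ρ t x * ρ t x ≤ C * (M * (Ca + Cb) + Cb * Cb) := by
  obtain ⟨C, hC, hW⟩ := exists_weights hd P0 L hL hP
  have hP0 : Continuous P0 := by
    have : LipschitzWith L.toNNReal P0 := LipschitzWith.of_dist_le_mul fun x y => by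
      rw [dist_eq_norm, dist_eq_norm, Real.coe_toNNReal _ hL]; exact hP x y
    exact this.continuous
  set K := L + L ^ 2 + C + 1 with hKd
  have hK : 0 ≤ K := by positivity
  refine ⟨|T| * (3 / 2 + 3 / 2 * L * Real.exp (2 * C * T)) * Real.exp (K * T), by positivity, ?_⟩
  intro P Q B h a b v ρ Ca Cb M S hv hg hr
  have hT := S.hT
  rw [abs_of_pos hT]
  have m0 : (0:ℝ) ∈ Icc 0 T := ⟨le_rfl, hT.le⟩
  have mT : T ∈ Icc 0 T := ⟨hT.le, le_rfl⟩
  have Sl := fun t ht => S.slice t ht M (hv t ht) (hg t ht) (hr t ht)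
  have hM : 0 ≤ M := (abs_nonneg _).trans (hv 0 m0 0)
  have hCa : 0 ≤ Ca := (abs_nonneg _).trans ((Sl 0 m0).ha 0)
  have hCb : 0 ≤ Cb := (norm_nonneg _).trans ((Sl 0 m0).hb 0)
  have hL0 : 0 < L := by linarith [(Sl 0 m0).L1]
  set E1 : ℝ → ℝ := fun N => C * (M * M) / N + ((2 + 3 * L) * (M * M) + M * Cb) * (C / N) + M * M * (C / N) +
      (M * Ca + M * Cb) with hE1
  set E2 : ℝ → ℝ := fun N => C * (M * M) / N + (5 * L * (M * M) + 2 * (M * Cb)) * (C / N) + M * M * (C / N) +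
      3 / 2 * (Cb * Cb) with hE2
  set Y : ℝ → ℝ := fun t => ∫ x in cube d, ρ t x * ρ t x with hY
  have hrr : ContinuousOn (fun q : ℝ × Ed d => ρ q.1 q.2 * ρ q.1 q.2) (Icc 0 T ×ˢ univ) :=
    S.rN.cont.mul S.rN.cont
  have hrrb : ∀ t ∈ Icc (0:ℝ) T, ∀ x, |ρ t x * ρ t x| ≤ M * M := fun t ht x => by
    rw [abs_mul]; exact mul_le_mul (hr t ht x) (hr t ht x) (abs_nonneg _) hM
  have hYc : ContinuousOn Y (Icc 0 T) := cube_int_cont (w := fun t x => ρ t x * ρ t x) hrr hrrb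
  have hYi : IntervalIntegrable Y volume 0 T := by
    apply ContinuousOn.intervalIntegrable; rwa [uIcc_of_le hT.le]
  have main : ∀ N : ℝ, 1 ≤ N → Real.exp (-(K * T)) * (∫ t in (0:ℝ)..T, Y t) ≤
      T * (E2 N + C * (M * M) / N + 3 / 2 * L * Real.exp (2 * C * T) * E1 N) := by
    intro N hN
    obtain ⟨ω, c, W⟩ := hW N hN
    obtain ⟨R, hR⟩ := W.cs
    have hwc : Continuous ω := W.smooth.continuous
    have hN0 : 0 < N := by linarith
    obtain ⟨i1, f1⟩ := time_ftc 0 T hT.le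
      (fun t x => ω x * (Real.exp (c * t) * (v t x * ρ t x)))
      (fun t x => ω x * (Real.exp (c * t) * (tderiv T v t x * ρ t x + v t x * tderiv T ρ t x + c * (v t x * ρ t x)))) R
      (by
        have := S.rN.cont; have := S.vN.cont
        fun_prop)
      (by
        have := S.rN.cont; have := S.vN.cont; have := S.rN.contt; have := S.vN.contt
        fun_prop)
      (by
        intro t ht x
        have e1 := S.vN.td t ht x
        have e2 := S.rN.td t ht x
        have e3 : HasDerivAt (fun s => Real.exp (c * s)) (Real.exp (c * t) * c) t := by
          simpa using ((hasDerivAt_id t).const_mul c).exp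
        refine ((e3.mul (e1.mul e2)).const_mul (ω x)).congr_deriv ?_
        simp only [Pi.mul_apply]; ring)
      (by intro t _ x hx; simp [hR x hx])
      (by intro t _ x hx; simp [hR x hx])
    obtain ⟨i2, f2⟩ := time_ftc 0 T hT.le
      (fun t x => ω x * (Real.exp (-K * t) * (ρ t x * ρ t x)))
      (fun t x => ω x * (Real.exp (-K * t) * (2 * (ρ t x * tderiv T ρ t x) - K * (ρ t x * ρ t x)))) R
      (by
        have := S.rN.cont
        fun_prop)
      (by
        have := S.rN.cont; have := S.rN.contt
        fun_prop)
      (by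
        intro t ht x
        have e2 := S.rN.td t ht x
        have e3 : HasDerivAt (fun s => Real.exp (-K * s)) (Real.exp (-K * t) * (-K)) t := by
          simpa using ((hasDerivAt_id t).const_mul (-K)).exp
        refine ((e3.mul (e2.mul e2)).const_mul (ω x)).congr_deriv ?_
        simp only [Pi.mul_apply]; ring)
      (by intro t _ x hx; simp [hR x hx])
      (by intro t _ x hx; simp [hR x hx])
    have z1 : (∫ x, ω x * (Real.exp (c * T) * (v T x * ρ T x))) = 0 := by simp [S.fin]
    have z2 : (∫ x, ω x * (Real.exp (c * 0) * (v 0 x * ρ 0 x))) = 0 := by simp [S.ini]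
    have z3 : (∫ x, ω x * (Real.exp (-K * 0) * (ρ 0 x * ρ 0 x))) = 0 := by simp [S.ini]
    have z4 : 0 ≤ (∫ x, ω x * (Real.exp (-K * T) * (ρ T x * ρ T x))) :=
      integral_nonneg fun x => mul_nonneg (W.nonneg x) (mul_nonneg (Real.exp_nonneg _) (mul_self_nonneg _))
    rw [z1, z2, sub_zero] at f1
    rw [z3, sub_zero] at f2
    set A1 : ℝ → ℝ := fun t => ∫ x, ω x * (Real.exp (c * t) * (tderiv T v t x * ρ t x + v t x * tderiv T ρ t x + c * (v t x * ρ t x))) with hA1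
    set A2 : ℝ → ℝ := fun t => ∫ x, ω x * (Real.exp (-K * t) * (2 * (ρ t x * tderiv T ρ t x) - K * (ρ t x * ρ t x))) with hA2
    have pt : ∀ t ∈ Icc 0 T, A2 t + Real.exp (-(K * T)) * Y t + 3 / 2 * L * Real.exp (C * T) * A1 t ≤
        E2 N + C * (M * M) / N + 3 / 2 * L * Real.exp (2 * C * T) * E1 N := by
      intro t ht
      have s1 := (Sl t ht).est1 hd W hP0
      have s2 := (Sl t ht).est2 hd (K := K) W hP0 le_rfl
      have vc := Nice.slice_cont S.vN.cont ht
      have rc := Nice.slice_cont S.rN.cont ht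
      have vtc := (Sl t ht).vtc
      have rtc := (Sl t ht).rtc
      have Rc := (Sl t ht).goodR_cont
      set X := ∫ x, ω x * ‖goodR (Q t) (B t) (v t) (ρ t) x‖ ^ 2 with hX
      set J1 := ∫ x, ω x * (tderiv T v t x * ρ t x + v t x * tderiv T ρ t x + c * (v t x * ρ t x)) with hJ1
      set J2 := ∫ x, ω x * (2 * (ρ t x * tderiv T ρ t x) - K * (ρ t x * ρ t x)) with hJ2
      set Z := ∫ x, ω x * (ρ t x * ρ t x) with hZ
      have c1 : CS (fun x => ω x * ‖goodR (Q t) (B t) (v t) (ρ t) x‖ ^ 2) :=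
        ⟨by fun_prop, R, fun x hx => by simp [hR x hx]⟩
      have c1' : CS (fun x => ω x * (‖goodR (Q t) (B t) (v t) (ρ t) x‖ ^ 2 / L)) :=
        ⟨by fun_prop, R, fun x hx => by simp [hR x hx]⟩
      have c2 : CS (fun x => ω x * (tderiv T v t x * ρ t x + v t x * tderiv T ρ t x + c * (v t x * ρ t x))) :=
        ⟨by fun_prop, R, fun x hx => by simp [hR x hx]⟩
      have c3 : CS (fun x => ω x * (2 * (ρ t x * tderiv T ρ t x) - K * (ρ t x * ρ t x))) :=
        ⟨by fun_prop, R, fun x hx => by simp [hR x hx]⟩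
      have c4 : CS (fun x => ω x * (ρ t x * ρ t x)) :=
        ⟨by fun_prop, R, fun x hx => by simp [hR x hx]⟩
      have e1 : ∫ x, ω x * (‖goodR (Q t) (B t) (v t) (ρ t) x‖ ^ 2 / L) = X / L := by
        rw [hX, ← integral_div]; congr 1; funext x; ring
      rw [c1'.integral_add c2, e1] at s1
      rw [(c3.sub (c1.const_mul (3 / 2))).integral_add c4, c3.integral_sub (c1.const_mul (3/2)),
        integral_const_mul] at s2
      have e2 : A1 t = Real.exp (c * t) * J1 := by
        simp only [hA1, hJ1]; rw [← integral_const_mul]; congr 1; funext x; ring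
      have e3 : A2 t = Real.exp (-K * t) * J2 := by
        simp only [hA2, hJ2]; rw [← integral_const_mul]; congr 1; funext x; ring
      have e4 := W.avg (fun x => ρ t x * ρ t x) (M * M) (by fun_prop)
        (fun x i => by simp only; rw [S.rN.per t ht]) (hrrb t ht)
      have e5 : (∫ x, ρ t x * ρ t x * ω x) = Z := by
        rw [hZ]; congr 1; funext x; ring
      rw [e5] at e4
      have e4' := (abs_le.1 e4).1
      have hX0 : 0 ≤ X := integral_nonneg fun x => mul_nonneg (W.nonneg x) (by positivity)
      have hY0 : 0 ≤ Y t := setIntegral_nonneg cube_measurable fun x _ => mul_self_nonneg _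
      change X / L + J1 ≤ E1 N at s1
      change J2 - 3 / 2 * X + Z ≤ E2 N at s2
      change -(C * (M * M) / N) ≤ Z - Y t at e4'
      have hE10 : 0 ≤ E1 N := by positivity
      have hE20 : 0 ≤ E2 N := by positivity
      have he3 : 0 ≤ C * (M * M) / N := by positivity
      have s1' : X ≤ L * (E1 N - J1) := by
        rw [div_add' _ _ _ hL0.ne', div_le_iff₀ hL0] at s1; linarith
      rw [e2, e3]
      have q1 : Real.exp (-K * t) ≤ 1 := Real.exp_le_one_iff.2 (by nlinarith [ht.1])
      have q2 : Real.exp (-(K * T)) ≤ Real.exp (-K * t) := Real.exp_le_exp.2 (by nlinarith [ht.2])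
      have hcb := abs_le.1 W.cbd
      have q3 : 1 ≤ Real.exp (C * T) * Real.exp (c * t) := by
        rw [← Real.exp_add]; apply Real.one_le_exp; nlinarith [ht.1, ht.2]
      have q4 : Real.exp (C * T) * Real.exp (c * t) ≤ Real.exp (2 * C * T) := by
        rw [← Real.exp_add]; apply Real.exp_le_exp.2; nlinarith [ht.1, ht.2]
      have q0 : 0 < Real.exp (-K * t) := Real.exp_pos _
      set Ek := Real.exp (-K * t)
      set Ec := Real.exp (C * T) * Real.exp (c * t) with hEc
      have w1 : Ek * (J2 + Y t) ≤ Ek * (E2 N + C * (M * M) / N + 3 / 2 * X) :=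
        mul_le_mul_of_nonneg_left (by linarith) q0.le
      have w2 : Ek * (E2 N + C * (M * M) / N + 3 / 2 * X) ≤ E2 N + C * (M * M) / N + 3 / 2 * X :=
        mul_le_of_le_one_left (by positivity) q1
      have w3 : X ≤ Ec * X := le_mul_of_one_le_left hX0 q3
      have w4 : Ec * X ≤ Ec * (L * (E1 N - J1)) := mul_le_mul_of_nonneg_left s1' (by positivity)
      have w5 : Ec * (L * E1 N) ≤ Real.exp (2 * C * T) * (L * E1 N) :=
        mul_le_mul_of_nonneg_right q4 (by positivity)
      have w6 : Real.exp (-(K * T)) * Y t ≤ Ek * Y t := mul_le_mul_of_nonneg_right q2 hY0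
      have w7 : 3 / 2 * L * Real.exp (C * T) * (Real.exp (c * t) * J1) = 3 / 2 * (Ec * (L * J1)) := by
        rw [hEc]; ring
      rw [w7]
      linarith
    have ii := intervalIntegral.integral_mono_on hT.le
      ((i2.add (hYi.const_mul (Real.exp (-(K * T))))).add (i1.const_mul (3 / 2 * L * Real.exp (C * T))))
      (_root_.intervalIntegrable_const (c := E2 N + C * (M * M) / N + 3 / 2 * L * Real.exp (2 * C * T) * E1 N)) pt
    rw [intervalIntegral.integral_add (i2.add (hYi.const_mul (Real.exp (-(K * T)))))
      (i1.const_mul (3 / 2 * L * Real.exp (C * T))), intervalIntegral.integral_add i2 (hYi.const_mul _),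
      intervalIntegral.integral_const_mul, intervalIntegral.integral_const_mul, f1, f2,
      intervalIntegral.integral_const] at ii
    simp only [smul_eq_mul, sub_zero, mul_zero, add_zero] at ii
    linarith
  have fin := le_of_forall_inv (y := Real.exp (-(K * T)) * (∫ t in (0:ℝ)..T, Y t))
    (A := T * (3 / 2 * (Cb * Cb) + 3 / 2 * L * Real.exp (2 * C * T) * (M * Ca + M * Cb)))
    (D := T * (C * (M * M) + (5 * L * (M * M) + 2 * (M * Cb)) * C + M * M * C + C * (M * M) +
      3 / 2 * L * Real.exp (2 * C * T) * (C * (M * M) + ((2 + 3 * L) * (M * M) + M * Cb) * C + M * M * C)))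
    (fun N hN => (main N hN).trans (le_of_eq (by simp only [hE1, hE2]; ring)))
  have hek : Real.exp (-(K * T)) * Real.exp (K * T) = 1 := by rw [← Real.exp_add]; simp
  have g := mul_le_mul_of_nonneg_right fin (Real.exp_nonneg (K * T))
  rw [mul_right_comm, hek, one_mul] at g
  refine g.trans ?_
  have : T * (3 / 2 * (Cb * Cb) + 3 / 2 * L * Real.exp (2 * C * T) * (M * Ca + M * Cb)) ≤
    T * (3 / 2 + 3 / 2 * L * Real.exp (2 * C * T)) * (M * (Ca + Cb) + Cb * Cb) := by
    rw [mul_assoc T]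
    refine mul_le_mul_of_nonneg_left ?_ hT.le
    have : 0 ≤ L * Real.exp (2 * C * T) * (Cb * Cb) := by positivity
    have : 0 ≤ M * (Ca + Cb) := by positivity
    nlinarith
  calc _ ≤ (T * (3 / 2 + 3 / 2 * L * Real.exp (2 * C * T)) * (M * (Ca + Cb) + Cb * Cb)) * Real.exp (K * T) :=
        mul_le_mul_of_nonneg_right this (Real.exp_nonneg _)
    _ = _ := by ring

/-- heat kernel up to normalization -/
def Gk (τ : ℝ) (y : Ed d) : ℝ := τ ^ (-(d:ℝ) / 2) * Real.exp (-(4 * τ)⁻¹ * ‖y‖ ^ 2)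

/-- derivative of the heat kernel -/
def Ke (e : Ed d) (τ : ℝ) (y : Ed d) : ℝ := -((2 * τ)⁻¹) * ⟪y, e⟫ * Gk τ y

lemma Gk_contDiff (τ : ℝ) : ContDiff ℝ 2 (Gk (d := d) τ) := by
  unfold Gk
  have : ContDiff ℝ 2 (fun y : Ed d => ‖y‖ ^ 2) := contDiff_norm_sq ℝ
  fun_prop

lemma Ke_contDiff (e : Ed d) (τ : ℝ) : ContDiff ℝ 2 (Ke e τ) := by
  unfold Ke
  have := Gk_contDiff (d := d) τ
  have h : ContDiff ℝ 2 (fun y : Ed d => ⟪y, e⟫) := contDiff_id.inner ℝ contDiff_const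
  fun_prop

lemma sgrad_Gk (τ : ℝ) (y : Ed d) : sgrad (Gk τ) y = (-((2 * τ)⁻¹) * Gk τ y) • y := by
  unfold sgrad
  apply HasGradientAt.gradient
  rw [hasGradientAt_iff_hasFDerivAt]
  have h1 : HasFDerivAt (fun y : Ed d => ‖y‖ ^ 2) (2 • (innerSL ℝ) y) y :=
    (hasStrictFDerivAt_norm_sq y).hasFDerivAt
  have h2 := ((h1.const_mul (-(4 * τ)⁻¹)).exp).const_mul (τ ^ (-(d:ℝ) / 2))
  refine HasFDerivAt.congr_fderiv (f := Gk τ) h2 ?_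
  ext e
  simp [Gk]
  ring

lemma lap_Gk (τ : ℝ) (y : Ed d) :
    lap (Gk τ) y = ((2 * τ)⁻¹ * (2 * τ)⁻¹ * ‖y‖ ^ 2 - d * (2 * τ)⁻¹) * Gk τ y := by
  rw [← diverg_sgrad (Gk_contDiff τ)]
  have e : sgrad (Gk (d := d) τ) = fun y => (-((2 * τ)⁻¹) * Gk τ y) • y := funext (sgrad_Gk τ)
  have hd : Differentiable ℝ (Gk (d := d) τ) := (Gk_contDiff τ).differentiable two_ne_zero
  rw [e, diverg_smul (fun y => (-((2 * τ)⁻¹) * Gk τ y)) (fun y => y) y (by fun_prop) (by fun_prop),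
    sgrad_const_mul _ _ (hd y), sgrad_Gk]
  have : diverg (fun y : Ed d => y) y = d := by
    simp [diverg, ebasis_norm]
  rw [this]
  simp only [inner_smul_left, RCLike.conj_to_real, real_inner_self_eq_norm_sq]
  ring

lemma Gk_heat {τ : ℝ} (hτ : 0 < τ) (y : Ed d) :
    HasDerivAt (fun s => Gk s y) (lap (Gk τ) y) τ := by
  rw [lap_Gk]
  have h1 : HasDerivAt (fun s : ℝ => s ^ (-(d:ℝ) / 2)) (-(d:ℝ) / 2 * τ ^ (-(d:ℝ) / 2 - 1)) τ :=
    Real.hasDerivAt_rpow_const (Or.inl hτ.ne')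
  have h2 : HasDerivAt (fun s : ℝ => -(4 * s)⁻¹ * ‖y‖ ^ 2) (4 / (4 * τ) ^ 2 * ‖y‖ ^ 2) τ := by
    have h3 : HasDerivAt (fun s : ℝ => 4 * s) 4 τ := by simpa using (hasDerivAt_id τ).const_mul 4
    have := ((h3.inv (by positivity)).neg.mul_const (‖y‖ ^ 2))
    refine this.congr_deriv ?_
    ring
  refine (h1.mul h2.exp).congr_deriv ?_
  rw [Real.rpow_sub_one hτ.ne']
  unfold Gk
  field_simp
  ring

lemma sgrad_Ke (e : Ed d) (τ : ℝ) (y : Ed d) :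
    sgrad (Ke e τ) y = (-((2 * τ)⁻¹) * ⟪y, e⟫) • sgrad (Gk τ) y + (-((2 * τ)⁻¹) * Gk τ y) • e := by
  have hd : Differentiable ℝ (Gk (d := d) τ) := (Gk_contDiff τ).differentiable two_ne_zero
  have hin : Differentiable ℝ (fun y : Ed d => ⟪y, e⟫) := differentiable_id.inner ℝ (differentiable_const e)
  have h1 : sgrad (fun y => -((2 * τ)⁻¹) * ⟪y, e⟫) y = (-((2 * τ)⁻¹)) • e := by
    unfold sgrad
    apply HasGradientAt.gradient
    rw [hasGradientAt_iff_hasFDerivAt]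
    have h2 : HasFDerivAt (fun y : Ed d => ⟪e, y⟫) (innerSL ℝ e) y := (innerSL ℝ e).hasFDerivAt
    have h3 := h2.const_mul (-((2 * τ)⁻¹))
    have e4 : (fun y : Ed d => -((2 * τ)⁻¹) * ⟪y, e⟫) = fun y => -((2 * τ)⁻¹) * ⟪e, y⟫ := by
      funext y; rw [real_inner_comm]
    rw [e4]
    refine h3.congr_fderiv ?_
    ext z
    simp
  have := sgrad_mul (f := fun y : Ed d => -((2 * τ)⁻¹) * ⟪y, e⟫) (g := Gk τ) (x := y)
    (by fun_prop) (hd y)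
  change sgrad (fun y => -((2 * τ)⁻¹) * ⟪y, e⟫ * Gk τ y) y = _
  rw [this, h1, smul_smul, mul_comm (Gk τ y)]

lemma lap_Ke (e : Ed d) (τ : ℝ) (y : Ed d) :
    lap (Ke e τ) y = -((2 * τ)⁻¹) * ⟪y, e⟫ * lap (Gk τ) y +
      2 * ((2 * τ)⁻¹ * (2 * τ)⁻¹) * ⟪y, e⟫ * Gk τ y := by
  have hd : Differentiable ℝ (Gk (d := d) τ) := (Gk_contDiff τ).differentiable two_ne_zero
  have hin : Differentiable ℝ (fun y : Ed d => ⟪y, e⟫) := differentiable_id.inner ℝ (differentiable_const e)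
  have hd2 : Differentiable ℝ (sgrad (Gk (d := d) τ)) :=
    (sgrad_contDiff (Gk_contDiff τ)).differentiable one_ne_zero
  have h1 : sgrad (fun y => -((2 * τ)⁻¹) * ⟪y, e⟫) y = (-((2 * τ)⁻¹)) • e := by
    unfold sgrad
    apply HasGradientAt.gradient
    rw [hasGradientAt_iff_hasFDerivAt]
    have h2 : HasFDerivAt (fun y : Ed d => ⟪e, y⟫) (innerSL ℝ e) y := (innerSL ℝ e).hasFDerivAt
    have h3 := h2.const_mul (-((2 * τ)⁻¹))
    have e4 : (fun y : Ed d => -((2 * τ)⁻¹) * ⟪y, e⟫) = fun y => -((2 * τ)⁻¹) * ⟪e, y⟫ := by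
      funext y; rw [real_inner_comm]
    rw [e4]
    refine h3.congr_fderiv ?_
    ext z
    simp
  rw [← diverg_sgrad (Ke_contDiff e τ), funext (sgrad_Ke e τ), diverg_add _ _ _ (by fun_prop) (by fun_prop),
    diverg_smul (fun y => (-((2 * τ)⁻¹) * ⟪y, e⟫)) (sgrad (Gk τ)) y (by fun_prop) (by fun_prop),
    diverg_smul (fun y => (-((2 * τ)⁻¹) * Gk τ y)) (fun _ => e) y (by fun_prop) (by fun_prop),
    h1, sgrad_const_mul _ _ (hd y), diverg_sgrad (Gk_contDiff τ), sgrad_Gk]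
  have : diverg (fun _ : Ed d => e) y = 0 := by simp [diverg]
  rw [this]
  simp only [inner_smul_left, inner_smul_right, RCLike.conj_to_real, real_inner_comm e y]
  ring

lemma Ke_heat (e : Ed d) {τ : ℝ} (hτ : 0 < τ) (y : Ed d) :
    HasDerivAt (fun s => Ke e s y) (lap (Ke e τ) y) τ := by
  rw [lap_Ke]
  have h2 : HasDerivAt (fun s : ℝ => -((2 * s)⁻¹) * ⟪y, e⟫) (2 / (2 * τ) ^ 2 * ⟪y, e⟫) τ := by
    have h3 : HasDerivAt (fun s : ℝ => 2 * s) 2 τ := by simpa using (hasDerivAt_id τ).const_mul 2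
    have := ((h3.inv (by positivity)).neg.mul_const ⟪y, e⟫)
    refine this.congr_deriv ?_
    ring
  refine (h2.mul (Gk_heat hτ y)).congr_deriv ?_
  field_simp
  ring

lemma Gk_cont : ContinuousOn (fun q : ℝ × Ed d => Gk q.1 q.2) (Ioi 0 ×ˢ univ) := by
  have h1 : ContinuousOn (fun q : ℝ × Ed d => q.1 ^ (-(d:ℝ) / 2)) (Ioi 0 ×ˢ univ) :=
    ContinuousOn.rpow_const (by fun_prop) (fun q hq => Or.inl (ne_of_gt hq.1))
  have h2 : ContinuousOn (fun q : ℝ × Ed d => (4 * q.1)⁻¹) (Ioi 0 ×ˢ univ) :=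
    ContinuousOn.inv₀ (by fun_prop) (fun q hq => by have : 0 < q.1 := hq.1; positivity)
  unfold Gk
  fun_prop

lemma inv_cont : ContinuousOn (fun q : ℝ × Ed d => (2 * q.1)⁻¹) (Ioi 0 ×ˢ univ) :=
  ContinuousOn.inv₀ (by fun_prop) (fun q hq => by have : 0 < q.1 := hq.1; positivity)

lemma Gk_contl : ContinuousOn (fun q : ℝ × Ed d => lap (Gk q.1) q.2) (Ioi 0 ×ˢ univ) := by
  have h1 := Gk_cont (d := d)
  have h2 := inv_cont (d := d)
  simp only [lap_Gk]
  fun_prop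

lemma Ke_cont (e : Ed d) : ContinuousOn (fun q : ℝ × Ed d => Ke e q.1 q.2) (Ioi 0 ×ˢ univ) := by
  have h1 := Gk_cont (d := d)
  have h2 := inv_cont (d := d)
  unfold Ke
  fun_prop

lemma Ke_contl (e : Ed d) : ContinuousOn (fun q : ℝ × Ed d => lap (Ke e q.1) q.2) (Ioi 0 ×ˢ univ) := by
  have h1 := Gk_cont (d := d)
  have h3 := Gk_contl (d := d)
  have h2 := inv_cont (d := d)
  simp only [lap_Ke]
  fun_prop

lemma gauss_int {b : ℝ} (hb : 0 < b) : Integrable (fun y : Ed d => Real.exp (-b * ‖y‖ ^ 2)) := by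
  apply Integrable.of_integral_ne_zero
  rw [GaussianFourier.integral_rexp_neg_mul_sq_norm hb]
  positivity

/-- The dominating gaussian. -/
def Dk (τ : ℝ) (y : Ed d) : ℝ := τ ^ (-(1:ℝ) / 2) * (τ ^ (-(d:ℝ) / 2) * Real.exp (-(8 * τ)⁻¹ * ‖y‖ ^ 2))

lemma Dk_nonneg {τ : ℝ} (hτ : 0 < τ) (y : Ed d) : 0 ≤ Dk τ y := by unfold Dk; positivity

lemma Dk_integrable {τ : ℝ} (hτ : 0 < τ) : Integrable (Dk (d := d) τ) := by
  unfold Dk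
  exact ((gauss_int (by positivity)).const_mul _).const_mul _

lemma Dk_integral {τ : ℝ} (hτ : 0 < τ) :
    ∫ y, Dk (d := d) τ y = (8 * Real.pi) ^ ((d:ℝ) / 2) * τ ^ (-(1:ℝ) / 2) := by
  unfold Dk
  rw [integral_const_mul, integral_const_mul, GaussianFourier.integral_rexp_neg_mul_sq_norm (by positivity)]
  have : Real.pi / (8 * τ)⁻¹ = 8 * Real.pi * τ := by field_simp
  rw [this, Real.mul_rpow (by positivity) hτ.le, finrank_euclideanSpace_fin]
  have h2 : τ ^ (-(d:ℝ) / 2) * τ ^ ((d:ℝ) / 2) = 1 := by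
    rw [← Real.rpow_add hτ]; ring_nf; simp
  calc _ = (τ ^ (-(d:ℝ) / 2) * τ ^ ((d:ℝ) / 2)) * ((8 * Real.pi) ^ ((d:ℝ) / 2) * τ ^ (-(1:ℝ) / 2)) := by ring
    _ = _ := by rw [h2, one_mul]

lemma Dk_sup {τ : ℝ} (hτ : 0 < τ) (y : Ed d) : Dk τ y ≤ τ ^ (-(1 + d:ℝ) / 2) := by
  unfold Dk
  rw [← mul_assoc, ← Real.rpow_add hτ]
  have : (-(1:ℝ) / 2 + -(d:ℝ) / 2) = -(1 + d:ℝ) / 2 := by ring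
  rw [this]
  refine mul_le_of_le_one_right (by positivity) (Real.exp_le_one_iff.2 ?_)
  have : 0 ≤ (8 * τ)⁻¹ * ‖y‖ ^ 2 := by positivity
  linarith

lemma Gk_le {τ T1 : ℝ} (hτ : 0 < τ) (h1 : τ ≤ T1) (y : Ed d) : |Gk τ y| ≤ T1 ^ ((1:ℝ) / 2) * Dk τ y := by
  have h0 : 0 ≤ Gk τ y := by unfold Gk; positivity
  rw [abs_of_nonneg h0]
  unfold Gk Dk
  rw [← mul_assoc]
  have e1 : 1 ≤ T1 ^ ((1:ℝ) / 2) * τ ^ (-(1:ℝ) / 2) := by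
    have : τ ^ ((1:ℝ) / 2) ≤ T1 ^ ((1:ℝ) / 2) := Real.rpow_le_rpow hτ.le h1 (by norm_num)
    have e : τ ^ ((1:ℝ) / 2) * τ ^ (-(1:ℝ) / 2) = 1 := by
      rw [← Real.rpow_add hτ]; norm_num
    calc 1 = τ ^ ((1:ℝ) / 2) * τ ^ (-(1:ℝ) / 2) := e.symm
      _ ≤ _ := mul_le_mul_of_nonneg_right this (by positivity)
  refine le_trans ?_ (le_mul_of_one_le_left (by positivity) e1)
  refine mul_le_mul_of_nonneg_left (Real.exp_le_exp.2 ?_) (by positivity)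
  have : (8 * τ)⁻¹ ≤ (4 * τ)⁻¹ := inv_anti₀ (by positivity) (by linarith)
  nlinarith [sq_nonneg ‖y‖]

lemma gauss_le {τ : ℝ} (hτ : 0 < τ) (y : Ed d) : (2 * τ)⁻¹ * ‖y‖ * Gk τ y ≤ Dk τ y := by
  unfold Gk Dk
  have e1 : Real.exp (-(4 * τ)⁻¹ * ‖y‖ ^ 2) =
      Real.exp (-(8 * τ)⁻¹ * ‖y‖ ^ 2) * Real.exp (-(8 * τ)⁻¹ * ‖y‖ ^ 2) := by
    rw [← Real.exp_add]; congr 1; field_simp; ring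
  have e2 : (2 * τ)⁻¹ * ‖y‖ * Real.exp (-(8 * τ)⁻¹ * ‖y‖ ^ 2) ≤ τ ^ (-(1:ℝ) / 2) := by
    have h3 : τ ^ (-(1:ℝ) / 2) = (√τ)⁻¹ := by
      rw [Real.sqrt_eq_rpow, ← Real.rpow_neg hτ.le]; norm_num
    rw [h3]
    obtain ⟨r, hr, rfl⟩ : ∃ r, 0 < r ∧ τ = r ^ 2 := ⟨√τ, Real.sqrt_pos.2 hτ, (Real.sq_sqrt hτ.le).symm⟩
    rw [Real.sqrt_sq hr.le]
    have h4 := Real.add_one_le_exp ((8 * r ^ 2)⁻¹ * ‖y‖ ^ 2)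
    rw [neg_mul, Real.exp_neg, ← div_eq_mul_inv, div_le_iff₀ (Real.exp_pos _)]
    refine le_trans ?_ (mul_le_mul_of_nonneg_left h4 (by positivity))
    have : r⁻¹ * ((8 * r ^ 2)⁻¹ * ‖y‖ ^ 2 + 1) - (2 * r ^ 2)⁻¹ * ‖y‖ =
      r⁻¹ * (((8 * r ^ 2)⁻¹ * (‖y‖ - 2 * r) ^ 2) + 1 / 2) := by
      field_simp; ring
    have h6 : 0 ≤ r⁻¹ * (((8 * r ^ 2)⁻¹ * (‖y‖ - 2 * r) ^ 2) + 1 / 2) := by positivity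
    linarith
  rw [e1]
  calc _ = ((2 * τ)⁻¹ * ‖y‖ * Real.exp (-(8 * τ)⁻¹ * ‖y‖ ^ 2)) * (τ ^ (-(d:ℝ) / 2) * Real.exp (-(8 * τ)⁻¹ * ‖y‖ ^ 2)) := by ring
    _ ≤ _ := mul_le_mul_of_nonneg_right e2 (by positivity)

lemma Ke_le {e : Ed d} (he : ‖e‖ ≤ 1) {τ : ℝ} (hτ : 0 < τ) (y : Ed d) : |Ke e τ y| ≤ Dk τ y := by
  refine le_trans ?_ (gauss_le hτ y)
  have h0 : 0 ≤ Gk τ y := by unfold Gk; positivity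
  unfold Ke
  rw [abs_mul, abs_mul, abs_neg, abs_of_nonneg h0, abs_of_nonneg (by positivity : (0:ℝ) ≤ (2 * τ)⁻¹)]
  refine mul_le_mul_of_nonneg_right (mul_le_mul_of_nonneg_left ?_ (by positivity)) h0
  refine (abs_real_inner_le_norm _ _).trans (mul_le_of_le_one_right (norm_nonneg _) he)

lemma sgrad_Gk_le {τ : ℝ} (hτ : 0 < τ) (y : Ed d) : ‖sgrad (Gk τ) y‖ ≤ Dk τ y := by
  refine le_trans (le_of_eq ?_) (gauss_le hτ y)
  have h0 : 0 ≤ Gk τ y := by unfold Gk; positivity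
  rw [sgrad_Gk, norm_smul, Real.norm_eq_abs, abs_mul, abs_neg, abs_of_nonneg h0,
    abs_of_nonneg (by positivity : (0:ℝ) ≤ (2 * τ)⁻¹)]
  ring

lemma Gk_limit (g : Ed d → ℝ) (hg : CS g) (x0 : Ed d) :
    Filter.Tendsto (fun c : ℝ => ∫ y, Gk ((c ^ 2)⁻¹) (y - x0) * g y) Filter.atTop
      (nhds ((4 * Real.pi) ^ ((d:ℝ) / 2) * g x0)) := by
  set A : ℝ := (4 * Real.pi) ^ ((d:ℝ) / 2) with hA
  have hA0 : 0 < A := by positivity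
  have hI : ∫ y : Ed d, Real.exp (-(1/4) * ‖y‖ ^ 2) = A := by
    rw [GaussianFourier.integral_rexp_neg_mul_sq_norm (by norm_num), finrank_euclideanSpace_fin, hA]
    congr 1; ring
  have key := tendsto_integral_comp_smul_smul_of_integrable' (μ := (volume : Measure (Ed d)))
    (φ := fun y => A⁻¹ * Real.exp (-(1/4) * ‖y‖ ^ 2)) (fun x => by positivity)
    (by rw [integral_const_mul, hI, inv_mul_cancel₀ hA0.ne']) ?_ (g := g) (x₀ := x0) hg.integrable
      hg.1.continuousAt
  · have := key.const_mul A
    refine this.congr' ?_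
    filter_upwards [Filter.eventually_gt_atTop 0] with c hc
    rw [← integral_const_mul]
    congr 1
    funext y
    rw [finrank_euclideanSpace_fin, smul_eq_mul]
    unfold Gk
    have e1 : ((c ^ 2)⁻¹) ^ (-(d:ℝ) / 2) = c ^ d := by
      rw [Real.inv_rpow (by positivity), ← Real.rpow_neg (by positivity), ← Real.rpow_natCast c 2,
        ← Real.rpow_mul hc.le, ← Real.rpow_natCast c d]
      congr 1; push_cast; ring
    rw [e1, norm_smul, norm_sub_rev x0 y, mul_pow, Real.norm_eq_abs, sq_abs]
    have e2 : -(4 * (c ^ 2)⁻¹)⁻¹ * ‖y - x0‖ ^ 2 = -(1/4) * (c ^ 2 * ‖y - x0‖ ^ 2) := by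
      field_simp
    rw [e2]
    field_simp
  · have h1 := tendsto_rpow_abs_mul_exp_neg_mul_sq_cocompact (a := 1/4) (by norm_num) d
    have h2 : Filter.Tendsto (fun x : Ed d => ‖x‖) (Bornology.cobounded _) (Filter.cocompact ℝ) :=
      tendsto_norm_cobounded_atTop.mono_right atTop_le_cocompact
    have h3 := (h1.comp h2).const_mul A⁻¹
    rw [mul_zero] at h3
    refine h3.congr fun x => ?_
    simp only [Function.comp, abs_norm, finrank_euclideanSpace_fin, Real.rpow_natCast]
    ring

lemma sgrad_trans (f : Ed d → ℝ) (x0 x : Ed d) :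
    sgrad (fun y => f (y - x0)) x = sgrad f (x - x0) := by
  simp only [sgrad, gradient, fderiv_comp_sub]

lemma lap_trans (f : Ed d → ℝ) (x0 x : Ed d) :
    lap (fun y => f (y - x0)) x = lap f (x - x0) := by
  unfold lap
  refine Finset.sum_congr rfl fun i _ => ?_
  unfold partial2
  simp only [fderiv_comp_sub]
  exact congrArg (fun z => z (ebasis d i))
    (fderiv_comp_sub (𝕜 := ℝ) (f := fun y => fderiv ℝ f y (ebasis d i)) (x := x) x0)

/-- kernels for the heat equation -/
structure Ker (k : ℝ → Ed d → ℝ) (C T1 : ℝ) : Prop where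
  c2 : ∀ τ, ContDiff ℝ 2 (k τ)
  heat : ∀ τ, 0 < τ → ∀ y, HasDerivAt (fun s => k s y) (lap (k τ) y) τ
  cont : ContinuousOn (fun q : ℝ × Ed d => k q.1 q.2) (Ioi 0 ×ˢ univ)
  contl : ContinuousOn (fun q : ℝ × Ed d => lap (k q.1) q.2) (Ioi 0 ×ˢ univ)
  bd : ∀ τ, 0 < τ → τ ≤ T1 → ∀ y, |k τ y| ≤ C * Dk τ y

lemma Ker_Gk (T1 : ℝ) (hT1 : 0 ≤ T1) : Ker (Gk (d := d)) (T1 ^ ((1:ℝ) / 2) + 1) T1 :=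
  ⟨Gk_contDiff, fun _ h y => Gk_heat h y, Gk_cont, Gk_contl, fun _ h h1 y => (Gk_le h h1 y).trans
    (mul_le_mul_of_nonneg_right (by linarith) (Dk_nonneg h y))⟩

lemma Ker_Ke (T1 : ℝ) (hT1 : 0 ≤ T1) (e : Ed d) (he : ‖e‖ ≤ 1) : Ker (Ke e) (T1 ^ ((1:ℝ) / 2) + 1) T1 :=
  ⟨Ke_contDiff e, fun _ h y => Ke_heat e h y, Ke_cont e, Ke_contl e, fun _ h h1 y => (Ke_le he h y).trans
    (le_mul_of_one_le_left (Dk_nonneg h y) (by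
      have : 0 ≤ T1 ^ ((1:ℝ) / 2) := Real.rpow_nonneg hT1 _
      linarith))⟩

/-- cut-off function -/
structure Cut (φ : Ed d → ℝ) (A : ℝ) : Prop where
  c2 : ContDiff ℝ 2 φ
  one : φ 0 = 1
  grad0 : sgrad φ 0 = 0
  supp : ∀ z, 1 / 2 ≤ ‖z‖ → φ z = 0 ∧ sgrad φ z = 0 ∧ lap φ z = 0
  bd : ∀ z, |φ z| ≤ 1 ∧ ‖sgrad φ z‖ ≤ A ∧ |lap φ z| ≤ A

lemma exists_cut : ∃ (φ : Ed d → ℝ) (A : ℝ), 0 ≤ A ∧ Cut φ A := by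
  let f : ContDiffBump (0 : Ed d) := ⟨1/8, 1/4, by norm_num, by norm_num⟩
  have h2 : ContDiff ℝ 2 (f : Ed d → ℝ) := f.contDiff
  have hs : ∀ z, 1 / 4 < ‖z‖ → (f : Ed d → ℝ) z = 0 := fun z hz => by
    apply f.zero_of_le_dist
    simpa [f] using hz.le
  have hg := sgrad_zero_of_far _ _ hs
  have hl : ∀ z, 1 / 4 < ‖z‖ → lap (f : Ed d → ℝ) z = 0 := fun z hz => by
    rw [← diverg_sgrad h2]; exact diverg_zero_of_far _ _ hg z hz
  have cg := sgrad_continuous (h2.of_le (by norm_num))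
  have cl := lap_continuous h2
  obtain ⟨A1, hA1⟩ := (isCompact_closedBall (0 : Ed d) (1/4)).exists_bound_of_continuousOn cg.continuousOn
  obtain ⟨A2, hA2⟩ := (isCompact_closedBall (0 : Ed d) (1/4)).exists_bound_of_continuousOn cl.continuousOn
  have mem0 : (0 : Ed d) ∈ Metric.closedBall (0 : Ed d) (1/4) := by simp
  have p1 : 0 ≤ A1 := (norm_nonneg _).trans (hA1 0 mem0)
  have p2 : 0 ≤ A2 := (norm_nonneg _).trans (hA2 0 mem0)
  refine ⟨f, A1 + A2, by positivity, h2, ?_, ?_, fun z hz => ?_, fun z => ⟨?_, ?_, ?_⟩⟩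
  · exact f.one_of_mem_closedBall (by simp [f])
  · have : (f : Ed d → ℝ) =ᶠ[nhds 0] fun _ => 1 := f.eventuallyEq_one
    simp [sgrad, gradient, this.fderiv_eq]
  · have hz : 1 / 4 < ‖z‖ := by linarith
    exact ⟨hs z hz, hg z hz, hl z hz⟩
  · rw [abs_of_nonneg f.nonneg]; exact f.le_one
  · by_cases hz : ‖z‖ ≤ 1 / 4
    · have := hA1 z (by simpa using hz); linarith
    · rw [hg z (not_le.1 hz)]; simp; positivity
  · by_cases hz : ‖z‖ ≤ 1 / 4
    · have := hA2 z (by simpa using hz); rw [Real.norm_eq_abs] at this; linarith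
    · rw [hl z (not_le.1 hz)]; simp; positivity

lemma ker_trans_cont {w : ℝ → Ed d → ℝ} (hc : ContinuousOn (fun q : ℝ × Ed d => w q.1 q.2) (Ioi 0 ×ˢ univ))
    {θ : ℝ → ℝ} (hθ : Continuous θ) {t0 t1 : ℝ} (hpos : ∀ s ∈ Icc t0 t1, 0 < θ s) (x0 : Ed d) :
    ContinuousOn (fun q : ℝ × Ed d => w (θ q.1) (q.2 - x0)) (Icc t0 t1 ×ˢ univ) :=
  hc.comp (f := fun q : ℝ × Ed d => (θ q.1, q.2 - x0)) (by fun_prop) (fun q hq => ⟨hpos _ hq.1, mem_univ _⟩)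

lemma sub_far {x0 y : Ed d} (hy : ‖x0‖ + 1 < ‖y‖) : 1 / 2 ≤ ‖y - x0‖ := by
  have := norm_sub_norm_le y x0
  linarith

/-- Duhamel identity, backward equation -/
lemma duh_v (hd : 1 ≤ d) {k : ℝ → Ed d → ℝ} {C T1 : ℝ} (hk : Ker k C T1) {φ : Ed d → ℝ} {A : ℝ} (hφ : Cut φ A)
    {T t0 ε : ℝ} (hε : 0 < ε) (ht0 : t0 ∈ Icc 0 T) {v : ℝ → Ed d → ℝ} (hv : Nice T v) (x0 : Ed d) :
    let J : ℝ → ℝ := fun s => ∫ y, k (s - t0 + ε) (y - x0) * (φ (y - x0) * (tderiv T v s y + lap (v s) y) +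
        2 * ⟪sgrad φ (y - x0), sgrad (v s) y⟫ + v s y * lap φ (y - x0))
    IntervalIntegrable J volume t0 T ∧
    ∫ s in t0..T, J s = (∫ y, k (T - t0 + ε) (y - x0) * (φ (y - x0) * v T y)) -
      ∫ y, k ε (y - x0) * (φ (y - x0) * v t0 y) := by
  intro J
  set θ : ℝ → ℝ := fun s => s - t0 + ε with hθ
  have hpos : ∀ s ∈ Icc t0 T, 0 < θ s := fun s hs => by simp only [hθ]; linarith [hs.1]
  have hsub : Icc t0 T ⊆ Icc 0 T := Icc_subset_Icc_left ht0.1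
  have hφc : Continuous φ := hφ.c2.continuous
  have hfar : ∀ y, ‖x0‖ + 1 < ‖y‖ → φ (y - x0) = 0 ∧ sgrad φ (y - x0) = 0 ∧ lap φ (y - x0) = 0 :=
    fun y hy => hφ.supp _ (sub_far hy)
  have ck := ker_trans_cont hk.cont (θ := θ) (by fun_prop) hpos x0
  have cl := ker_trans_cont (w := fun τ => lap (k τ)) hk.contl (θ := θ) (by fun_prop) hpos x0
  have cv := hv.cont.mono (prod_mono hsub (subset_refl (univ : Set (Ed d))))
  have cvt := hv.contt.mono (prod_mono hsub (subset_refl (univ : Set (Ed d))))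
  have cφ : ∀ S : Set (ℝ × Ed d), ContinuousOn (fun q : ℝ × Ed d => φ (q.2 - x0)) S := fun S =>
    (hφc.comp (by fun_prop : Continuous fun q : ℝ × Ed d => q.2 - x0)).continuousOn
  obtain ⟨i1, f1⟩ := time_ftc t0 T ht0.2
    (fun s y => k (θ s) (y - x0) * (φ (y - x0) * v s y))
    (fun s y => lap (k (θ s)) (y - x0) * (φ (y - x0) * v s y) +
      k (θ s) (y - x0) * (φ (y - x0) * tderiv T v s y)) (‖x0‖ + 1)
    (ck.mul ((cφ _).mul cv)) ((cl.mul ((cφ _).mul cv)).add (ck.mul ((cφ _).mul cvt)))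
    (by
      intro s hs y
      have e1 := hv.td s ⟨ht0.1.trans_lt hs.1, hs.2⟩ y
      have e2 : HasDerivAt θ 1 s := by
        simpa [hθ] using ((hasDerivAt_id s).sub_const t0).add_const ε
      have e3 := HasDerivAt.comp s (hk.heat (θ s) (hpos s ⟨hs.1.le, hs.2.le⟩) (y - x0)) e2
      have e4 := e3.mul (e1.const_mul (φ (y - x0)))
      refine e4.congr_deriv ?_
      simp)
    (by intro s _ y hy; simp [(hfar y hy).1])
    (by intro s _ y hy; simp [(hfar y hy).1])
  have key : ∀ s ∈ Icc t0 T, (∫ y, (lap (k (θ s)) (y - x0) * (φ (y - x0) * v s y) +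
      k (θ s) (y - x0) * (φ (y - x0) * tderiv T v s y))) = J s := by
    intro s hs
    set κ : Ed d → ℝ := fun y => k (θ s) (y - x0) with hκ
    set χ : Ed d → ℝ := fun y => φ (y - x0) with hχ
    have κ2 : ContDiff ℝ 2 κ := (hk.c2 (θ s)).comp (by fun_prop)
    have χ2 : ContDiff ℝ 2 χ := hφ.c2.comp (by fun_prop)
    have v2 := hv.c2 s (hsub hs)
    have κ1 : ContDiff ℝ 1 κ := κ2.of_le (by norm_num)
    have χ1 : ContDiff ℝ 1 χ := χ2.of_le (by norm_num)
    have v1 : ContDiff ℝ 1 (v s) := v2.of_le (by norm_num)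
    have κd : Differentiable ℝ κ := κ1.differentiable one_ne_zero
    have χd : Differentiable ℝ χ := χ1.differentiable one_ne_zero
    have vd : Differentiable ℝ (v s) := v1.differentiable one_ne_zero
    have vtc : Continuous (tderiv T v s) := Nice.slice_cont hv.contt (hsub hs)
    have el : ∀ y, lap (k (θ s)) (y - x0) = lap κ y := fun y => (lap_trans _ _ _).symm
    have eg : ∀ y, sgrad φ (y - x0) = sgrad χ y := fun y => (sgrad_trans _ _ _).symm
    have el' : ∀ y, lap φ (y - x0) = lap χ y := fun y => (lap_trans _ _ _).symm
    have hf2 : ∀ y, ‖x0‖ + 1 < ‖y‖ → χ y = 0 ∧ sgrad χ y = 0 ∧ lap χ y = 0 := fun y hy => by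
      rw [← eg, ← el']; exact hfar y hy
    obtain ⟨c1, n1⟩ := null_lap hd (fun y => χ y * v s y) κ (χ1.mul v1) κ2
      ⟨‖x0‖ + 1, fun y hy => by simp [(hf2 y hy).1]⟩
    obtain ⟨c2, n2⟩ := null_lap hd (fun y => κ y * χ y) (v s) (κ1.mul χ1) v2
      ⟨‖x0‖ + 1, fun y hy => by simp [(hf2 y hy).1]⟩
    obtain ⟨c3, n3⟩ := null_lap hd (fun y => κ y * v s y) χ (κ1.mul v1) χ2
      ⟨‖x0‖ + 1, fun y hy => by simp [(hf2 y hy).2.1]⟩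
    have κc := κ1.continuous
    have χc := χ1.continuous
    have vc := v1.continuous
    have κlc := lap_continuous κ2
    have c0 : CS (fun y => lap κ y * (χ y * v s y) + κ y * (χ y * tderiv T v s y)) :=
      ⟨by fun_prop, ‖x0‖ + 1, fun y hy => by simp [(hf2 y hy).1]⟩
    simp only [J, el, eg, el']
    change (∫ y, (lap κ y * (χ y * v s y) + κ y * (χ y * tderiv T v s y))) = ∫ y, κ y * (χ y * _ + _ + _)
    have z := c1.sub (c2.add c3)
    have z0 := c1.integral_sub (c2.add c3)
    rw [c2.integral_add c3, n1, n2, n3, add_zero, sub_zero] at z0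
    rw [← sub_zero (∫ y, (lap κ y * (χ y * v s y) + κ y * (χ y * tderiv T v s y))), ← z0,
      ← c0.integral_sub z]
    congr 1
    funext y
    rw [sgrad_mul (χd y) (vd y), sgrad_mul (κd y) (χd y), sgrad_mul (κd y) (vd y)]
    simp only [inner_add_left, inner_smul_left, RCLike.conj_to_real]
    rw [real_inner_comm (sgrad κ y) (sgrad (v s) y), real_inner_comm (sgrad κ y) (sgrad χ y),
      real_inner_comm (sgrad χ y) (sgrad (v s) y)]
    ring
  refine ⟨i1.congr fun s hs => ?_, ?_⟩
  · rw [uIoc_of_le ht0.2] at hs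
    exact key s ⟨hs.1.le, hs.2⟩
  · rw [← intervalIntegral.integral_congr (fun s hs => key s (by rwa [uIcc_of_le ht0.2] at hs)), f1]
    simp [hθ]

/-- Duhamel identity, forward equation -/
lemma duh_r (hd : 1 ≤ d) {k : ℝ → Ed d → ℝ} {C T1 : ℝ} (hk : Ker k C T1) {φ : Ed d → ℝ} {A : ℝ} (hφ : Cut φ A)
    {T t0 ε : ℝ} (hε : 0 < ε) (ht0 : t0 ∈ Icc 0 T) {ρ : ℝ → Ed d → ℝ} (hr : Nice T ρ) (x0 : Ed d)
    (F : ℝ → Ed d → Ed d) (hF : ∀ s ∈ Icc 0 T, Differentiable ℝ (F s))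
    (hdF : ∀ s ∈ Icc 0 T, ∀ x, tderiv T ρ s x = lap (ρ s) x + diverg (F s) x) :
    let J : ℝ → ℝ := fun s => ∫ y, (2 * ρ s y * ⟪sgrad (k (t0 + ε - s)) (y - x0), sgrad φ (y - x0)⟫ +
        k (t0 + ε - s) (y - x0) * (ρ s y * lap φ (y - x0)) -
        (k (t0 + ε - s) (y - x0) * ⟪sgrad φ (y - x0), F s y⟫ +
          φ (y - x0) * ⟪sgrad (k (t0 + ε - s)) (y - x0), F s y⟫))
    IntervalIntegrable J volume 0 t0 ∧
    ∫ s in (0:ℝ)..t0, J s = (∫ y, k ε (y - x0) * (φ (y - x0) * ρ t0 y)) -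
      ∫ y, k (t0 + ε) (y - x0) * (φ (y - x0) * ρ 0 y) := by
  intro J
  set θ : ℝ → ℝ := fun s => t0 + ε - s with hθ
  have hpos : ∀ s ∈ Icc 0 t0, 0 < θ s := fun s hs => by simp only [hθ]; linarith [hs.2]
  have hsub : Icc 0 t0 ⊆ Icc 0 T := Icc_subset_Icc_right ht0.2
  have hφc : Continuous φ := hφ.c2.continuous
  have hfar : ∀ y, ‖x0‖ + 1 < ‖y‖ → φ (y - x0) = 0 ∧ sgrad φ (y - x0) = 0 ∧ lap φ (y - x0) = 0 :=
    fun y hy => hφ.supp _ (sub_far hy)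
  have ck := ker_trans_cont hk.cont (θ := θ) (by fun_prop) hpos x0
  have cl := ker_trans_cont (w := fun τ => lap (k τ)) hk.contl (θ := θ) (by fun_prop) hpos x0
  have cv := hr.cont.mono (prod_mono hsub (subset_refl (univ : Set (Ed d))))
  have cvt := hr.contt.mono (prod_mono hsub (subset_refl (univ : Set (Ed d))))
  have cφ : ∀ S : Set (ℝ × Ed d), ContinuousOn (fun q : ℝ × Ed d => φ (q.2 - x0)) S := fun S =>
    (hφc.comp (by fun_prop : Continuous fun q : ℝ × Ed d => q.2 - x0)).continuousOn
  obtain ⟨i1, f1⟩ := time_ftc 0 t0 ht0.1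
    (fun s y => k (θ s) (y - x0) * (φ (y - x0) * ρ s y))
    (fun s y => -lap (k (θ s)) (y - x0) * (φ (y - x0) * ρ s y) +
      k (θ s) (y - x0) * (φ (y - x0) * tderiv T ρ s y)) (‖x0‖ + 1)
    (ck.mul ((cφ _).mul cv)) ((cl.neg.mul ((cφ _).mul cv)).add (ck.mul ((cφ _).mul cvt)))
    (by
      intro s hs y
      have e1 := hr.td s ⟨hs.1, hs.2.trans_le ht0.2⟩ y
      have e2 : HasDerivAt θ (-1) s := by
        simpa [hθ] using (hasDerivAt_id s).const_sub (t0 + ε)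
      have e3 := HasDerivAt.comp s (hk.heat (θ s) (hpos s ⟨hs.1.le, hs.2.le⟩) (y - x0)) e2
      have e4 := e3.mul (e1.const_mul (φ (y - x0)))
      refine e4.congr_deriv ?_
      simp)
    (by intro s _ y hy; simp [(hfar y hy).1])
    (by intro s _ y hy; simp [(hfar y hy).1])
  have key : ∀ s ∈ Icc 0 t0, (∫ y, (-lap (k (θ s)) (y - x0) * (φ (y - x0) * ρ s y) +
      k (θ s) (y - x0) * (φ (y - x0) * tderiv T ρ s y))) = J s := by
    intro s hs
    set κ : Ed d → ℝ := fun y => k (θ s) (y - x0) with hκ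
    set χ : Ed d → ℝ := fun y => φ (y - x0) with hχ
    have κ2 : ContDiff ℝ 2 κ := (hk.c2 (θ s)).comp (by fun_prop)
    have χ2 : ContDiff ℝ 2 χ := hφ.c2.comp (by fun_prop)
    have v2 := hr.c2 s (hsub hs)
    have κ1 : ContDiff ℝ 1 κ := κ2.of_le (by norm_num)
    have χ1 : ContDiff ℝ 1 χ := χ2.of_le (by norm_num)
    have v1 : ContDiff ℝ 1 (ρ s) := v2.of_le (by norm_num)
    have κd : Differentiable ℝ κ := κ1.differentiable one_ne_zero
    have χd : Differentiable ℝ χ := χ1.differentiable one_ne_zero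
    have vd : Differentiable ℝ (ρ s) := v1.differentiable one_ne_zero
    have vtc : Continuous (tderiv T ρ s) := Nice.slice_cont hr.contt (hsub hs)
    have dFc : Continuous (diverg (F s)) := by
      have : diverg (F s) = fun x => tderiv T ρ s x - lap (ρ s) x := by
        funext x; rw [hdF s (hsub hs)]; ring
      rw [this]
      have := lap_continuous v2
      fun_prop
    have el : ∀ y, lap (k (θ s)) (y - x0) = lap κ y := fun y => (lap_trans _ _ _).symm
    have eg : ∀ y, sgrad φ (y - x0) = sgrad χ y := fun y => (sgrad_trans _ _ _).symm
    have egk : ∀ y, sgrad (k (t0 + ε - s)) (y - x0) = sgrad κ y := fun y => (sgrad_trans _ _ _).symm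
    have el' : ∀ y, lap φ (y - x0) = lap χ y := fun y => (lap_trans _ _ _).symm
    have hf2 : ∀ y, ‖x0‖ + 1 < ‖y‖ → χ y = 0 ∧ sgrad χ y = 0 ∧ lap χ y = 0 := fun y hy => by
      rw [← eg, ← el']; exact hfar y hy
    obtain ⟨c1, n1⟩ := null_lap hd (fun y => χ y * ρ s y) κ (χ1.mul v1) κ2
      ⟨‖x0‖ + 1, fun y hy => by simp [(hf2 y hy).1]⟩
    obtain ⟨c2, n2⟩ := null_lap hd (fun y => κ y * χ y) (ρ s) (κ1.mul χ1) v2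
      ⟨‖x0‖ + 1, fun y hy => by simp [(hf2 y hy).1]⟩
    obtain ⟨c3, n3⟩ := null_lap hd (fun y => κ y * ρ s y) χ (κ1.mul v1) χ2
      ⟨‖x0‖ + 1, fun y hy => by simp [(hf2 y hy).2.1]⟩
    obtain ⟨c4, n4⟩ := null_div hd (fun y => κ y * χ y) (F s) (κ1.mul χ1) (hF s (hsub hs)) dFc
      ⟨‖x0‖ + 1, fun y hy => by simp [(hf2 y hy).1]⟩
    have κc := κ1.continuous
    have χc := χ1.continuous
    have vc := v1.continuous
    have κlc := lap_continuous κ2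
    have c0 : CS (fun y => -lap κ y * (χ y * ρ s y) + κ y * (χ y * tderiv T ρ s y)) :=
      ⟨by fun_prop, ‖x0‖ + 1, fun y hy => by simp [(hf2 y hy).1]⟩
    simp only [J, el, eg, el', egk]
    change (∫ y, (-lap κ y * (χ y * ρ s y) + κ y * (χ y * tderiv T ρ s y))) =
      ∫ y, (_ + κ y * _ - (κ y * _ + χ y * _))
    have z := (c1.add c3).sub (c2.add c4)
    have z0 := (c1.add c3).integral_sub (c2.add c4)
    rw [c2.integral_add c4, c1.integral_add c3, n1, n2, n3, n4, add_zero, sub_zero] at z0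
    rw [← add_zero (∫ y, (-lap κ y * (χ y * ρ s y) + κ y * (χ y * tderiv T ρ s y))), ← z0,
      ← c0.integral_add z]
    congr 1
    funext y
    rw [sgrad_mul (χd y) (vd y), sgrad_mul (κd y) (χd y), sgrad_mul (κd y) (vd y), hdF s (hsub hs)]
    simp only [inner_add_left, inner_smul_left, RCLike.conj_to_real]
    rw [real_inner_comm (sgrad κ y) (sgrad (ρ s) y), real_inner_comm (sgrad κ y) (sgrad χ y),
      real_inner_comm (sgrad χ y) (sgrad (ρ s) y)]
    ring
  refine ⟨i1.congr fun s hs => ?_, ?_⟩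
  · rw [uIoc_of_le ht0.1] at hs
    exact key s ⟨hs.1.le, hs.2⟩
  · rw [← intervalIntegral.integral_congr (fun s hs => key s (by rwa [uIcc_of_le ht0.1] at hs)), f1]
    simp [hθ]

lemma ball_ind_integrable {g : Ed d → ℝ} (hg : Continuous g) (x0 : Ed d) :
    Integrable ((Metric.ball x0 (1/2)).indicator fun y => |g y|) := by
  rw [integrable_indicator_iff Metric.isOpen_ball.measurableSet]
  exact (hg.abs.continuousOn.integrableOn_compact (isCompact_closedBall x0 (1/2))).mono_set
    Metric.ball_subset_closedBall

lemma ball_le_cube {g : Ed d → ℝ} (hg : Continuous g) (hp : ZPeriodic g) {B : ℝ} (hB : ∀ x, |g x| ≤ B)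
    (x0 : Ed d) :
    ∫ y, (Metric.ball x0 (1/2)).indicator (fun y => |g y|) y ≤ ∫ y in cube d, |g y| := by
  set hh : Ed d := WithLp.toLp 2 fun _ => (1/2 : ℝ) with hhd
  have hp' : ZPeriodic fun y => |g y| := fun x i => by simp only [hp x i]
  rw [← hp'.cube_shift (x0 - hh), ← integral_add_left_eq_self _ (x0 - hh),
    ← integral_indicator cube_measurable]
  refine integral_mono ((ball_ind_integrable hg x0).comp_add_left (x0 - hh)) ?_ ?_
  · rw [integrable_indicator_iff cube_measurable]
    exact bdd_integrable_cube (by fun_prop) B (fun x => by rw [abs_abs]; exact hB _)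
  · intro z
    by_cases hz : x0 - hh + z ∈ Metric.ball x0 (1/2)
    · have hc : z ∈ cube d := by
        intro i
        rw [Metric.mem_ball, dist_eq_norm] at hz
        have h1 := (PiLp.norm_apply_le (x0 - hh + z - x0) i).trans_lt hz
        have h2 : (x0 - hh + z - x0) i = z i - 1/2 := by
          simp [hhd]; ring
        rw [h2, Real.norm_eq_abs, abs_lt] at h1
        constructor <;> linarith [h1.1, h1.2]
      simp only [indicator_of_mem hz, indicator_of_mem hc]; exact le_rfl
    · simp only [indicator_of_notMem hz]
      exact indicator_nonneg (fun _ _ => abs_nonneg _) _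

lemma imp_iter (Pr : ℝ → Prop) (D : ℝ) (hD : 0 ≤ D) (mono : ∀ B B', B ≤ B' → Pr B → Pr B')
    (h0 : ∃ B, 0 ≤ B ∧ Pr B) (hs : ∀ B, 0 ≤ B → Pr B → Pr (B / 2 + D)) :
    ∃ B : ℝ, 0 ≤ B ∧ ∀ n : ℕ, Pr (B / 2 ^ n + 2 * D) := by
  obtain ⟨B, hB, h⟩ := h0
  refine ⟨B, hB, fun n => ?_⟩
  induction n with
  | zero => exact mono B _ (by simp; exact hD) h
  | succ n ih =>
    have := hs _ (by positivity) ih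
    have e : (B / 2 ^ n + 2 * D) / 2 + D = B / 2 ^ (n + 1) + 2 * D := by rw [pow_succ]; field_simp; ring
    rwa [e] at this

lemma imp_lim {y B D w : ℝ} (h : ∀ n : ℕ, y ≤ (B / 2 ^ n + 2 * D) * w) : y ≤ 2 * D * w := by
  have h1 : Filter.Tendsto (fun n : ℕ => (B / 2 ^ n + 2 * D) * w) Filter.atTop (nhds ((0 + 2 * D) * w)) := by
    refine ((Filter.Tendsto.add ?_ tendsto_const_nhds).mul_const w)
    exact tendsto_const_nhds.div_atTop (tendsto_pow_atTop_atTop_of_one_lt (by norm_num))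
  rw [zero_add] at h1
  exact ge_of_tendsto' h1 h

lemma rpow_time {a b : ℝ} (ha : 0 < a) (_ : a ≤ b) :
    IntervalIntegrable (fun τ : ℝ => τ ^ (-(3:ℝ) / 4)) volume a b ∧
    ∫ τ in a..b, τ ^ (-(3:ℝ) / 4) ≤ 4 * b ^ ((1:ℝ) / 4) := by
  refine ⟨intervalIntegral.intervalIntegrable_rpow' (by norm_num), ?_⟩
  rw [integral_rpow (Or.inl (by norm_num))]
  have e : (-(3:ℝ) / 4 + 1) = 1 / 4 := by norm_num
  rw [e]
  have : 0 ≤ a ^ ((1:ℝ) / 4) := by positivity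
  have h : (b ^ ((1:ℝ) / 4) - a ^ ((1:ℝ) / 4)) / (1 / 4) = 4 * b ^ ((1:ℝ) / 4) - 4 * a ^ ((1:ℝ) / 4) := by ring
  rw [h]; linarith

lemma time_v {t0 T ε T1 : ℝ} (h0 : t0 ≤ T) (hε : 0 < ε) (h1 : T - t0 + ε ≤ T1) :
    IntervalIntegrable (fun s : ℝ => (s - t0 + ε) ^ (-(3:ℝ) / 4)) volume t0 T ∧
    ∫ s in t0..T, (s - t0 + ε) ^ (-(3:ℝ) / 4) ≤ 4 * T1 ^ ((1:ℝ) / 4) := by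
  obtain ⟨i, hi⟩ := rpow_time hε (by linarith : ε ≤ T - t0 + ε)
  have e : ∀ s : ℝ, s - t0 + ε = s + (ε - t0) := fun s => by ring
  constructor
  · have := i.comp_add_right (ε - t0)
    simp only [e]
    convert this using 1 <;> ring
  · simp only [e]
    rw [intervalIntegral.integral_comp_add_right (fun τ : ℝ => τ ^ (-(3:ℝ) / 4))]
    have e1 : t0 + (ε - t0) = ε := by ring
    have e2 : T + (ε - t0) = T - t0 + ε := by ring
    rw [e1, e2]
    refine hi.trans ?_
    have := Real.rpow_le_rpow (by linarith) h1 (by norm_num : (0:ℝ) ≤ 1 / 4)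
    linarith

lemma time_r {t0 ε T1 : ℝ} (h0 : 0 ≤ t0) (hε : 0 < ε) (h1 : t0 + ε ≤ T1) :
    IntervalIntegrable (fun s : ℝ => (t0 + ε - s) ^ (-(3:ℝ) / 4)) volume 0 t0 ∧
    ∫ s in (0:ℝ)..t0, (t0 + ε - s) ^ (-(3:ℝ) / 4) ≤ 4 * T1 ^ ((1:ℝ) / 4) := by
  obtain ⟨i, hi⟩ := rpow_time hε (by linarith : ε ≤ t0 + ε)
  constructor
  · have := (i.comp_sub_left (t0 + ε)).symm
    convert this using 1 <;> ring
  · rw [intervalIntegral.integral_comp_sub_left (fun τ : ℝ => τ ^ (-(3:ℝ) / 4))]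
    have e1 : t0 + ε - t0 = ε := by ring
    rw [e1, sub_zero]
    refine hi.trans ?_
    have := Real.rpow_le_rpow (by linarith) h1 (by norm_num : (0:ℝ) ≤ 1 / 4)
    linarith

lemma half_le {τ T1 : ℝ} (hτ : 0 < τ) (h : τ ≤ T1) :
    τ ^ (-(1:ℝ) / 2) ≤ T1 ^ ((1:ℝ) / 4) * τ ^ (-(3:ℝ) / 4) := by
  have e : τ ^ (-(1:ℝ) / 2) = τ ^ ((1:ℝ) / 4) * τ ^ (-(3:ℝ) / 4) := by
    rw [← Real.rpow_add hτ]; norm_num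
  rw [e]
  exact mul_le_mul_of_nonneg_right (Real.rpow_le_rpow hτ.le h (by norm_num)) (by positivity)

/-- the exponential weight gains a small factor -/
lemma exp_gain {K τ : ℝ} (hK : 0 < K) (hτ : 0 < τ) :
    τ ^ (-(1:ℝ) / 2) * Real.exp (-(K * τ)) ≤ K ^ (-(1:ℝ) / 4) * τ ^ (-(3:ℝ) / 4) := by
  have h1 : Real.exp (-(K * τ)) ≤ (K * τ) ^ (-(1:ℝ) / 4) := by
    have hx : 0 < K * τ := by positivity
    have : (K * τ) ^ ((1:ℝ) / 4) ≤ Real.exp (K * τ) := by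
      rcases le_total (K * τ) 1 with h | h
      · exact (Real.rpow_le_one hx.le h (by norm_num)).trans (Real.one_le_exp hx.le)
      · calc (K * τ) ^ ((1:ℝ) / 4) ≤ (K * τ) ^ (1:ℝ) := Real.rpow_le_rpow_of_exponent_le h (by norm_num)
          _ ≤ Real.exp (K * τ) := by
            rw [Real.rpow_one]; linarith [Real.add_one_le_exp (K * τ)]
    have e : (-(1:ℝ) / 4) = -(1 / 4) := by norm_num
    rw [Real.exp_neg, e, Real.rpow_neg hx.le]
    exact inv_anti₀ (by positivity) this
  calc _ ≤ τ ^ (-(1:ℝ) / 2) * (K * τ) ^ (-(1:ℝ) / 4) := mul_le_mul_of_nonneg_left h1 (by positivity)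
    _ = _ := by
      rw [Real.mul_rpow hK.le hτ.le]
      have e : τ ^ (-(3:ℝ) / 4) = τ ^ (-(1:ℝ) / 2) * τ ^ (-(1:ℝ) / 4) := by
        rw [← Real.rpow_add hτ]; norm_num
      rw [e]; ring

lemma Dk_int_trans {τ : ℝ} (hτ : 0 < τ) (x0 : Ed d) : Integrable (fun y => Dk τ (y - x0)) ∧
    ∫ y, Dk τ (y - x0) = (8 * Real.pi) ^ ((d:ℝ) / 2) * τ ^ (-(1:ℝ) / 2) :=
  ⟨(Dk_integrable hτ).comp_sub_right x0, by rw [integral_sub_right_eq_self (Dk τ) x0, Dk_integral hτ]⟩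

/-- spatial estimate in the Duhamel formula of the backward equation -/
lemma J_bound {κ br r : Ed d → ℝ} {x0 : Ed d} {C τ X Y R δ : ℝ} (hC : 0 ≤ C) (hX : 0 ≤ X) (hY : 0 ≤ Y)
    (hτ : 0 < τ) (hδ : 0 < δ) (hk : ∀ y, |κ y| ≤ C * Dk τ (y - x0))
    (hr : Continuous r) (hp : ZPeriodic r) (hR : ∀ y, |r y| ≤ R)
    (hb1 : ∀ y, 1 / 2 ≤ ‖y - x0‖ → br y = 0) (hb2 : ∀ y, ‖y - x0‖ < 1 / 2 → |br y| ≤ X + Y * |r y|) :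
    |∫ y, κ y * br y| ≤ C * (8 * Real.pi) ^ ((d:ℝ) / 2) * τ ^ (-(1:ℝ) / 2) * X +
      C * (8 * Real.pi) ^ ((d:ℝ) / 2) * Y * (δ ^ ((1:ℝ) / 4) * τ ^ (-(3:ℝ) / 4) * R) +
      C * Y * (δ ^ (-(1 + d:ℝ) / 2) * ∫ y in cube d, |r y|) := by
  obtain ⟨i1, e1⟩ := Dk_int_trans hτ x0
  have hR0 : 0 ≤ R := (abs_nonneg _).trans (hR 0)
  have hI0 : 0 ≤ ∫ y in cube d, |r y| := integral_nonneg fun y => abs_nonneg _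
  have hbr : ∀ y, |br y| ≤ X + Y * |r y| := fun y => by
    by_cases h : 1 / 2 ≤ ‖y - x0‖
    · rw [hb1 y h, abs_zero]; positivity
    · exact hb2 y (not_le.1 h)
  have hpt : ∀ y, |κ y * br y| ≤ C * Dk τ (y - x0) * |br y| := fun y => by
    rw [abs_mul]; exact mul_le_mul_of_nonneg_right (hk y) (abs_nonneg _)
  set G := (8 * Real.pi) ^ ((d:ℝ) / 2) with hG
  have hG0 : 0 ≤ G := by positivity
  by_cases hc : τ ≤ δ
  · have h1 : |∫ y, κ y * br y| ≤ ∫ y, C * (X + Y * R) * Dk τ (y - x0) := by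
      rw [← Real.norm_eq_abs]
      refine norm_integral_le_of_norm_le (i1.const_mul _) (Filter.Eventually.of_forall fun y => ?_)
      rw [Real.norm_eq_abs]
      refine (hpt y).trans ?_
      have h2 : |br y| ≤ X + Y * R := (hbr y).trans (by gcongr; exact hR y)
      have h3 := Dk_nonneg hτ (y - x0)
      calc _ ≤ C * Dk τ (y - x0) * (X + Y * R) := by gcongr
        _ = _ := by ring
    rw [integral_const_mul, e1] at h1
    refine h1.trans ?_
    have h4 := half_le hτ hc
    have h5 : 0 ≤ C * Y * (δ ^ (-(1 + d:ℝ) / 2) * ∫ y in cube d, |r y|) := by positivity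
    have h6 : C * G * Y * R * τ ^ (-(1:ℝ) / 2) ≤ C * G * Y * R * (δ ^ ((1:ℝ) / 4) * τ ^ (-(3:ℝ) / 4)) :=
      mul_le_mul_of_nonneg_left h4 (by positivity)
    nlinarith
  · have hc := not_le.1 hc
    have hs : ∀ y, Dk τ (y - x0) ≤ δ ^ (-(1 + d:ℝ) / 2) := fun y =>
      (Dk_sup hτ _).trans (Real.rpow_le_rpow_of_nonpos hδ hc.le (by
        have : (0:ℝ) ≤ d := Nat.cast_nonneg d
        linarith))
    have i2 := ball_ind_integrable hr x0
    have h1 : |∫ y, κ y * br y| ≤ ∫ y, (C * X * Dk τ (y - x0) + C * Y * δ ^ (-(1 + d:ℝ) / 2) *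
        (Metric.ball x0 (1/2)).indicator (fun y => |r y|) y) := by
      rw [← Real.norm_eq_abs]
      have ii : Integrable (fun y => (C * X * Dk τ (y - x0) + C * Y * δ ^ (-(1 + d:ℝ) / 2) *
        (Metric.ball x0 (1/2)).indicator (fun y => |r y|) y)) := (i1.const_mul _).add (i2.const_mul _)
      refine norm_integral_le_of_norm_le ii
        (Filter.Eventually.of_forall fun y => ?_)
      rw [Real.norm_eq_abs]
      refine (hpt y).trans ?_
      have h3 := Dk_nonneg hτ (y - x0)
      by_cases h : 1 / 2 ≤ ‖y - x0‖
      · rw [hb1 y h, abs_zero, mul_zero]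
        have := indicator_nonneg (s := Metric.ball x0 (1/2)) (f := fun y => |r y|) (fun _ _ => abs_nonneg _) y
        positivity
      · have hm : y ∈ Metric.ball x0 (1/2) := by
          rw [Metric.mem_ball, dist_eq_norm]; exact not_le.1 h
        rw [indicator_of_mem hm]
        calc _ ≤ C * Dk τ (y - x0) * (X + Y * |r y|) := by gcongr; exact hbr y
          _ = C * X * Dk τ (y - x0) + C * Y * Dk τ (y - x0) * |r y| := by ring
          _ ≤ _ := by gcongr; exact hs y
    rw [integral_add (i1.const_mul _) (i2.const_mul _), integral_const_mul, integral_const_mul, e1] at h1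
    have h2 : C * Y * δ ^ (-(1 + d:ℝ) / 2) * ∫ y, (Metric.ball x0 (1/2)).indicator (fun y => |r y|) y ≤
        C * Y * δ ^ (-(1 + d:ℝ) / 2) * ∫ y in cube d, |r y| :=
      mul_le_mul_of_nonneg_left (ball_le_cube hr hp hR x0) (by positivity)
    have h5 : 0 ≤ C * G * Y * (δ ^ ((1:ℝ) / 4) * τ ^ (-(3:ℝ) / 4) * R) := by positivity
    nlinarith

/-- the time integral of the L¹ norm -/
def Iabs (T : ℝ) (ρ : ℝ → Ed d → ℝ) : ℝ := ∫ s in (0:ℝ)..T, ∫ y in cube d, |ρ s y|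

lemma near_norm {x0 y : Ed d} (hx0 : x0 ∈ cube d) (hy : ‖y - x0‖ < 1 / 2) : ‖y‖ ≤ d + 1 := by
  have h1 := cube_norm x0 hx0
  have h2 := norm_le_norm_add_norm_sub' y x0
  linarith

set_option maxHeartbeats 1000000 in
lemma v_step (hd : 1 ≤ d) {T L : ℝ} {P0 : Ed d → Ed d} {P Q : ℝ → Ed d → Ed d}
    {Bm : ℝ → Ed d → Ed d →L[ℝ] Ed d}
    {h : ℝ → Ed d → ℝ} {a : ℝ → Ed d → ℝ} {b : ℝ → Ed d → Ed d} {v ρ : ℝ → Ed d → ℝ}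
    {Ca Cb : ℝ} (S : Sys T L P0 P Q Bm h a b v ρ Ca Cb)
    {k : ℝ → Ed d → ℝ} {C : ℝ} (hC : 0 ≤ C) (hk : Ker k C (T + 1)) {φ : Ed d → ℝ} {A : ℝ} (hA : 0 ≤ A)
    (hφ : Cut φ A) {K B R δ ε t0 : ℝ} (hK : 1 ≤ K) (hB : 0 ≤ B) (hδ : 0 < δ) (hε : 0 < ε) (hε1 : K * ε ≤ 1)
    (hv : ∀ t ∈ Icc (0:ℝ) T, ∀ x, |v t x| ≤ B * Real.exp (K * (T - t)))
    (hg : ∀ t ∈ Icc (0:ℝ) T, ∀ x, ‖sgrad (v t) x‖ ≤ B * Real.exp (K * (T - t)))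
    (hr : ∀ t ∈ Icc (0:ℝ) T, ∀ x, |ρ t x| ≤ R) (ht0 : t0 ∈ Icc 0 T) {x0 : Ed d} (hx0 : x0 ∈ cube d) :
    |∫ y, k ε (y - x0) * (φ (y - x0) * v t0 y)| ≤
      C * (8 * Real.pi) ^ ((d:ℝ) / 2) * (L + 3 * A + 1) * (3 * K ^ (-(1:ℝ) / 4) * B * Real.exp (K * (T - t0)) +
        (T + 1) ^ ((1:ℝ) / 4) * Ca + δ ^ ((1:ℝ) / 4) * R) * (4 * (T + 1) ^ ((1:ℝ) / 4)) +
      C * (L + 3 * A + 1) * δ ^ (-(1 + d:ℝ) / 2) * Iabs T ρ := by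
  obtain ⟨iJ, eJ⟩ := duh_v hd hk hφ hε ht0 S.vN x0
  have hT := S.hT
  have hsub : Icc t0 T ⊆ Icc 0 T := Icc_subset_Icc_left ht0.1
  have hR0 : 0 ≤ R := (abs_nonneg _).trans (hr t0 ht0 0)
  have slc : ∀ t ∈ Icc (0:ℝ) T, Slice L P0 (P t) (Q t) (Bm t) (h t) (a t) (b t) (v t) (ρ t)
      (tderiv T v t) (tderiv T ρ t) Ca Cb (B * Real.exp (K * (T - t)) + R) := fun t ht => by
    have p1 : 0 ≤ B * Real.exp (K * (T - t)) := by positivity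
    exact S.slice t ht _ (fun x => (hv t ht x).trans (by linarith))
      (fun x => (hg t ht x).trans (by linarith)) (fun x => (hr t ht x).trans (by linarith))
  have hCa : 0 ≤ Ca := (abs_nonneg _).trans ((slc t0 ht0).ha 0)
  have hL1 : 1 ≤ L := (slc t0 ht0).L1
  set N := L + 3 * A + 1 with hN
  have hN0 : 0 ≤ N := by positivity
  set G := (8 * Real.pi) ^ ((d:ℝ) / 2) with hG
  have hG0 : 0 ≤ G := by positivity
  set S1 := (T + 1) ^ ((1:ℝ) / 4) with hS1
  set w0 := Real.exp (K * (T - t0)) with hw0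
  have hε2 : ε ≤ 1 := by nlinarith
  set y : ℝ → ℝ := fun s => ∫ x in cube d, |ρ s x| with hy
  have yc : ContinuousOn y (Icc 0 T) := cube_int_cont (w := fun t x => |ρ t x|) (B := R) S.rN.cont.abs
    (fun t ht x => by rw [abs_abs]; exact hr t ht x)
  have y0 : ∀ s, 0 ≤ y s := fun s => integral_nonneg fun x => abs_nonneg _
  have yi : ∀ p ∈ Icc 0 T, ∀ q ∈ Icc 0 T, IntervalIntegrable y volume p q := fun p hp q hq =>
    (yc.mono (uIcc_subset_Icc hp hq)).intervalIntegrable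
  have m0 : (0:ℝ) ∈ Icc 0 T := ⟨le_rfl, hT.le⟩
  have mT : T ∈ Icc 0 T := ⟨hT.le, le_rfl⟩
  obtain ⟨it, et⟩ := time_v (t0 := t0) (T := T) (T1 := T + 1) ht0.2 hε (by linarith [ht0.1])
  set Z := C * G * N * (3 * K ^ (-(1:ℝ) / 4) * B * w0 + S1 * Ca + δ ^ ((1:ℝ) / 4) * R) with hZ
  have hZ0 : 0 ≤ Z := by positivity
  have hfinal : (∫ y, k (T - t0 + ε) (y - x0) * (φ (y - x0) * v T y)) = 0 := by
    simp [S.fin]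
  rw [hfinal, zero_sub] at eJ
  have hbd : ∀ s ∈ Icc t0 T, ‖∫ y, k (s - t0 + ε) (y - x0) * (φ (y - x0) * (tderiv T v s y + lap (v s) y) +
        2 * ⟪sgrad φ (y - x0), sgrad (v s) y⟫ + v s y * lap φ (y - x0))‖ ≤
      Z * (s - t0 + ε) ^ (-(3:ℝ) / 4) + C * N * δ ^ (-(1 + d:ℝ) / 2) * y s := by
    intro s hs
    have hs' := hsub hs
    have hτ : 0 < s - t0 + ε := by linarith [hs.1]
    have hτ1 : s - t0 + ε ≤ T + 1 := by linarith [hs.2, ht0.1]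
    set τ := s - t0 + ε with hτd
    set β := B * Real.exp (K * (T - s)) with hβ
    have hβ0 : 0 ≤ β := by positivity
    have sl := slc s hs'
    have h1 := J_bound (κ := fun y => k τ (y - x0)) (br := fun y => φ (y - x0) * (tderiv T v s y + lap (v s) y) +
        2 * ⟪sgrad φ (y - x0), sgrad (v s) y⟫ + v s y * lap φ (y - x0)) (r := ρ s) (x0 := x0) (X := N * (β + Ca))
        (Y := N) (R := R) hC (by positivity) hN0 hτ hδ (fun y => hk.bd τ hτ hτ1 _) sl.r2.continuous sl.rp
        (hr s hs') (fun y hy => by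
          obtain ⟨z1, z2, z3⟩ := hφ.supp _ hy
          simp [z1, z2, z3])
        (fun y hy => by
          obtain ⟨z1, z2, z3⟩ := hφ.bd (y - x0)
          obtain ⟨l1, l2⟩ := S.hloc s hs' y (near_norm hx0 hy)
          have q1 : |tderiv T v s y + lap (v s) y| ≤ L * β + L * |ρ s y| + Ca := by
            have e : tderiv T v s y + lap (v s) y = ⟪P s y, sgrad (v s) y⟫ - h s y * ρ s y - a s y := by
              rw [sl.eq1]; ring
            rw [e]
            have r1 : |⟪P s y, sgrad (v s) y⟫| ≤ L * β := (abs_real_inner_le_norm _ _).trans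
              (mul_le_mul l2 (hg s hs' y) (norm_nonneg _) (by linarith))
            have r2 : |h s y * ρ s y| ≤ L * |ρ s y| := by
              rw [abs_mul]; exact mul_le_mul_of_nonneg_right l1 (abs_nonneg _)
            have r3 := sl.ha y
            have r4 := abs_sub (⟪P s y, sgrad (v s) y⟫ - h s y * ρ s y) (a s y)
            have r5 := abs_sub ⟪P s y, sgrad (v s) y⟫ (h s y * ρ s y)
            linarith
          have q2 : |⟪sgrad φ (y - x0), sgrad (v s) y⟫| ≤ A * β := (abs_real_inner_le_norm _ _).trans
              (mul_le_mul z2 (hg s hs' y) (norm_nonneg _) hA)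
          have q3 : |v s y * lap φ (y - x0)| ≤ β * A := by
            rw [abs_mul]; exact mul_le_mul (hv s hs' y) z3 (abs_nonneg _) hβ0
          have q4 : |φ (y - x0) * (tderiv T v s y + lap (v s) y)| ≤ L * β + L * |ρ s y| + Ca := by
            rw [abs_mul]
            exact (mul_le_of_le_one_left (abs_nonneg _) z1).trans q1
          have q5 := abs_add_le (φ (y - x0) * (tderiv T v s y + lap (v s) y) +
            2 * ⟪sgrad φ (y - x0), sgrad (v s) y⟫) (v s y * lap φ (y - x0))
          have q6 := abs_add_le (φ (y - x0) * (tderiv T v s y + lap (v s) y))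
            (2 * ⟪sgrad φ (y - x0), sgrad (v s) y⟫)
          have q7 : |2 * ⟪sgrad φ (y - x0), sgrad (v s) y⟫| ≤ 2 * (A * β) := by
            rw [abs_mul, abs_two]; linarith
          have q8 : 0 ≤ (3 * A + 1) * |ρ s y| := by positivity
          have q9 : 0 ≤ β + (L + 3 * A) * Ca := by positivity
          rw [hN]
          linarith)
    rw [Real.norm_eq_abs]
    refine h1.trans ?_
    have g1 : τ ^ (-(1:ℝ) / 2) * β ≤ 3 * K ^ (-(1:ℝ) / 4) * B * w0 * τ ^ (-(3:ℝ) / 4) := by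
      have e1 : Real.exp (K * (T - s)) = w0 * Real.exp (K * ε) * Real.exp (-(K * τ)) := by
        rw [hw0, ← Real.exp_add, ← Real.exp_add, hτd]; congr 1; ring
      have e2 : Real.exp (K * ε) ≤ 3 := (Real.exp_le_exp.2 hε1).trans (Real.exp_one_lt_d9.le.trans (by norm_num))
      have e3 := exp_gain (K := K) (by linarith) hτ
      rw [hβ, e1]
      calc τ ^ (-(1:ℝ) / 2) * (B * (w0 * Real.exp (K * ε) * Real.exp (-(K * τ))))
          = B * w0 * Real.exp (K * ε) * (τ ^ (-(1:ℝ) / 2) * Real.exp (-(K * τ))) := by ring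
        _ ≤ B * w0 * 3 * (K ^ (-(1:ℝ) / 4) * τ ^ (-(3:ℝ) / 4)) := by gcongr
        _ = _ := by ring
    have g2 : τ ^ (-(1:ℝ) / 2) * Ca ≤ S1 * Ca * τ ^ (-(3:ℝ) / 4) := by
      have := mul_le_mul_of_nonneg_right (half_le hτ hτ1) hCa
      linarith
    have g3 : C * G * N * (τ ^ (-(1:ℝ) / 2) * β + τ ^ (-(1:ℝ) / 2) * Ca) ≤
      C * G * N * (3 * K ^ (-(1:ℝ) / 4) * B * w0 * τ ^ (-(3:ℝ) / 4) + S1 * Ca * τ ^ (-(3:ℝ) / 4)) :=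
      mul_le_mul_of_nonneg_left (add_le_add g1 g2) (by positivity)
    rw [hZ]
    simp only [hy]
    linarith
  have hitg := intervalIntegral.norm_integral_le_of_norm_le ht0.2
    (Filter.Eventually.of_forall fun s hs => hbd s ⟨hs.1.le, hs.2⟩)
    ((it.const_mul Z).add ((yi t0 ht0 T mT).const_mul (C * N * δ ^ (-(1 + d:ℝ) / 2))))
  rw [intervalIntegral.integral_add (it.const_mul Z) ((yi t0 ht0 T mT).const_mul _),
    intervalIntegral.integral_const_mul, intervalIntegral.integral_const_mul, eJ, Real.norm_eq_abs, abs_neg] at hitg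
  refine hitg.trans ?_
  have i1 : ∫ s in t0..T, y s ≤ Iabs T ρ := by
    have := intervalIntegral.integral_add_adjacent_intervals (yi 0 m0 t0 ht0) (yi t0 ht0 T mT)
    have p : 0 ≤ ∫ s in (0:ℝ)..t0, y s := intervalIntegral.integral_nonneg ht0.1 fun s _ => y0 s
    change _ ≤ ∫ s in (0:ℝ)..T, y s
    linarith
  exact add_le_add (mul_le_mul_of_nonneg_left et hZ0) (mul_le_mul_of_nonneg_left i1 (by positivity))

set_option maxHeartbeats 1000000 in
lemma r_step (hd : 1 ≤ d) {T L : ℝ} {P0 : Ed d → Ed d} {P Q : ℝ → Ed d → Ed d}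
    {Bm : ℝ → Ed d → Ed d →L[ℝ] Ed d}
    {h : ℝ → Ed d → ℝ} {a : ℝ → Ed d → ℝ} {b : ℝ → Ed d → Ed d} {v ρ : ℝ → Ed d → ℝ}
    {Ca Cb : ℝ} (S : Sys T L P0 P Q Bm h a b v ρ Ca Cb)
    {C : ℝ} (hC : 1 ≤ C) (hk : Ker (Gk (d := d)) C (T + 1)) {φ : Ed d → ℝ} {A : ℝ} (hA : 0 ≤ A)
    (hφ : Cut φ A) {K B V ε t0 : ℝ} (hK : 1 ≤ K) (hB : 0 ≤ B) (hε : 0 < ε) (hε1 : K * ε ≤ 1)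
    (hr : ∀ t ∈ Icc (0:ℝ) T, ∀ x, |ρ t x| ≤ B * Real.exp (K * t))
    (hg : ∀ t ∈ Icc (0:ℝ) T, ∀ x, ‖sgrad (v t) x‖ ≤ V)
    (ht0 : t0 ∈ Icc 0 T) {x0 : Ed d} (hx0 : x0 ∈ cube d) :
    |∫ y, Gk ε (y - x0) * (φ (y - x0) * ρ t0 y)| ≤
      C * (8 * Real.pi) ^ ((d:ℝ) / 2) * (3 * A + (A + 1) * (2 * L)) *
        (3 * K ^ (-(1:ℝ) / 4) * B * Real.exp (K * t0) +
        (T + 1) ^ ((1:ℝ) / 4) * (V + Cb)) * (4 * (T + 1) ^ ((1:ℝ) / 4)) := by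
  have hT := S.hT
  have hsub : Icc 0 t0 ⊆ Icc 0 T := Icc_subset_Icc_right ht0.2
  obtain ⟨Bv, hBv, hvb⟩ := S.vN.bdd
  have hV0 : 0 ≤ V := (norm_nonneg _).trans (hg t0 ht0 0)
  have slc : ∀ t ∈ Icc (0:ℝ) T, Slice L P0 (P t) (Q t) (Bm t) (h t) (a t) (b t) (v t) (ρ t)
      (tderiv T v t) (tderiv T ρ t) Ca Cb (Bv + B * Real.exp (K * t)) := fun t ht => by
    have p1 : 0 ≤ B * Real.exp (K * t) := by positivity
    exact S.slice t ht _ (fun x => ((hvb t ht x).1).trans (by linarith))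
      (fun x => (hvb t ht x).2.1.trans (by linarith)) (fun x => (hr t ht x).trans (by linarith))
  obtain ⟨iJ, eJ⟩ := duh_r hd hk hφ hε ht0 S.rN x0 (fun s => flux (P s) (Q s) (Bm s) (b s) (v s) (ρ s))
    (fun s hs => (slc s hs).fd) (fun s hs x => (slc s hs).eq2 x)
  have hCb : 0 ≤ Cb := (norm_nonneg _).trans ((slc t0 ht0).hb 0)
  have hL1 : 1 ≤ L := (slc t0 ht0).L1
  set N := 3 * A + (A + 1) * (2 * L) with hN
  have hN0 : 0 ≤ N := by positivity
  set G := (8 * Real.pi) ^ ((d:ℝ) / 2) with hG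
  have hG0 : 0 ≤ G := by positivity
  set S1 := (T + 1) ^ ((1:ℝ) / 4) with hS1
  set w0 := Real.exp (K * t0) with hw0
  have hε2 : ε ≤ 1 := by nlinarith
  obtain ⟨it, et⟩ := time_r (t0 := t0) (T1 := T + 1) ht0.1 hε (by linarith [ht0.2])
  set Z := C * G * N * (3 * K ^ (-(1:ℝ) / 4) * B * w0 + S1 * (V + Cb)) with hZ
  have hZ0 : 0 ≤ Z := by positivity
  have hfinal : (∫ y, Gk (t0 + ε) (y - x0) * (φ (y - x0) * ρ 0 y)) = 0 := by
    simp [S.ini]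
  rw [hfinal, sub_zero] at eJ
  rw [← eJ]
  have hbd : ∀ s ∈ Icc 0 t0, ‖∫ y, (2 * ρ s y * ⟪sgrad (Gk (t0 + ε - s)) (y - x0), sgrad φ (y - x0)⟫ +
        Gk (t0 + ε - s) (y - x0) * (ρ s y * lap φ (y - x0)) -
        (Gk (t0 + ε - s) (y - x0) * ⟪sgrad φ (y - x0), flux (P s) (Q s) (Bm s) (b s) (v s) (ρ s) y⟫ +
          φ (y - x0) * ⟪sgrad (Gk (t0 + ε - s)) (y - x0), flux (P s) (Q s) (Bm s) (b s) (v s) (ρ s) y⟫))‖ ≤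
      Z * (t0 + ε - s) ^ (-(3:ℝ) / 4) := by
    intro s hs
    have hs' := hsub hs
    have hτ : 0 < t0 + ε - s := by linarith [hs.2]
    have hτ1 : t0 + ε - s ≤ T + 1 := by linarith [hs.1, ht0.2]
    set τ := t0 + ε - s with hτd
    set β := B * Real.exp (K * s) with hβ
    have hβ0 : 0 ≤ β := by positivity
    have sl := slc s hs'
    obtain ⟨i1, e1⟩ := Dk_int_trans hτ x0
    set F := flux (P s) (Q s) (Bm s) (b s) (v s) (ρ s) with hF
    have h1 := norm_integral_le_of_norm_le (i1.const_mul (C * N * (β + (V + Cb))))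
      (f := fun y => (2 * ρ s y * ⟪sgrad (Gk τ) (y - x0), sgrad φ (y - x0)⟫ +
        Gk τ (y - x0) * (ρ s y * lap φ (y - x0)) -
        (Gk τ (y - x0) * ⟪sgrad φ (y - x0), F y⟫ +
          φ (y - x0) * ⟪sgrad (Gk τ) (y - x0), F y⟫)))
      (Filter.Eventually.of_forall fun y => by
        have hD := Dk_nonneg hτ (y - x0)
        set D := Dk τ (y - x0) with hDd
        rw [Real.norm_eq_abs]
        by_cases hy : 1 / 2 ≤ ‖y - x0‖
        · obtain ⟨z1, z2, z3⟩ := hφ.supp _ hy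
          simp only [z1, z2, z3, inner_zero_right, inner_zero_left, mul_zero, zero_mul, add_zero, sub_zero, abs_zero]
          positivity
        · obtain ⟨z1, z2, z3⟩ := hφ.bd (y - x0)
          obtain ⟨l1, l2⟩ := S.hloc s hs' y (near_norm hx0 (not_le.1 hy))
          have k1 := hk.bd τ hτ hτ1 (y - x0)
          have k2 := sgrad_Gk_le hτ (y - x0)
          rw [← hDd] at k1 k2
          have f1 : ‖F y‖ ≤ 2 * L * (β + (V + Cb)) := by
            have r1 : ‖ρ s y • P s y‖ ≤ β * L := by
              rw [norm_smul]; exact mul_le_mul (hr s hs' y) l2 (norm_nonneg _) hβ0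
            have r2 : ‖ρ s y • Q s y‖ ≤ β * L := by
              rw [norm_smul]; exact mul_le_mul (hr s hs' y) (sl.qb y) (norm_nonneg _) hβ0
            have r3 : ‖Bm s y (sgrad (v s) y)‖ ≤ L * V :=
              (ContinuousLinearMap.le_opNorm _ _).trans
                (mul_le_mul (sl.bb y) (hg s hs' y) (norm_nonneg _) (by linarith))
            have r4 := sl.hb y
            have r5 : ‖F y‖ ≤ ‖ρ s y • P s y‖ + ‖ρ s y • Q s y‖ + ‖Bm s y (sgrad (v s) y)‖ + ‖b s y‖ :=
              norm_add₄_le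
            have r6 : 0 ≤ L * V := by positivity
            have r7 : Cb ≤ 2 * L * Cb := le_mul_of_one_le_left hCb (by linarith)
            linarith
          set f := 2 * L * (β + (V + Cb)) with hf
          have f0 : 0 ≤ f := by positivity
          have t1 : |2 * ρ s y * ⟪sgrad (Gk τ) (y - x0), sgrad φ (y - x0)⟫| ≤ 2 * β * (D * A) := by
            rw [abs_mul, abs_mul, abs_two]
            refine mul_le_mul (mul_le_mul_of_nonneg_left (hr s hs' y) (by norm_num)) ?_ (abs_nonneg _) (by positivity)
            exact (abs_real_inner_le_norm _ _).trans (mul_le_mul k2 z2 (norm_nonneg _) hD)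
          have t2 : |Gk τ (y - x0) * (ρ s y * lap φ (y - x0))| ≤ C * D * (β * A) := by
            rw [abs_mul, abs_mul]
            exact mul_le_mul k1 (mul_le_mul (hr s hs' y) z3 (abs_nonneg _) hβ0) (by positivity) (by positivity)
          have t3 : |Gk τ (y - x0) * ⟪sgrad φ (y - x0), F y⟫| ≤ C * D * (A * f) := by
            rw [abs_mul]
            exact mul_le_mul k1 ((abs_real_inner_le_norm _ _).trans (mul_le_mul z2 f1 (norm_nonneg _) hA))
              (abs_nonneg _) (by positivity)
          have t4 : |φ (y - x0) * ⟪sgrad (Gk τ) (y - x0), F y⟫| ≤ D * f := by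
            rw [abs_mul]
            exact (mul_le_of_le_one_left (abs_nonneg _) z1).trans
              ((abs_real_inner_le_norm _ _).trans (mul_le_mul k2 f1 (norm_nonneg _) hD))
          have u1 := abs_sub (2 * ρ s y * ⟪sgrad (Gk τ) (y - x0), sgrad φ (y - x0)⟫ +
            Gk τ (y - x0) * (ρ s y * lap φ (y - x0))) (Gk τ (y - x0) * ⟪sgrad φ (y - x0), F y⟫ +
            φ (y - x0) * ⟪sgrad (Gk τ) (y - x0), F y⟫)
          have u2 := abs_add_le (2 * ρ s y * ⟪sgrad (Gk τ) (y - x0), sgrad φ (y - x0)⟫)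
            (Gk τ (y - x0) * (ρ s y * lap φ (y - x0)))
          have u3 := abs_add_le (Gk τ (y - x0) * ⟪sgrad φ (y - x0), F y⟫)
            (φ (y - x0) * ⟪sgrad (Gk τ) (y - x0), F y⟫)
          have w1 : 2 * β * (D * A) ≤ C * (2 * β * (D * A)) := le_mul_of_one_le_left (by positivity) hC
          have w2 : D * f ≤ C * (D * f) := le_mul_of_one_le_left (by positivity) hC
          have w3 : C * D * (3 * A * β) ≤ C * D * (3 * A * (β + (V + Cb))) := by
            gcongr; linarith
          have w4 : C * N * (β + (V + Cb)) * D = C * D * (3 * A * (β + (V + Cb))) + C * D * ((A + 1) * f) := by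
            rw [hN, hf]; ring
          rw [w4]
          linarith)
    refine h1.trans ?_
    rw [integral_const_mul, e1]
    have g1 : τ ^ (-(1:ℝ) / 2) * β ≤ 3 * K ^ (-(1:ℝ) / 4) * B * w0 * τ ^ (-(3:ℝ) / 4) := by
      have e1 : Real.exp (K * s) = w0 * Real.exp (K * ε) * Real.exp (-(K * τ)) := by
        rw [hw0, ← Real.exp_add, ← Real.exp_add, hτd]; congr 1; ring
      have e2 : Real.exp (K * ε) ≤ 3 := (Real.exp_le_exp.2 hε1).trans (Real.exp_one_lt_d9.le.trans (by norm_num))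
      have e3 := exp_gain (K := K) (by linarith) hτ
      rw [hβ, e1]
      calc τ ^ (-(1:ℝ) / 2) * (B * (w0 * Real.exp (K * ε) * Real.exp (-(K * τ))))
          = B * w0 * Real.exp (K * ε) * (τ ^ (-(1:ℝ) / 2) * Real.exp (-(K * τ))) := by ring
        _ ≤ B * w0 * 3 * (K ^ (-(1:ℝ) / 4) * τ ^ (-(3:ℝ) / 4)) := by gcongr
        _ = _ := by ring
    have g2 : τ ^ (-(1:ℝ) / 2) * (V + Cb) ≤ S1 * (V + Cb) * τ ^ (-(3:ℝ) / 4) := by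
      have := mul_le_mul_of_nonneg_right (half_le hτ hτ1) (by positivity : 0 ≤ V + Cb)
      linarith
    have g3 : C * G * N * (τ ^ (-(1:ℝ) / 2) * β + τ ^ (-(1:ℝ) / 2) * (V + Cb)) ≤
      C * G * N * (3 * K ^ (-(1:ℝ) / 4) * B * w0 * τ ^ (-(3:ℝ) / 4) + S1 * (V + Cb) * τ ^ (-(3:ℝ) / 4)) :=
      mul_le_mul_of_nonneg_left (add_le_add g1 g2) (by positivity)
    rw [hZ]
    linarith
  have hitg := intervalIntegral.norm_integral_le_of_norm_le ht0.1
    (Filter.Eventually.of_forall fun s hs => hbd s ⟨hs.1.le, hs.2⟩) (it.const_mul Z)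
  rw [intervalIntegral.integral_const_mul, Real.norm_eq_abs] at hitg
  exact hitg.trans (mul_le_mul_of_nonneg_left et hZ0)

lemma lim_val {φ w : Ed d → ℝ} {A K X : ℝ} (hφ : Cut φ A) (hw : Continuous w) (x0 : Ed d)
    (h : ∀ ε : ℝ, 0 < ε → K * ε ≤ 1 → |∫ y, Gk ε (y - x0) * (φ (y - x0) * w y)| ≤ X) :
    (4 * Real.pi) ^ ((d:ℝ) / 2) * |w x0| ≤ X := by
  have hφc : Continuous φ := hφ.c2.continuous
  have cs : CS (fun y => φ (y - x0) * w y) := ⟨by fun_prop, ‖x0‖ + 1, fun y hy => by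
    simp [(hφ.supp _ (sub_far hy)).1]⟩
  have l := (Gk_limit _ cs x0).abs
  simp only [sub_self, hφ.one, one_mul] at l
  rw [abs_mul, abs_of_nonneg (by positivity : 0 ≤ (4 * Real.pi) ^ ((d:ℝ) / 2))] at l
  refine le_of_tendsto l ?_
  filter_upwards [Filter.eventually_ge_atTop (|K| + 1)] with c hc
  have c1 : 1 ≤ c := by linarith [abs_nonneg K]
  refine h _ (by positivity) ?_
  rw [← div_eq_mul_inv, div_le_one (by positivity)]
  have := le_abs_self K
  nlinarith

lemma lim_grad (hd : 1 ≤ d) {φ w : Ed d → ℝ} {A K X : ℝ} (hφ : Cut φ A) (hw : ContDiff ℝ 2 w) (x0 e : Ed d)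
    (h : ∀ ε : ℝ, 0 < ε → K * ε ≤ 1 → |∫ y, Ke e ε (y - x0) * (φ (y - x0) * w y)| ≤ X) :
    (4 * Real.pi) ^ ((d:ℝ) / 2) * |⟪sgrad w x0, e⟫| ≤ X := by
  have χ2 : ContDiff ℝ 2 (fun y => φ (y - x0)) := hφ.c2.comp (by fun_prop)
  set g : Ed d → ℝ := fun y => φ (y - x0) * w y with hg
  have g2 : ContDiff ℝ 2 g := χ2.mul hw
  have g1 : ContDiff ℝ 1 g := g2.of_le (by norm_num)
  have gz : ∀ y, ‖x0‖ + 1 < ‖y‖ → g y = 0 := fun y hy => by simp [hg, (hφ.supp _ (sub_far hy)).1]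
  have gs := sgrad_zero_of_far _ _ gz
  have gc := sgrad_continuous g1
  have cs : CS (fun y => ⟪sgrad g y, e⟫) := ⟨by fun_prop, ‖x0‖ + 1, fun y hy => by simp [gs y hy]⟩
  have l := (Gk_limit _ cs x0).abs
  have eg : sgrad g x0 = sgrad w x0 := by
    rw [hg, sgrad_mul ((χ2.differentiable two_ne_zero) x0) ((hw.differentiable two_ne_zero) x0), sgrad_trans]
    simp [hφ.one, hφ.grad0]
  rw [eg, abs_mul, abs_of_nonneg (by positivity : 0 ≤ (4 * Real.pi) ^ ((d:ℝ) / 2))] at l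
  refine le_of_tendsto l ?_
  filter_upwards [Filter.eventually_ge_atTop (|K| + 1)] with c hc
  have c1 : 1 ≤ c := by linarith [abs_nonneg K]
  set ε := (c ^ 2)⁻¹ with hε
  have hb := h ε (by positivity) (by
    rw [hε, ← div_eq_mul_inv, div_le_one (by positivity)]
    have := le_abs_self K
    nlinarith)
  have κ2 : ContDiff ℝ 2 (fun y => Gk ε (y - x0)) := (Gk_contDiff ε).comp (by fun_prop)
  have κ1 : ContDiff ℝ 1 (fun y => Gk ε (y - x0)) := κ2.of_le (by norm_num)
  have d0 : diverg (fun _ : Ed d => e) = fun _ => 0 := by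
    funext x; simp [diverg]
  obtain ⟨c1, n1⟩ := null_div hd (fun y => Gk ε (y - x0) * g y) (fun _ => e) (κ1.mul g1) (by fun_prop)
    (by rw [d0]; fun_prop) ⟨‖x0‖ + 1, fun y hy => by simp [gz y hy]⟩
  have q1 : CS (fun y => Ke e ε (y - x0) * g y) :=
    ⟨by have := (Ke_contDiff e ε).continuous; have := g1.continuous; fun_prop, ‖x0‖ + 1, fun y hy => by simp [gz y hy]⟩
  have q2 : CS (fun y => Gk ε (y - x0) * ⟪sgrad g y, e⟫) :=
    ⟨by have := (Gk_contDiff (d := d) ε).continuous; fun_prop, ‖x0‖ + 1, fun y hy => by simp [gs y hy]⟩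
  have ee : (fun y => (Gk ε (y - x0) * g y) * diverg (fun _ : Ed d => e) y +
      ⟪sgrad (fun y => Gk ε (y - x0) * g y) y, e⟫) =
      fun y => Ke e ε (y - x0) * g y + Gk ε (y - x0) * ⟪sgrad g y, e⟫ := by
    funext y
    rw [d0, sgrad_mul ((κ1.differentiable one_ne_zero) y) ((g1.differentiable one_ne_zero) y), sgrad_trans, sgrad_Gk]
    simp only [inner_add_left, inner_smul_left, RCLike.conj_to_real, Ke]
    ring
  rw [ee, q1.integral_add q2] at n1
  have : (∫ y, Gk ε (y - x0) * ⟪sgrad g y, e⟫) = -∫ y, Ke e ε (y - x0) * g y := by linarith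
  rw [this, abs_neg]
  exact hb

lemma norm_of_inner {z : Ed d} {A X : ℝ} (hX : 0 ≤ X) (h : ∀ e : Ed d, ‖e‖ ≤ 1 → A * |⟪z, e⟫| ≤ X) : A * ‖z‖ ≤ X := by
  by_cases hz : z = 0
  · simpa [hz] using hX
  · have hz' : ‖z‖ ≠ 0 := norm_ne_zero_iff.2 hz
    have := h (‖z‖⁻¹ • z) (by rw [norm_smul, norm_inv, norm_norm, inv_mul_cancel₀ hz'])
    rw [inner_smul_right, real_inner_self_eq_norm_sq, abs_of_nonneg (by positivity)] at this
    have e : ‖z‖⁻¹ * ‖z‖ ^ 2 = ‖z‖ := by field_simp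
    rwa [e] at this

lemma choose_K (q : ℝ) (hq : 0 ≤ q) : ∃ K : ℝ, 1 ≤ K ∧ q * K ^ (-(1:ℝ) / 4) ≤ 1 / 2 := by
  refine ⟨(2 * q + 1) ^ (4:ℕ), one_le_pow₀ (by linarith), ?_⟩
  rw [← Real.rpow_natCast, ← Real.rpow_mul (by linarith)]
  have : ((4:ℕ):ℝ) * (-(1:ℝ) / 4) = -1 := by norm_num
  rw [this, Real.rpow_neg_one, ← div_eq_mul_inv, div_le_iff₀ (by linarith)]
  linarith

lemma ZPeriodic.sgrad_span {f : Ed d → ℝ} (hf : ZPeriodic f) (g : Ed d) (hg : g ∈ Submodule.span ℤ (range (sb d)))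
    (x : Ed d) : sgrad f (g + x) = sgrad f x := by
  have : (fun y => f (y - (-g))) = f := by
    funext y
    rw [sub_neg_eq_add, add_comm]; exact hf.span g hg y
  conv_rhs => rw [← this]
  rw [sgrad_trans]
  congr 1
  abel

set_option maxHeartbeats 1000000 in
lemma v_est (hd : 1 ≤ d) (T L : ℝ) (hT : 0 < T) (hL : 1 ≤ L) :
    ∃ C : ℝ, 0 ≤ C ∧ ∀ δ : ℝ, 0 < δ → ∃ Cd : ℝ, 0 ≤ Cd ∧ ∀ {P0 : Ed d → Ed d} {P Q : ℝ → Ed d → Ed d}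
      {Bm : ℝ → Ed d → Ed d →L[ℝ] Ed d}
      {h : ℝ → Ed d → ℝ} {a : ℝ → Ed d → ℝ} {b : ℝ → Ed d → Ed d} {v ρ : ℝ → Ed d → ℝ}
      {Ca Cb R : ℝ}, Sys T L P0 P Q Bm h a b v ρ Ca Cb → 0 ≤ Ca →
      (∀ t ∈ Icc (0:ℝ) T, ∀ x, |ρ t x| ≤ R) → ∀ t ∈ Icc (0:ℝ) T, ∀ x,
        |v t x| ≤ C * (Ca + δ ^ ((1:ℝ) / 4) * R) + Cd * Iabs T ρ ∧
        ‖sgrad (v t) x‖ ≤ C * (Ca + δ ^ ((1:ℝ) / 4) * R) + Cd * Iabs T ρ := by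
  obtain ⟨φ, A, hA, hφ⟩ := exists_cut (d := d)
  set C := (T + 1) ^ ((1:ℝ) / 2) + 1 with hC
  have hC0 : 0 ≤ C := by positivity
  set G := (8 * Real.pi) ^ ((d:ℝ) / 2) with hG
  have hG0 : 0 ≤ G := by positivity
  set A4 := (4 * Real.pi) ^ ((d:ℝ) / 2) with hA4
  have hA40 : 0 < A4 := by positivity
  set N := L + 3 * A + 1 with hN
  have hN0 : 0 ≤ N := by positivity
  set S1 := (T + 1) ^ ((1:ℝ) / 4) with hS1
  have hS10 : 0 ≤ S1 := by positivity
  obtain ⟨K, hK, hKq⟩ := choose_K (C * G * N * 3 * (4 * S1) / A4) (by positivity)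
  have hk1 := Ker_Gk (d := d) (T + 1) (by linarith)
  have hk2 := fun e he => Ker_Ke (d := d) (T + 1) (by linarith) e he
  rw [← hC] at hk1 hk2
  refine ⟨2 * (C * G * N * (4 * S1) * (S1 + 1) / A4) * Real.exp (K * T), by positivity, fun δ hδ => ?_⟩
  set δ' := δ ^ (-(1 + d:ℝ) / 2) with hδ'
  have hδ0 : 0 ≤ δ' := by positivity
  set δ4 := δ ^ ((1:ℝ) / 4) with hδ4
  have hδ40 : 0 ≤ δ4 := by positivity
  refine ⟨2 * (C * N * δ' / A4) * Real.exp (K * T), by positivity, ?_⟩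
  intro P0 P Q Bm h a b v ρ Ca Cb R S hCa hr
  have m0 : (0:ℝ) ∈ Icc 0 T := ⟨le_rfl, hT.le⟩
  have hR0 : 0 ≤ R := (abs_nonneg _).trans (hr 0 m0 0)
  have hI : 0 ≤ Iabs T ρ := intervalIntegral.integral_nonneg hT.le fun s _ => integral_nonneg fun _ => abs_nonneg _
  set D := (C * G * N * (S1 * Ca + δ4 * R) * (4 * S1) + C * N * δ' * Iabs T ρ) / A4 with hD
  have hD0 : 0 ≤ D := by positivity
  obtain ⟨B, hB, hit⟩ := imp_iter (fun B => ∀ t ∈ Icc (0:ℝ) T, ∀ x,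
      |v t x| ≤ B * Real.exp (K * (T - t)) ∧ ‖sgrad (v t) x‖ ≤ B * Real.exp (K * (T - t))) D hD0
    (fun B B' hBB hB t ht x => by
      have : B * Real.exp (K * (T - t)) ≤ B' * Real.exp (K * (T - t)) := by gcongr
      exact ⟨(hB t ht x).1.trans this, (hB t ht x).2.trans this⟩)
    (by
      obtain ⟨B, hB, hb⟩ := S.vN.bdd
      refine ⟨B, hB, fun t ht x => ?_⟩
      have : B ≤ B * Real.exp (K * (T - t)) := le_mul_of_one_le_right hB
        (Real.one_le_exp (mul_nonneg (by linarith) (by linarith [ht.2])))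
      exact ⟨(hb t ht x).1.trans this, (hb t ht x).2.1.trans this⟩)
    (by
      intro B hB hb t0 ht0 x
      set w0 := Real.exp (K * (T - t0)) with hw0
      have hw1 : 1 ≤ w0 := Real.one_le_exp (mul_nonneg (by linarith) (by linarith [ht0.2]))
      obtain ⟨g, hgs, hx0⟩ := exists_cube x
      have e1 : v t0 x = v t0 (g + x) := ((S.vN.per t0 ht0).span g hgs x).symm
      have e2 : sgrad (v t0) x = sgrad (v t0) (g + x) := ((S.vN.per t0 ht0).sgrad_span g hgs x).symm
      rw [e1, e2]
      set x0 := g + x with hx0d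
      set X := C * G * N * (3 * K ^ (-(1:ℝ) / 4) * B * w0 + S1 * Ca + δ4 * R) * (4 * S1) +
        C * N * δ' * Iabs T ρ with hX
      have hX0 : 0 ≤ X := by positivity
      have st : ∀ {k : ℝ → Ed d → ℝ}, Ker k C (T + 1) → ∀ ε : ℝ, 0 < ε → K * ε ≤ 1 →
          |∫ y, k ε (y - x0) * (φ (y - x0) * v t0 y)| ≤ X := fun hk ε hε hε1 =>
        v_step hd S hC0 hk hA hφ hK hB hδ hε hε1 (fun t ht x => (hb t ht x).1) (fun t ht x => (hb t ht x).2) hr ht0 hx0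
      have c2 := S.vN.c2 t0 ht0
      have f1 := lim_val hφ c2.continuous x0 (st hk1)
      have f2 : A4 * ‖sgrad (v t0) x0‖ ≤ X := norm_of_inner hX0 fun e he => lim_grad hd hφ c2 x0 e (st (hk2 e he))
      have hXA : X / A4 ≤ (B / 2 + D) * w0 := by
        have z1 : X / A4 = C * G * N * 3 * (4 * S1) / A4 * K ^ (-(1:ℝ) / 4) * (B * w0) + D := by
          rw [hX, hD]; field_simp; ring
        have z2 : C * G * N * 3 * (4 * S1) / A4 * K ^ (-(1:ℝ) / 4) * (B * w0) ≤ 1 / 2 * (B * w0) :=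
          mul_le_mul_of_nonneg_right hKq (by positivity)
        have z3 : D ≤ D * w0 := le_mul_of_one_le_right hD0 hw1
        rw [z1]; linarith
      constructor
      · refine le_trans ?_ hXA
        rw [le_div_iff₀ hA40]; linarith
      · refine le_trans ?_ hXA
        rw [le_div_iff₀ hA40]; linarith)
  intro t ht x
  have hw : Real.exp (K * (T - t)) ≤ Real.exp (K * T) := by
    apply Real.exp_le_exp.2
    exact mul_le_mul_of_nonneg_left (by linarith [ht.1]) (by linarith)
  have key : 2 * D * Real.exp (K * (T - t)) ≤
      2 * (C * G * N * (4 * S1) * (S1 + 1) / A4) * Real.exp (K * T) * (Ca + δ4 * R) +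
        2 * (C * N * δ' / A4) * Real.exp (K * T) * Iabs T ρ := by
    have z1 : D ≤ C * G * N * (4 * S1) * (S1 + 1) / A4 * (Ca + δ4 * R) + C * N * δ' / A4 * Iabs T ρ := by
      have z2 : S1 * Ca + δ4 * R ≤ (S1 + 1) * (Ca + δ4 * R) := by
        have : 0 ≤ δ4 * R := by positivity
        nlinarith
      have z3 : C * G * N * (4 * S1) / A4 * (S1 * Ca + δ4 * R) ≤
        C * G * N * (4 * S1) / A4 * ((S1 + 1) * (Ca + δ4 * R)) := mul_le_mul_of_nonneg_left z2 (by positivity)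
      calc D = C * G * N * (4 * S1) / A4 * (S1 * Ca + δ4 * R) + C * N * δ' / A4 * Iabs T ρ := by
            rw [hD]; field_simp
        _ ≤ C * G * N * (4 * S1) / A4 * ((S1 + 1) * (Ca + δ4 * R)) + C * N * δ' / A4 * Iabs T ρ := by linarith
        _ = _ := by ring
    calc 2 * D * Real.exp (K * (T - t)) ≤ 2 * (C * G * N * (4 * S1) * (S1 + 1) / A4 * (Ca + δ4 * R) +
          C * N * δ' / A4 * Iabs T ρ) * Real.exp (K * T) := by gcongr
      _ = _ := by ring
  exact ⟨(imp_lim fun n => (hit n t ht x).1).trans key, (imp_lim fun n => (hit n t ht x).2).trans key⟩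

set_option maxHeartbeats 1000000 in
lemma r_est (hd : 1 ≤ d) (T L : ℝ) (hT : 0 < T) (hL : 1 ≤ L) :
    ∃ C : ℝ, 0 ≤ C ∧ ∀ {P0 : Ed d → Ed d} {P Q : ℝ → Ed d → Ed d}
      {Bm : ℝ → Ed d → Ed d →L[ℝ] Ed d}
      {h : ℝ → Ed d → ℝ} {a : ℝ → Ed d → ℝ} {b : ℝ → Ed d → Ed d} {v ρ : ℝ → Ed d → ℝ}
      {Ca Cb V : ℝ}, Sys T L P0 P Q Bm h a b v ρ Ca Cb → 0 ≤ Cb →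
      (∀ t ∈ Icc (0:ℝ) T, ∀ x, ‖sgrad (v t) x‖ ≤ V) → ∀ t ∈ Icc (0:ℝ) T, ∀ x,
        |ρ t x| ≤ C * (V + Cb) := by
  obtain ⟨φ, A, hA, hφ⟩ := exists_cut (d := d)
  set C := (T + 1) ^ ((1:ℝ) / 2) + 1 with hC
  have hC1 : 1 ≤ C := by
    have : 0 ≤ (T + 1) ^ ((1:ℝ) / 2) := by positivity
    linarith
  have hC0 : 0 ≤ C := by positivity
  set G := (8 * Real.pi) ^ ((d:ℝ) / 2) with hG
  have hG0 : 0 ≤ G := by positivity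
  set A4 := (4 * Real.pi) ^ ((d:ℝ) / 2) with hA4
  have hA40 : 0 < A4 := by positivity
  set N := 3 * A + (A + 1) * (2 * L) with hN
  have hN0 : 0 ≤ N := by positivity
  set S1 := (T + 1) ^ ((1:ℝ) / 4) with hS1
  have hS10 : 0 ≤ S1 := by positivity
  obtain ⟨K, hK, hKq⟩ := choose_K (C * G * N * 3 * (4 * S1) / A4) (by positivity)
  have hk1 := Ker_Gk (d := d) (T + 1) (by linarith)
  rw [← hC] at hk1
  refine ⟨2 * (C * G * N * (4 * S1) * S1 / A4) * Real.exp (K * T), by positivity, ?_⟩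
  intro P0 P Q Bm h a b v ρ Ca Cb V S hCb hg
  have m0 : (0:ℝ) ∈ Icc 0 T := ⟨le_rfl, hT.le⟩
  have hV0 : 0 ≤ V := (norm_nonneg _).trans (hg 0 m0 0)
  set D := C * G * N * (S1 * (V + Cb)) * (4 * S1) / A4 with hD
  have hD0 : 0 ≤ D := by positivity
  obtain ⟨B, hB, hit⟩ := imp_iter (fun B => ∀ t ∈ Icc (0:ℝ) T, ∀ x,
      |ρ t x| ≤ B * Real.exp (K * t)) D hD0
    (fun B B' hBB hB t ht x => (hB t ht x).trans (by gcongr))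
    (by
      obtain ⟨B, hB, hb⟩ := S.rN.bdd
      refine ⟨B, hB, fun t ht x => ?_⟩
      have : B ≤ B * Real.exp (K * t) := le_mul_of_one_le_right hB
        (Real.one_le_exp (mul_nonneg (by linarith) ht.1))
      exact (hb t ht x).1.trans this)
    (by
      intro B hB hb t0 ht0 x
      set w0 := Real.exp (K * t0) with hw0
      have hw1 : 1 ≤ w0 := Real.one_le_exp (mul_nonneg (by linarith) ht0.1)
      obtain ⟨g, hgs, hx0⟩ := exists_cube x
      have e1 : ρ t0 x = ρ t0 (g + x) := ((S.rN.per t0 ht0).span g hgs x).symm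
      rw [e1]
      set x0 := g + x with hx0d
      set X := C * G * N * (3 * K ^ (-(1:ℝ) / 4) * B * w0 + S1 * (V + Cb)) * (4 * S1) with hX
      have f1 := lim_val hφ (S.rN.c2 t0 ht0).continuous x0 (fun ε hε hε1 =>
        r_step hd S hC1 hk1 hA hφ hK hB hε hε1 hb hg ht0 hx0)
      have hXA : X / A4 ≤ (B / 2 + D) * w0 := by
        have z1 : X / A4 = C * G * N * 3 * (4 * S1) / A4 * K ^ (-(1:ℝ) / 4) * (B * w0) + D := by
          rw [hX, hD]; field_simp
        have z2 : C * G * N * 3 * (4 * S1) / A4 * K ^ (-(1:ℝ) / 4) * (B * w0) ≤ 1 / 2 * (B * w0) :=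
          mul_le_mul_of_nonneg_right hKq (by positivity)
        have z3 : D ≤ D * w0 := le_mul_of_one_le_right hD0 hw1
        rw [z1]; linarith
      refine le_trans ?_ hXA
      rw [le_div_iff₀ hA40]; linarith)
  intro t ht x
  have hw : Real.exp (K * t) ≤ Real.exp (K * T) := by
    apply Real.exp_le_exp.2
    exact mul_le_mul_of_nonneg_left ht.2 (by linarith)
  refine (imp_lim fun n => hit n t ht x).trans ?_
  calc 2 * D * Real.exp (K * t) ≤ 2 * D * Real.exp (K * T) := by gcongr
    _ = _ := by rw [hD]; ring

/-- from L² to L¹ -/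
lemma Iabs_le {T : ℝ} (hT : 0 < T) {ρ : ℝ → Ed d → ℝ} (hN : Nice T ρ) {σ : ℝ} (hσ : 0 < σ) :
    Iabs T ρ ≤ T * σ + σ⁻¹ * ∫ t in (0:ℝ)..T, ∫ x in cube d, ρ t x * ρ t x := by
  obtain ⟨B, hB, hb⟩ := hN.bdd
  have c1 : ContinuousOn (fun t => ∫ x in cube d, |ρ t x|) (Icc 0 T) :=
    cube_int_cont (w := fun t x => |ρ t x|) (B := B) hN.cont.abs
      (fun t ht x => by rw [abs_abs]; exact (hb t ht x).1)
  have hbb : ∀ t ∈ Icc (0:ℝ) T, ∀ x, |ρ t x * ρ t x| ≤ B * B := fun t ht x => by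
    rw [abs_mul]; exact mul_le_mul (hb t ht x).1 (hb t ht x).1 (abs_nonneg _) hB
  have c2 : ContinuousOn (fun t => ∫ x in cube d, ρ t x * ρ t x) (Icc 0 T) :=
    cube_int_cont (w := fun t x => ρ t x * ρ t x) (B := B * B) (hN.cont.mul hN.cont) hbb
  have i1 : IntervalIntegrable (fun t => ∫ x in cube d, |ρ t x|) volume 0 T :=
    ContinuousOn.intervalIntegrable (by rwa [uIcc_of_le hT.le])
  have i2 : IntervalIntegrable (fun t => ∫ x in cube d, ρ t x * ρ t x) volume 0 T :=
    ContinuousOn.intervalIntegrable (by rwa [uIcc_of_le hT.le])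
  have h1 : Iabs T ρ ≤ ∫ t in (0:ℝ)..T, (σ + σ⁻¹ * ∫ x in cube d, ρ t x * ρ t x) := by
    refine intervalIntegral.integral_mono_on hT.le i1 (intervalIntegrable_const.add (i2.const_mul _)) fun t ht => ?_
    have rc := (hN.c2 t ht).continuous
    have j1 : IntegrableOn (fun x => |ρ t x|) (cube d) :=
      bdd_integrable_cube rc.abs B (fun x => by rw [abs_abs]; exact (hb t ht x).1)
    have j2 : IntegrableOn (fun x => ρ t x * ρ t x) (cube d) := bdd_integrable_cube (rc.mul rc) (B * B) (hbb t ht)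
    have e : ∫ x in cube d, (σ + σ⁻¹ * (ρ t x * ρ t x)) = σ + σ⁻¹ * ∫ x in cube d, ρ t x * ρ t x := by
      rw [integral_add (integrable_const _) (j2.const_mul _), integral_const_mul]
      simp [Measure.real, cube_volume]
    rw [← e]
    refine integral_mono j1 ((integrable_const _).add (j2.const_mul _)) fun x => ?_
    change |ρ t x| ≤ σ + σ⁻¹ * (ρ t x * ρ t x)
    have h3 : ρ t x * ρ t x = |ρ t x| * |ρ t x| := (abs_mul_abs_self _).symm
    rw [h3]
    have h4 : 0 ≤ σ⁻¹ * ((|ρ t x| - σ) ^ 2) := by positivity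
    have h5 : σ⁻¹ * ((|ρ t x| - σ) ^ 2) = σ⁻¹ * (|ρ t x| * |ρ t x|) - 2 * |ρ t x| + σ := by field_simp; ring
    have := abs_nonneg (ρ t x)
    linarith
  refine h1.trans (le_of_eq ?_)
  rw [intervalIntegral.integral_add intervalIntegrable_const (i2.const_mul _), intervalIntegral.integral_const_mul]
  simp

/-- the abstract stability theorem -/
lemma Sys.stab (hd : 1 ≤ d) (T L : ℝ) (hT : 0 < T) (hL : 1 ≤ L) (P0 : Ed d → Ed d)
    (hP : ∀ x y, ‖P0 x - P0 y‖ ≤ L * ‖x - y‖) :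
    ∃ C : ℝ, 0 < C ∧ ∀ {P Q : ℝ → Ed d → Ed d} {Bm : ℝ → Ed d → Ed d →L[ℝ] Ed d}
    {h : ℝ → Ed d → ℝ} {a : ℝ → Ed d → ℝ} {b : ℝ → Ed d → Ed d} {v ρ : ℝ → Ed d → ℝ}
    {Ca Cb : ℝ}, Sys T L P0 P Q Bm h a b v ρ Ca Cb → 0 ≤ Ca → 0 ≤ Cb → ∀ t ∈ Icc (0:ℝ) T, ∀ x,
      |v t x| + ‖sgrad (v t) x‖ + |ρ t x| ≤ C * (Ca + Cb) := by
  obtain ⟨Ce, hCe, hen⟩ := Sys.energy hd T L P0 (by linarith) hP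
  obtain ⟨Cv, hCv, hvest⟩ := v_est hd T L hT hL
  obtain ⟨Cr, hCr, hrest⟩ := r_est hd T L hT hL
  set q := 4 * (Cr + 1) * Cv + 1 with hq
  have hq0 : 0 < q := by positivity
  set δ := (q⁻¹) ^ 4 with hδ
  have hδ0 : 0 < δ := by positivity
  have hδ4 : δ ^ ((1:ℝ) / 4) = q⁻¹ := by
    rw [hδ, ← Real.rpow_natCast, ← Real.rpow_mul (by positivity)]; norm_num
  obtain ⟨Cd, hCd, hv2⟩ := hvest δ hδ0
  set q2 := 4 * (Cr + 1) * Cd * T + 1 with hq2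
  have hq20 : 0 < q2 := by positivity
  set η := q2⁻¹ with hη
  have hη0 : 0 < η := by positivity
  set Ct := (Cr + 1) * (Cv + Cd * (T + Ce * (q2 + 1)) + 1) with hCt
  have hCt0 : 0 ≤ Ct := by positivity
  refine ⟨6 * Ct + 1, by positivity, ?_⟩
  intro P Q Bm h a b v ρ Ca Cb S hCa hCb
  set E := Ca + Cb with hE
  have hE0 : 0 ≤ E := by positivity
  obtain ⟨B, hB, hit⟩ := imp_iter (fun M => ∀ t ∈ Icc (0:ℝ) T, ∀ x,
      |v t x| ≤ M ∧ ‖sgrad (v t) x‖ ≤ M ∧ |ρ t x| ≤ M) (Ct * E) (by positivity)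
    (fun B B' hBB hB t ht x => ⟨(hB t ht x).1.trans hBB, (hB t ht x).2.1.trans hBB, (hB t ht x).2.2.trans hBB⟩)
    (by
      obtain ⟨B1, hB1, h1⟩ := S.vN.bdd
      obtain ⟨B2, hB2, h2⟩ := S.rN.bdd
      exact ⟨B1 + B2, by positivity, fun t ht x => ⟨(h1 t ht x).1.trans (by linarith),
        (h1 t ht x).2.1.trans (by linarith), (h2 t ht x).1.trans (by linarith)⟩⟩)
    (by
      intro M hM hb
      have hI : Iabs T ρ ≤ T * (η * M + E) + Ce * (q2 + 1) * E := by
        have en := hen S (fun t ht x => (hb t ht x).1) (fun t ht x => (hb t ht x).2.1) (fun t ht x => (hb t ht x).2.2)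
        have hk : ∀ κ : ℝ, 0 < κ → Iabs T ρ ≤ T * (η * M + E) + Ce * (q2 + 1) * E + T * κ := by
          intro κ hκ
          set σ := η * M + E + κ with hσ
          have hσ0 : 0 < σ := by positivity
          have i := Iabs_le hT S.rN hσ0
          have j : σ⁻¹ * (Ce * (M * E + Cb * Cb)) ≤ Ce * (q2 + 1) * E := by
            rw [inv_mul_le_iff₀ hσ0]
            have j1 : M ≤ q2 * σ := by
              have : q2 * (η * M) = M := by rw [hη]; field_simp
              have p : 0 ≤ q2 * (E + κ) := by positivity
              nlinarith
            have j2 : Cb ≤ σ := by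
              have : 0 ≤ η * M := by positivity
              linarith
            have j3 : M * E ≤ q2 * σ * E := mul_le_mul_of_nonneg_right j1 hE0
            have j4 : Cb * Cb ≤ σ * E := mul_le_mul j2 (by linarith) hCb hσ0.le
            have j5 : Ce * (M * E + Cb * Cb) ≤ Ce * (q2 * σ * E + σ * E) :=
              mul_le_mul_of_nonneg_left (add_le_add j3 j4) hCe
            linarith
          have k := mul_le_mul_of_nonneg_left en (by positivity : 0 ≤ σ⁻¹)
          have l : T * σ = T * (η * M + E) + T * κ := by rw [hσ]; ring
          linarith
        refine le_of_forall_pos_le_add fun e he => ?_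
        have := hk (e / T) (by positivity)
        rwa [mul_div_cancel₀ _ hT.ne'] at this
      have hvv := hv2 S hCa (fun t ht x => (hb t ht x).2.2)
      rw [hδ4] at hvv
      set V := Cv * (Ca + q⁻¹ * M) + Cd * Iabs T ρ with hV
      have hV0 : 0 ≤ V := (abs_nonneg _).trans (hvv 0 ⟨le_rfl, hT.le⟩ 0).1
      have hrr := hrest S hCb (fun t ht x => (hvv t ht x).2)
      have fin : (Cr + 1) * (V + Cb) ≤ M / 2 + Ct * E := by
        have b1 : V ≤ Cv * (E + q⁻¹ * M) + Cd * (T * (η * M + E) + Ce * (q2 + 1) * E) := by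
          have : Cd * Iabs T ρ ≤ Cd * (T * (η * M + E) + Ce * (q2 + 1) * E) := mul_le_mul_of_nonneg_left hI hCd
          have : Cv * (Ca + q⁻¹ * M) ≤ Cv * (E + q⁻¹ * M) := mul_le_mul_of_nonneg_left (by linarith) hCv
          linarith
        have b2 : (Cr + 1) * (V + Cb) ≤ (Cr + 1) * (Cv * (E + q⁻¹ * M) +
            Cd * (T * (η * M + E) + Ce * (q2 + 1) * E) + E) :=
          mul_le_mul_of_nonneg_left (by linarith) (by positivity)
        have b3 : (Cr + 1) * Cv * q⁻¹ ≤ 1 / 4 := by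
          rw [← div_eq_mul_inv, div_le_iff₀ hq0]; linarith
        have b4 : (Cr + 1) * Cd * T * η ≤ 1 / 4 := by
          rw [hη, ← div_eq_mul_inv, div_le_iff₀ hq20]; linarith
        have b5 := mul_le_mul_of_nonneg_right b3 hM
        have b6 := mul_le_mul_of_nonneg_right b4 hM
        rw [hCt]
        linarith
      have w1 : V ≤ (Cr + 1) * (V + Cb) := by
        have : 0 ≤ Cr * (V + Cb) := by positivity
        linarith
      have w2 : Cr * (V + Cb) ≤ (Cr + 1) * (V + Cb) := by
        have : 0 ≤ V + Cb := by positivity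
        linarith
      intro t ht x
      exact ⟨((hvv t ht x).1.trans w1).trans fin, ((hvv t ht x).2.trans w1).trans fin,
        ((hrr t ht x).trans w2).trans fin⟩)
  intro t ht x
  have l1 : |v t x| ≤ 2 * (Ct * E) * 1 := imp_lim (B := B) fun n => by rw [mul_one]; exact (hit n t ht x).1
  have l2 : ‖sgrad (v t) x‖ ≤ 2 * (Ct * E) * 1 := imp_lim (B := B) fun n => by rw [mul_one]; exact (hit n t ht x).2.1
  have l3 : |ρ t x| ≤ 2 * (Ct * E) * 1 := imp_lim (B := B) fun n => by rw [mul_one]; exact (hit n t ht x).2.2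
  nlinarith

/-- phase space -/
abbrev Ph (d : ℕ) : Type := Ed d × ℝ × Ed d

/-- uncurried Hamiltonian -/
def Hf (H : Ed d → ℝ → Ed d → ℝ) (q : Ph d) : ℝ := H q.1 q.2.1 q.2.2

/-- admissible set -/
def Om (d : ℕ) : Set (Ph d) := {q | 0 < q.2.1}

/-- embedding of the momentum variable -/
def jp (d : ℕ) : Ed d →L[ℝ] Ph d :=
  (ContinuousLinearMap.inr ℝ (Ed d) (ℝ × Ed d)).comp (ContinuousLinearMap.inr ℝ ℝ (Ed d))

/-- embedding of the density variable -/
def jm (d : ℕ) : ℝ →L[ℝ] Ph d :=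
  (ContinuousLinearMap.inr ℝ (Ed d) (ℝ × Ed d)).comp (ContinuousLinearMap.inl ℝ ℝ (Ed d))

lemma Om_open : IsOpen (Om d) := isOpen_lt continuous_const (continuous_fst.comp continuous_snd)

/-- Riesz map applied to the momentum part -/
def rz (d : ℕ) : (Ph d →L[ℝ] ℝ) →L[ℝ] Ed d where
  toFun l := (InnerProductSpace.toDual ℝ (Ed d)).symm (l.comp (jp d))
  map_add' l k := by simp
  map_smul' c l := by simp
  cont := (InnerProductSpace.toDual ℝ (Ed d)).symm.continuous.comp
    ((ContinuousLinearMap.compL ℝ (Ed d) (Ph d) ℝ).flip (jp d)).continuous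

lemma rz_inner (l : Ph d →L[ℝ] ℝ) (z : Ed d) : ⟪rz d l, z⟫ = l (jp d z) := by
  change ⟪(InnerProductSpace.toDual ℝ (Ed d)).symm (l.comp (jp d)), z⟫ = _
  rw [InnerProductSpace.toDual_symm_apply]; rfl

/-- H_p as a function on phase space -/
def hP (H : Ed d → ℝ → Ed d → ℝ) (q : Ph d) : Ed d := rz d (fderiv ℝ (Hf H) q)
/-- H_m as a function on phase space -/
def hM (H : Ed d → ℝ → Ed d → ℝ) (q : Ph d) : ℝ := fderiv ℝ (Hf H) q (jm d 1)
/-- H_pm as a function on phase space -/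
def hPM (H : Ed d → ℝ → Ed d → ℝ) (q : Ph d) : Ed d := rz d (fderiv ℝ (hM H) q)
/-- H_pp as a function on phase space -/
def hPP (H : Ed d → ℝ → Ed d → ℝ) (q : Ph d) : Ed d →L[ℝ] Ed d := (fderiv ℝ (hP H) q).comp (jp d)

lemma hasFDerivAt_p (x : Ed d) (m : ℝ) (p : Ed d) : HasFDerivAt (fun p => ((x, m, p) : Ph d)) (jp d) p := by
  have : (fun p => ((x, m, p) : Ph d)) = fun p => ((x, m, 0) : Ph d) + jp d p := by
    funext p; simp [jp]
  rw [this]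
  exact (jp d).hasFDerivAt.const_add _

lemma hasFDerivAt_m (x : Ed d) (m : ℝ) (p : Ed d) : HasFDerivAt (fun m => ((x, m, p) : Ph d)) (jm d) m := by
  have : (fun m => ((x, m, p) : Ph d)) = fun m => ((x, 0, p) : Ph d) + jm d m := by
    funext p; simp [jm]
  rw [this]
  exact (jm d).hasFDerivAt.const_add _

lemma hasFDerivAt_x (x : Ed d) (m : ℝ) (p : Ed d) :
    HasFDerivAt (fun x => ((x, m, p) : Ph d)) (ContinuousLinearMap.inl ℝ (Ed d) (ℝ × Ed d)) x := by
  have : (fun x => ((x, m, p) : Ph d)) = fun x => ((0, m, p) : Ph d) + ContinuousLinearMap.inl ℝ (Ed d) (ℝ × Ed d) x := by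
    funext p; simp
  rw [this]
  exact (ContinuousLinearMap.hasFDerivAt _).const_add _


lemma dHf {H : Ed d → ℝ → Ed d → ℝ} (hH : ContDiffOn ℝ 4 (Hf H) (Om d)) {q : Ph d} (hq : q ∈ Om d) : DifferentiableAt ℝ (Hf H) q :=
  (hH.differentiableOn (by norm_num)).differentiableAt (Om_open.mem_nhds hq)

lemma dF_cd {H : Ed d → ℝ → Ed d → ℝ} (hH : ContDiffOn ℝ 4 (Hf H) (Om d)) : ContDiffOn ℝ 3 (fderiv ℝ (Hf H)) (Om d) := hH.fderiv_of_isOpen Om_open (by norm_num)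

lemma hP_cd {H : Ed d → ℝ → Ed d → ℝ} (hH : ContDiffOn ℝ 4 (Hf H) (Om d)) : ContDiffOn ℝ 3 (hP H) (Om d) := (rz d).contDiff.comp_contDiffOn (dF_cd hH)

lemma hM_cd {H : Ed d → ℝ → Ed d → ℝ} (hH : ContDiffOn ℝ 4 (Hf H) (Om d)) : ContDiffOn ℝ 3 (hM H) (Om d) := (dF_cd hH).clm_apply contDiffOn_const

lemma hPM_cd {H : Ed d → ℝ → Ed d → ℝ} (hH : ContDiffOn ℝ 4 (Hf H) (Om d)) : ContDiffOn ℝ 2 (hPM H) (Om d) :=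
  (rz d).contDiff.comp_contDiffOn ((hM_cd hH).fderiv_of_isOpen Om_open (by norm_num))

lemma hPP_cd {H : Ed d → ℝ → Ed d → ℝ} (hH : ContDiffOn ℝ 4 (Hf H) (Om d)) : ContDiffOn ℝ 2 (hPP H) (Om d) :=
  ((hP_cd hH).fderiv_of_isOpen Om_open (by norm_num)).clm_comp contDiffOn_const

lemma dhP {H : Ed d → ℝ → Ed d → ℝ} (hH : ContDiffOn ℝ 4 (Hf H) (Om d)) {q : Ph d} (hq : q ∈ Om d) : DifferentiableAt ℝ (hP H) q :=
  ((hP_cd hH).differentiableOn (by norm_num)).differentiableAt (Om_open.mem_nhds hq)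

lemma dhM {H : Ed d → ℝ → Ed d → ℝ} (hH : ContDiffOn ℝ 4 (Hf H) (Om d)) {q : Ph d} (hq : q ∈ Om d) : DifferentiableAt ℝ (hM H) q :=
  ((hM_cd hH).differentiableOn (by norm_num)).differentiableAt (Om_open.mem_nhds hq)

lemma HamP_eq {H : Ed d → ℝ → Ed d → ℝ} (hH : ContDiffOn ℝ 4 (Hf H) (Om d)) (x : Ed d) {m : ℝ} (hm : 0 < m) (p : Ed d) : HamP H x m p = hP H (x, m, p) := by
  have h1 : HasFDerivAt (H x m) ((fderiv ℝ (Hf H) (x, m, p)).comp (jp d)) p :=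
    HasFDerivAt.comp (g := Hf H) (f := fun p => ((x, m, p) : Ph d)) p
      (dHf hH (q := (x, m, p)) hm).hasFDerivAt (hasFDerivAt_p x m p)
  rw [HamP, gradient, h1.fderiv]; rfl

lemma HamM_eq {H : Ed d → ℝ → Ed d → ℝ} (hH : ContDiffOn ℝ 4 (Hf H) (Om d)) (x : Ed d) {m : ℝ} (hm : 0 < m) (p : Ed d) : HamM H x m p = hM H (x, m, p) := by
  have h1 : HasFDerivAt (fun s => H x s p) ((fderiv ℝ (Hf H) (x, m, p)).comp (jm d)) m :=
    HasFDerivAt.comp (g := Hf H) (f := fun m => ((x, m, p) : Ph d)) m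
      (dHf hH (q := (x, m, p)) hm).hasFDerivAt (hasFDerivAt_m x m p)
  rw [HamM, h1.hasDerivAt.deriv]; rfl

lemma HamPM_eq {H : Ed d → ℝ → Ed d → ℝ} (hH : ContDiffOn ℝ 4 (Hf H) (Om d)) (x : Ed d) {m : ℝ} (hm : 0 < m) (p : Ed d) : HamPM H x m p = hPM H (x, m, p) := by
  have e : (fun q => HamM H x m q) = fun q => hM H (x, m, q) := funext fun q => HamM_eq hH x hm q
  have h1 : HasFDerivAt (fun q => hM H (x, m, q)) ((fderiv ℝ (hM H) (x, m, p)).comp (jp d)) p :=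
    HasFDerivAt.comp (g := hM H) (f := fun p => ((x, m, p) : Ph d)) p
      (dhM hH (q := (x, m, p)) hm).hasFDerivAt (hasFDerivAt_p x m p)
  rw [HamPM, e, gradient, h1.fderiv]; rfl

lemma hP_fp {H : Ed d → ℝ → Ed d → ℝ} (hH : ContDiffOn ℝ 4 (Hf H) (Om d)) (x : Ed d) {m : ℝ} (hm : 0 < m) (p : Ed d) :
    HasFDerivAt (fun q => hP H (x, m, q)) (hPP H (x, m, p)) p :=
  HasFDerivAt.comp (g := hP H) (f := fun p => ((x, m, p) : Ph d)) p
      (dhP hH (q := (x, m, p)) hm).hasFDerivAt (hasFDerivAt_p x m p)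

lemma HamPP_eq {H : Ed d → ℝ → Ed d → ℝ} (hH : ContDiffOn ℝ 4 (Hf H) (Om d)) (x : Ed d) {m : ℝ} (hm : 0 < m) (p : Ed d) : HamPP H x m p = hPP H (x, m, p) := by
  have e : (fun q => HamP H x m q) = fun q => hP H (x, m, q) := funext fun q => HamP_eq hH x hm q
  rw [HamPP, e, (hP_fp hH x hm p).fderiv]

lemma HamPx_eq {H : Ed d → ℝ → Ed d → ℝ} (hH : ContDiffOn ℝ 4 (Hf H) (Om d)) (x : Ed d) {m : ℝ} (hm : 0 < m) (p : Ed d) : fderiv ℝ (fun y => HamP H y m p) x =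
    (fderiv ℝ (hP H) (x, m, p)).comp (ContinuousLinearMap.inl ℝ (Ed d) (ℝ × Ed d)) := by
  have e : (fun y => HamP H y m p) = fun y => hP H (y, m, p) := funext fun q => HamP_eq hH q hm p
  rw [e]
  exact (HasFDerivAt.comp (g := hP H) (f := fun x => ((x, m, p) : Ph d)) x
      (dhP hH (q := (x, m, p)) hm).hasFDerivAt (hasFDerivAt_x x m p)).fderiv

lemma snd_symm {H : Ed d → ℝ → Ed d → ℝ} (hH : ContDiffOn ℝ 4 (Hf H) (Om d)) {q : Ph d} (hq : q ∈ Om d) (y z : Ph d) :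
    fderiv ℝ (fderiv ℝ (Hf H)) q y z = fderiv ℝ (fderiv ℝ (Hf H)) q z y := by
  have := (hH.contDiffAt (Om_open.mem_nhds hq)).isSymmSndFDerivAt (by simp; norm_num)
  exact this y z

lemma fderiv_hP_inner {H : Ed d → ℝ → Ed d → ℝ} (hH : ContDiffOn ℝ 4 (Hf H) (Om d)) {q : Ph d} (hq : q ∈ Om d) (y : Ph d) (z : Ed d) :
    ⟪fderiv ℝ (hP H) q y, z⟫ = fderiv ℝ (fderiv ℝ (Hf H)) q y (jp d z) := by
  have h1 : DifferentiableAt ℝ (fderiv ℝ (Hf H)) q :=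
    ((dF_cd hH).differentiableOn (by norm_num)).differentiableAt (Om_open.mem_nhds hq)
  have h2 : HasFDerivAt (hP H) ((rz d).comp (fderiv ℝ (fderiv ℝ (Hf H)) q)) q :=
    (rz d).hasFDerivAt.comp q h1.hasFDerivAt
  rw [h2.fderiv, ContinuousLinearMap.comp_apply, rz_inner]

lemma fderiv_hM {H : Ed d → ℝ → Ed d → ℝ} (hH : ContDiffOn ℝ 4 (Hf H) (Om d)) {q : Ph d} (hq : q ∈ Om d) (y : Ph d) :
    fderiv ℝ (hM H) q y = fderiv ℝ (fderiv ℝ (Hf H)) q y (jm d 1) := by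
  have h1 : DifferentiableAt ℝ (fderiv ℝ (Hf H)) q :=
    ((dF_cd hH).differentiableOn (by norm_num)).differentiableAt (Om_open.mem_nhds hq)
  have h2 := h1.hasFDerivAt.clm_apply (hasFDerivAt_const (jm d 1) q)
  unfold hM
  rw [h2.fderiv]; simp

lemma hPP_symm {H : Ed d → ℝ → Ed d → ℝ} (hH : ContDiffOn ℝ 4 (Hf H) (Om d)) {q : Ph d} (hq : q ∈ Om d) (y z : Ed d) : ⟪hPP H q y, z⟫ = ⟪y, hPP H q z⟫ := by
  rw [real_inner_comm (hPP H q z) y]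
  change ⟪fderiv ℝ (hP H) q (jp d y), z⟫ = ⟪fderiv ℝ (hP H) q (jp d z), y⟫
  rw [fderiv_hP_inner hH hq, fderiv_hP_inner hH hq, snd_symm hH hq]

lemma hP_fm {H : Ed d → ℝ → Ed d → ℝ} (hH : ContDiffOn ℝ 4 (Hf H) (Om d)) {q : Ph d} (hq : q ∈ Om d) : fderiv ℝ (hP H) q (jm d 1) = hPM H q := by
  refine ext_inner_right ℝ fun z => ?_
  rw [fderiv_hP_inner hH hq, hPM, rz_inner, fderiv_hM hH hq, snd_symm hH hq]

lemma jdecomp (z : Ed d) (r : ℝ) (w : Ed d) : ((z, r, w) : Ph d) =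
    ContinuousLinearMap.inl ℝ (Ed d) (ℝ × Ed d) z + r • jm d 1 + jp d w := by
  simp [jm, jp]

/-- facts on the Hamiltonian in phase space form -/
structure HFacts (H : Ed d → ℝ → Ed d → ℝ) (K : ℝ) : Prop where
  hK : 0 < K
  cd : ContDiffOn ℝ 4 (Hf H) (Om d)
  px : ∀ x m p, 0 < m → ‖(fderiv ℝ (hP H) (x, m, p)).comp (ContinuousLinearMap.inl ℝ (Ed d) (ℝ × Ed d))‖ ≤ K * (‖p‖ + 1)
  pm : ∀ x m p, 0 < m → ‖hPM H (x, m, p)‖ ≤ K * ‖p‖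
  pp : ∀ x m p, 0 < m → ‖hPP H (x, m, p)‖ ≤ K
  pos : ∀ x m p, 0 < m → ∀ (r : ℝ) (q : Ed d),
    0 ≤ -hM H (x, m, p) * r ^ 2 + m * ⟪hPM H (x, m, p), q⟫ * r + m * ⟪hPP H (x, m, p) q, q⟫

lemma A2.facts {H : Ed d → ℝ → Ed d → ℝ} (h : A2 H) : ∃ K, HFacts H K := by
  obtain ⟨hH, ⟨K, hK, h2⟩, h3⟩ := h
  have hH' : ContDiffOn ℝ 4 (Hf H) (Om d) := hH
  refine ⟨K, hK, hH', ?_, ?_, ?_, ?_⟩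
  · intro x m p hm
    rw [← HamPx_eq hH' x hm p]
    exact (h2 x m hm p).1
  · intro x m p hm
    rw [← HamPM_eq hH' x hm p]
    exact (h2 x m hm p).2.2.1
  · intro x m p hm
    rw [← HamPP_eq hH' x hm p]
    have := (h2 x m hm p).2.2.2.2.1
    have h0 := norm_nonneg (fderiv ℝ (fun q => HamPM H x m q) p)
    linarith
  · intro x m p hm r q
    by_cases hz : r = 0 ∧ q = 0
    · obtain ⟨rfl, rfl⟩ := hz
      simp
    · have := (h3 x m hm p r q hz).le
      rwa [HamM_eq hH' x hm p, HamPM_eq hH' x hm p, HamPP_eq hH' x hm p] at this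

lemma HFacts.P0_lip {H : Ed d → ℝ → Ed d → ℝ} {K : ℝ} (F : HFacts H K) (x y : Ed d) :
    ‖hP H (x, 1, 0) - hP H (y, 1, 0)‖ ≤ K * ‖x - y‖ := by
  have hd : ∀ z : Ed d, HasFDerivAt (fun x => hP H (x, 1, 0))
      ((fderiv ℝ (hP H) (z, 1, 0)).comp (ContinuousLinearMap.inl ℝ (Ed d) (ℝ × Ed d))) z := fun z =>
    HasFDerivAt.comp (g := hP H) (f := fun x => ((x, 1, 0) : Ph d)) z
      (dhP F.cd (q := (z, 1, 0)) (by simp [Om])).hasFDerivAt (hasFDerivAt_x z 1 0)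
  refine Convex.norm_image_sub_le_of_norm_hasFDerivWithin_le (s := univ)
    (fun z _ => (hd z).hasFDerivWithinAt) (fun z _ => ?_) convex_univ (mem_univ _) (mem_univ _)
  simpa using F.px z 1 0 one_pos

lemma HFacts.P_sub {H : Ed d → ℝ → Ed d → ℝ} {K : ℝ} (F : HFacts H K) (x : Ed d) {m : ℝ} (hm : 0 < m)
    (p : Ed d) : ‖hP H (x, m, p) - hP H (x, 1, 0)‖ ≤ K * ‖p‖ := by
  have h1 : hP H (x, m, 0) = hP H (x, 1, 0) := by
    have hd : ∀ s : ℝ, 0 < s → HasFDerivAt (fun s => hP H (x, s, 0))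
        ((fderiv ℝ (hP H) (x, s, 0)).comp (jm d)) s := fun s hs =>
      HasFDerivAt.comp (g := hP H) (f := fun s => ((x, s, 0) : Ph d)) s
        (dhP F.cd (q := (x, s, 0)) hs).hasFDerivAt (hasFDerivAt_m x s 0)
    have := Convex.norm_image_sub_le_of_norm_hasFDerivWithin_le (s := Ioi (0:ℝ)) (C := 0)
      (f := fun s => hP H (x, s, 0)) (x := 1) (y := m)
      (fun z hz => (hd z hz).hasFDerivWithinAt) (fun z hz => ?_) (convex_Ioi 0) (by simp) hm
    · rw [zero_mul] at this
      exact sub_eq_zero.1 (norm_le_zero_iff.1 this)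
    · have e : (fderiv ℝ (hP H) (x, z, 0)).comp (jm d) = 0 := by
        refine ContinuousLinearMap.ext_ring ?_
        change fderiv ℝ (hP H) (x, z, 0) (jm d 1) = 0
        rw [hP_fm F.cd (q := (x, z, 0)) hz]
        have := F.pm x z 0 hz
        rw [norm_zero, mul_zero] at this
        exact norm_le_zero_iff.1 this
      rw [e, norm_zero]
  rw [← h1]
  have := Convex.norm_image_sub_le_of_norm_hasFDerivWithin_le (s := univ) (C := K)
      (f := fun q => hP H (x, m, q)) (x := 0) (y := p)
      (fun z _ => (hP_fp F.cd x hm z).hasFDerivWithinAt) (fun z _ => F.pp x m z hm) convex_univ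
      (mem_univ _) (mem_univ _)
  simpa using this

lemma HFacts.fderiv_le {H : Ed d → ℝ → Ed d → ℝ} {K : ℝ} (F : HFacts H K) (x : Ed d) {m : ℝ} (hm : 0 < m)
    (p z : Ed d) (r : ℝ) (w : Ed d) : ‖fderiv ℝ (hP H) (x, m, p) (z, r, w)‖ ≤
      K * (‖p‖ + 1) * ‖z‖ + |r| * (K * ‖p‖) + K * ‖w‖ := by
  rw [jdecomp z r w, map_add, map_add, map_smul, hP_fm F.cd (q := (x, m, p)) hm]
  refine (norm_add₃_le).trans ?_
  refine add_le_add (add_le_add ?_ ?_) ?_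
  · exact ((fderiv ℝ (hP H) (x, m, p)).comp (ContinuousLinearMap.inl ℝ (Ed d) (ℝ × Ed d))).le_of_opNorm_le
      (F.px x m p hm) z
  · rw [norm_smul, Real.norm_eq_abs]
    exact mul_le_mul_of_nonneg_left (F.pm x m p hm) (abs_nonneg _)
  · exact (hPP H (x, m, p)).le_of_opNorm_le (F.pp x m p hm) w

/-- the phase point map at a fixed time -/
def pt (u m : Ed d → ℝ) (x : Ed d) : Ph d := (x, m x, sgrad u x)

lemma pt_cd {u m : Ed d → ℝ} (hu : ContDiff ℝ 2 u) (hm : ContDiff ℝ 2 m) : ContDiff ℝ 1 (pt u m) :=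
  contDiff_id.prodMk ((hm.of_le (by norm_num)).prodMk (sgrad_contDiff hu))

lemma comp_pt_cd {E : Type*} [NormedAddCommGroup E] [NormedSpace ℝ E] {g : Ph d → E} {u m : Ed d → ℝ}
    (hu : ContDiff ℝ 2 u) (hm : ContDiff ℝ 2 m) (hp : ∀ x, 0 < m x) (hg : ContDiffOn ℝ 1 g (Om d)) :
    ContDiff ℝ 1 (fun x => g (pt u m x)) :=
  hg.comp_contDiff (pt_cd hu hm) (fun x => hp x)

lemma HFacts.diverg_le {H : Ed d → ℝ → Ed d → ℝ} {K : ℝ} (F : HFacts H K) {u m : Ed d → ℝ} {B : ℝ}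
    (hB : 0 ≤ B)
    (hu : ContDiff ℝ 2 u) (hm : ContDiff ℝ 2 m) (hp : ∀ x, 0 < m x)
    (bu : ∀ x, ‖sgrad u x‖ ≤ B) (bu2 : ∀ x, ‖fderiv ℝ (sgrad u) x‖ ≤ B) (bm : ∀ x, ‖sgrad m x‖ ≤ B)
    (x : Ed d) : |diverg (fun x => hP H (pt u m x)) x| ≤ d * (K * (B + 1) + B * (K * B) + K * B) := by
  have hK := F.hK
  have hmd : DifferentiableAt ℝ m x := hm.differentiable (by norm_num) x
  have h1 : HasFDerivAt (pt u m) ((ContinuousLinearMap.id ℝ (Ed d)).prod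
      ((fderiv ℝ m x).prod (fderiv ℝ (sgrad u) x))) x :=
    (hasFDerivAt_id x).prodMk (hmd.hasFDerivAt.prodMk
      ((sgrad_contDiff hu).differentiable (by norm_num) x).hasFDerivAt)
  have h2 := (dhP F.cd (q := pt u m x) (hp x)).hasFDerivAt.comp x h1
  rw [diverg]
  have h3 : ∀ i : Fin d, |⟪fderiv ℝ (fun x => hP H (pt u m x)) x (ebasis d i), ebasis d i⟫| ≤
      K * (B + 1) + B * (K * B) + K * B := by
    intro i
    refine (abs_real_inner_le_norm _ _).trans ?_
    rw [ebasis_norm, mul_one]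
    have e : fderiv ℝ (fun x => hP H (pt u m x)) x = _ := h2.fderiv
    rw [e]
    refine (F.fderiv_le x (hp x) (sgrad u x) (ebasis d i) (fderiv ℝ m x (ebasis d i))
      (fderiv ℝ (sgrad u) x (ebasis d i))).trans ?_
    have a1 : |fderiv ℝ m x (ebasis d i)| ≤ B := by
      rw [fderiv_eq_inner_sgrad m x _ hmd]
      refine (abs_real_inner_le_norm _ _).trans ?_
      rw [ebasis_norm, mul_one]; exact bm x
    have a2 : ‖fderiv ℝ (sgrad u) x (ebasis d i)‖ ≤ B := by
      have := (fderiv ℝ (sgrad u) x).le_of_opNorm_le (bu2 x) (ebasis d i)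
      rwa [ebasis_norm, mul_one] at this
    have a3 := bu x
    rw [ebasis_norm, mul_one]
    gcongr
  refine (Finset.abs_sum_le_sum_abs _ _).trans ((Finset.sum_le_sum fun i _ => h3 i).trans ?_)
  simp [mul_add]

lemma hM_bdd {H : Ed d → ℝ → Ed d → ℝ} {K : ℝ} (F : HFacts H K) {T R : ℝ} {u m : ℝ → Ed d → ℝ}
    (hu : Nice T u) (hm : Nice T m) (hp : ∀ t ∈ Icc (0:ℝ) T, ∀ x, 0 < m t x) :
    ∃ C, 0 ≤ C ∧ ∀ t ∈ Icc (0:ℝ) T, ∀ x : Ed d, ‖x‖ ≤ R → |hM H (pt (u t) (m t) x)| ≤ C := by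
  have hc : ContinuousOn (fun q : ℝ × Ed d => hM H (pt (u q.1) (m q.1) q.2))
      (Icc 0 T ×ˢ Metric.closedBall 0 R) := by
    refine (hM_cd F.cd).continuousOn.comp ?_ (fun q hq => hp q.1 hq.1 q.2)
    have : ContinuousOn (fun q : ℝ × Ed d => pt (u q.1) (m q.1) q.2) (Icc 0 T ×ˢ univ) :=
      continuousOn_snd.prodMk (hm.cont.prodMk hu.contg)
    exact this.mono (prod_mono le_rfl (subset_univ _))
  obtain ⟨C, hC⟩ := (isCompact_Icc.prod (isCompact_closedBall (0 : Ed d) R)).exists_bound_of_continuousOn hc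
  refine ⟨max C 0, le_max_right _ _, fun t ht x hx => ?_⟩
  exact (hC (t, x) ⟨ht, by simpa using hx⟩).trans (le_max_left _ _)

/-- Lemma `v rho estimate`: stability of the linearized system.
Let `(u,m)` be the classical solution of the MFG system. There is a constant
`C > 0`, depending only on the coefficients of the problem (not on `a, b, v,
ρ`), such that for every continuous `a`, every continuous vector field `b`
(spatially differentiable, so that `div b` makes sense classically), and every
classical solution `(v,ρ)` of the perturbed linearized system
(i)  `-∂ₜv - Δv + H_p(x,m,Du)·Dv + H_m(x,m,Du)ρ = f'(m)ρ + a`;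
(ii) `∂ₜρ - Δρ - div(ρH_p(x,m,Du)) - div(mρH_pm(x,m,Du))
        = div(mH_pp(x,m,Du)Dv) + div(b)`;
with `ρ(·,0) = 0`, `v(·,T) = 0`, one has
`‖v‖_{C^{1,0}} + ‖ρ‖_{C⁰} ≤ C(‖a‖_{C⁰} + ‖b‖_{C⁰})`, expressed here through
arbitrary sup-bounds `Ca, Cb` of `a` and `b` on `Q`. -/
theorem linearized_mfg_stability
    (d : ℕ) (hd : 1 ≤ d) (T α ϑ : ℝ) (hT : 0 < T) (hα : α ∈ Ioo (0:ℝ) 1)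
    (hϑ : 0 < ϑ) (H : Ed d → ℝ → Ed d → ℝ) (f : ℝ → ℝ) (m0 uT : Ed d → ℝ)
    (hA1 : A1 α ϑ m0 uT) (hA2 : A2 H) (hA3 : A3 f)
    (u m : ℝ → Ed d → ℝ) (hu : InC2alpha T α u) (hm : InC2alpha T α m)
    (hsol : SolvesMFG T H f m0 uT u m)
    (hmpos : ∀ t ∈ Icc (0:ℝ) T, ∀ x : Ed d, 0 < m t x) :
    ∃ C : ℝ, 0 < C ∧
      ∀ (a : ℝ → Ed d → ℝ) (b : ℝ → Ed d → Ed d) (v ρ : ℝ → Ed d → ℝ)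
        (Ca Cb : ℝ),
        Continuous (fun q : ℝ × Ed d => a q.1 q.2) →
        Continuous (fun q : ℝ × Ed d => b q.1 q.2) →
        (∀ t ∈ Icc (0:ℝ) T, Differentiable ℝ (b t)) →
        InC2alpha T α v → InC2alpha T α ρ →
        (∀ t ∈ Icc (0:ℝ) T, ∀ x : Ed d,
          -tderiv T v t x - lap (v t) x +
              ⟪HamP H x (m t x) (sgrad (u t) x), sgrad (v t) x⟫ +
              HamM H x (m t x) (sgrad (u t) x) * ρ t x =
            deriv f (m t x) * ρ t x + a t x) →
        (∀ t ∈ Icc (0:ℝ) T, ∀ x : Ed d,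
          tderiv T ρ t x - lap (ρ t) x -
              diverg (fun y => ρ t y • HamP H y (m t y) (sgrad (u t) y)) x -
              diverg (fun y =>
                (m t y * ρ t y) • HamPM H y (m t y) (sgrad (u t) y)) x =
            diverg (fun y =>
              m t y • HamPP H y (m t y) (sgrad (u t) y) (sgrad (v t) y)) x +
            diverg (b t) x) →
        (∀ x : Ed d, ρ 0 x = 0) → (∀ x : Ed d, v T x = 0) →
        (∀ t ∈ Icc (0:ℝ) T, ∀ x : Ed d, |a t x| ≤ Ca) →
        (∀ t ∈ Icc (0:ℝ) T, ∀ x : Ed d, ‖b t x‖ ≤ Cb) →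
        ∀ t ∈ Icc (0:ℝ) T, ∀ x : Ed d,
          |v t x| + ‖sgrad (v t) x‖ + |ρ t x| ≤ C * (Ca + Cb) := by
  have hFx := hA2.facts
  obtain ⟨K, F⟩ := hFx
  have hK := F.hK
  obtain ⟨-, ⟨Cf, hCf⟩, hf0⟩ := hA3
  have hun : Nice T u := hu.nice hT hα.1
  have hmn : Nice T m := hm.nice hT hα.1
  obtain ⟨Bu, hBu, bu⟩ := hun.bdd
  obtain ⟨Bm, hBm, bm⟩ := hmn.bdd
  obtain ⟨CM, hCM, hM0⟩ := hM_bdd (R := (d : ℝ) + 1) F hun hmn hmpos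
  have hCf0 : 0 ≤ Cf := (abs_nonneg _).trans (hCf 1 one_pos).1
  set B := Bu + Bm with hBdef
  have hB : 0 ≤ B := by positivity
  have hBu' : Bu ≤ B := by linarith
  have hBm' : Bm ≤ B := by linarith
  set N0 := ‖hP H ((0 : Ed d), (1:ℝ), (0 : Ed d))‖ with hN0
  have hN00 : 0 ≤ N0 := norm_nonneg _
  set k1 := K * B
  set k2 := (d : ℝ) * (K * (B + 1) + B * (K * B) + K * B)
  set k3 := B * (K * B)
  set k4 := N0 + K * (d + 1) + K * B
  have hk1 : 0 ≤ k1 := by positivity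
  have hk2 : 0 ≤ k2 := by positivity
  have hk3 : 0 ≤ k3 := by positivity
  have hk4 : 0 ≤ k4 := by positivity
  obtain ⟨L, hLdef⟩ : ∃ L, L = 1 + K + k1 + k2 + k3 + k4 + Cf + CM := ⟨_, rfl⟩
  have hL : 1 ≤ L := by linarith
  obtain ⟨C, hC, hst⟩ := Sys.stab hd T L hT hL (fun x : Ed d => hP H (x, 1, 0)) (fun x y =>
    (F.P0_lip x y).trans (mul_le_mul_of_nonneg_right (by linarith) (norm_nonneg _)))
  refine ⟨C, hC, ?_⟩
  intro a b v ρ Ca Cb _ _ hbd hv hr he1 he2 hini hfin hCa hCb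
  have h0T : (0:ℝ) ∈ Icc (0:ℝ) T := ⟨le_rfl, hT.le⟩
  refine hst (P := fun t x => hP H (pt (u t) (m t) x)) (Q := fun t x => m t x • hPM H (pt (u t) (m t) x))
    (Bm := fun t x => m t x • hPP H (pt (u t) (m t) x))
    (h := fun t x => deriv f (m t x) - hM H (pt (u t) (m t) x)) (a := a) (b := b) (v := v) (ρ := ρ) ?_
    ((abs_nonneg _).trans (hCa 0 h0T 0)) ((norm_nonneg _).trans (hCb 0 h0T 0))
  have hvn : Nice T v := hv.nice hT hα.1
  have hrn : Nice T ρ := hr.nice hT hα.1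
  have gu : ∀ t ∈ Icc (0:ℝ) T, ∀ x, ‖sgrad (u t) x‖ ≤ B := fun t ht x => (bu t ht x).2.1.trans hBu'
  have gm : ∀ t ∈ Icc (0:ℝ) T, ∀ x, |m t x| ≤ B := fun t ht x => (bm t ht x).1.trans hBm'
  have hPP0 : ∀ t ∈ Icc (0:ℝ) T, ∀ x, ‖hP H (pt (u t) (m t) x) - hP H (x, 1, 0)‖ ≤ k1 := fun t ht x =>
    (F.P_sub x (hmpos t ht x) _).trans (mul_le_mul_of_nonneg_left (gu t ht x) hK.le)
  refine ⟨hT, hvn, hrn, ?_, ?_, hini, hfin⟩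
  · intro t ht M mv mg mr
    have hpos := hmpos t ht
    have u2 := hun.c2 t ht
    have m2 := hmn.c2 t ht
    have v2 := hvn.c2 t ht
    have r2 := hrn.c2 t ht
    have m1 : ContDiff ℝ 1 (m t) := m2.of_le (by norm_num)
    have r1 : ContDiff ℝ 1 (ρ t) := r2.of_le (by norm_num)
    have Pc : ContDiff ℝ 1 (fun x => hP H (pt (u t) (m t) x)) :=
      comp_pt_cd u2 m2 hpos ((hP_cd F.cd).of_le (by norm_num))
    have Qc : ContDiff ℝ 1 (fun x => m t x • hPM H (pt (u t) (m t) x)) :=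
      m1.smul (comp_pt_cd u2 m2 hpos ((hPM_cd F.cd).of_le (by norm_num)))
    have Bc : ContDiff ℝ 1 (fun x => m t x • hPP H (pt (u t) (m t) x)) :=
      m1.smul (comp_pt_cd u2 m2 hpos ((hPP_cd F.cd).of_le (by norm_num)))
    have d1 : Differentiable ℝ (fun x => ρ t x • hP H (pt (u t) (m t) x)) :=
      (r1.smul Pc).differentiable (by norm_num)
    have d2 : Differentiable ℝ (fun x => ρ t x • (m t x • hPM H (pt (u t) (m t) x))) :=
      (r1.smul Qc).differentiable (by norm_num)
    have d3 : Differentiable ℝ (fun x => (m t x • hPP H (pt (u t) (m t) x)) (sgrad (v t) x)) :=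
      (Bc.clm_apply (sgrad_contDiff v2)).differentiable (by norm_num)
    refine ⟨hL, v2, r2, hvn.per t ht, hrn.per t ht, ?_, Pc, ?_, Qc.continuous, ?_, ?_, ?_, Bc.continuous,
      ?_, Nice.slice_cont hvn.contt ht, Nice.slice_cont hrn.contt ht, ?_, ?_, ?_, hCa t ht, hCb t ht,
      mv, mg, mr⟩
    · intro x
      exact (hPP0 t ht x).trans (by linarith)
    · intro x
      exact (F.diverg_le hB u2 m2 hpos (gu t ht) (fun x => (bu t ht x).2.2.trans hBu')
        (fun x => (bm t ht x).2.1.trans hBm') x).trans (by linarith)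
    · intro x
      rw [norm_smul, Real.norm_eq_abs]
      refine (mul_le_mul (gm t ht x) ((F.pm x _ _ (hpos x)).trans
        (mul_le_mul_of_nonneg_left (gu t ht x) hK.le)) (norm_nonneg _) hB).trans (by linarith)
    · intro x y z
      simp only [ContinuousLinearMap.smul_apply, real_inner_smul_left, real_inner_smul_right]
      rw [hPP_symm F.cd (q := pt (u t) (m t) x) (hpos x)]
    · intro x
      rw [norm_smul, Real.norm_eq_abs]
      refine (mul_le_mul (gm t ht x) (F.pp x _ _ (hpos x)) (norm_nonneg _) hB).trans ?_
      have : B * K = k1 := mul_comm _ _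
      linarith
    · intro x r ξ
      have h1 := F.pos x (m t x) (sgrad (u t) x) (hpos x) r ξ
      have h2 := mul_nonneg (hf0 _ (hpos x)) (sq_nonneg r)
      simp only [ContinuousLinearMap.smul_apply, real_inner_smul_left]
      change 0 ≤ (deriv f (m t x) - hM H (x, m t x, sgrad (u t) x)) * r ^ 2 +
        m t x * ⟪hPM H (x, m t x, sgrad (u t) x), ξ⟫ * r + m t x * ⟪hPP H (x, m t x, sgrad (u t) x) ξ, ξ⟫
      nlinarith
    · exact ((d1.add d2).add d3).add (hbd t ht)
    · intro x
      have h1 := he1 t ht x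
      rw [HamP_eq F.cd x (hpos x), HamM_eq F.cd x (hpos x)] at h1
      change tderiv T v t x = - lap (v t) x + ⟪hP H (x, m t x, sgrad (u t) x), sgrad (v t) x⟫ -
        (deriv f (m t x) - hM H (x, m t x, sgrad (u t) x)) * ρ t x - a t x
      linarith
    · intro x
      have h1 := he2 t ht x
      have e1 : (fun y => ρ t y • HamP H y (m t y) (sgrad (u t) y)) =
          fun y => ρ t y • hP H (pt (u t) (m t) y) := funext fun y => by
        rw [HamP_eq F.cd y (hpos y)]; rfl
      have e2 : (fun y => (m t y * ρ t y) • HamPM H y (m t y) (sgrad (u t) y)) =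
          fun y => ρ t y • (m t y • hPM H (pt (u t) (m t) y)) := funext fun y => by
        rw [HamPM_eq F.cd y (hpos y), mul_comm, mul_smul]; rfl
      have e3 : (fun y => m t y • HamPP H y (m t y) (sgrad (u t) y) (sgrad (v t) y)) =
          fun y => (m t y • hPP H (pt (u t) (m t) y)) (sgrad (v t) y) := funext fun y => by
        rw [HamPP_eq F.cd y (hpos y)]; rfl
      rw [e1, e2, e3] at h1
      have e4 := diverg_add _ _ x (((d1.add d2).add d3) x) (hbd t ht x)
      have e5 := diverg_add _ _ x ((d1.add d2) x) (d3 x)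
      have e6 := diverg_add _ _ x (d1 x) (d2 x)
      have e7 : diverg (flux (fun x => hP H (pt (u t) (m t) x)) (fun x => m t x • hPM H (pt (u t) (m t) x))
        (fun x => m t x • hPP H (pt (u t) (m t) x)) (b t) (v t) (ρ t)) x = _ := e4.trans
          (congrArg (· + diverg (b t) x) (e5.trans (congrArg (· + _) e6)))
      rw [e7]
      linarith
  · intro t ht x hx
    constructor
    · refine (abs_sub _ _).trans ?_
      have h1 := (hCf _ (hmpos t ht x)).2.1
      have h2 := hM0 t ht x hx
      linarith
    · have h1 := hPP0 t ht x
      have h2 := F.P0_lip x 0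
      rw [sub_zero] at h2
      have h3 : K * ‖x‖ ≤ K * (d + 1) := mul_le_mul_of_nonneg_left hx hK.le
      have h4 : hP H (pt (u t) (m t) x) = (hP H (pt (u t) (m t) x) - hP H (x, 1, 0)) +
        (hP H (x, 1, 0) - hP H (0, 1, 0)) + hP H (0, 1, 0) := by abel
      have h5 : ‖hP H (pt (u t) (m t) x)‖ ≤ k1 + K * (d + 1) + N0 := by
        rw [h4]
        refine norm_add₃_le.trans ?_
        exact add_le_add (add_le_add h1 (h2.trans h3)) le_rfl
      refine h5.trans ?_
      have : k4 = N0 + K * (d + 1) + k1 := rfl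
      linarith
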